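/- (Gårding's inequality for SG M-elliptic operators) Let m₁, m₂ ∈ ℝ and let σ ∈ M^{2m₁,2m₂}_{ρ,Λ} be strongly SG M-elliptic: there exist C > 0 and R > 0 with Re σ(x,ξ) ≥ C Λ(x)^{2m₂} Λ(ξ)^{2m₁} whenever |x|² + |ξ|² ≥ R². Then there exists a constant C' > 0 and, for all real numbers s₁ ≤ ρ/2 and s₂ ≥ ρ/2, a constant C_{s₁,s₂} > 0 such that for all φ ∈ 𝒮(ℝⁿ), Re ∫_{ℝⁿ} (T_σφ)(x) \overline{φ(x)} dx ≥ C' ‖φ‖²_{m₁,m₂,2,Λ} − C_{s₁,s₂} ‖φ‖²_{m₁−s₁,m₂−s₂,2,Λ}. -/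

import Mathlib

open MeasureTheory Real Filter
open scoped RealInnerProductSpace BigOperators ENNReal

noncomputable section

/-- Euclidean space ℝⁿ. -/
abbrev En (n : ℕ) : Type := EuclideanSpace ℝ (Fin n)

/-- Partial derivative in the `i`-th coordinate direction. -/
def pd {n : ℕ} {F : Type*} [NormedAddCommGroup F] [NormedSpace ℝ F]
    (i : Fin n) (f : En n → F) : En n → F :=
  fun x => fderiv ℝ f x (EuclideanSpace.single i 1)

/-- Iterated partial derivative `∂^α` for a multi-index `α`. -/
def mpd {n : ℕ} {F : Type*} [NormedAddCommGroup F] [NormedSpace ℝ F]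
    (α : Fin n → ℕ) (f : En n → F) : En n → F :=
  (List.finRange n).foldr (fun i g => (pd i)^[α i] g) f

/-- Mixed derivative `∂_x^α ∂_ξ^β σ` of a symbol. -/
def mixpd {n : ℕ} (α β : Fin n → ℕ) (σ : En n → En n → ℂ) : En n → En n → ℂ :=
  fun x ξ => mpd α (fun y => mpd β (σ y) ξ) x

/-- `Λ` is a weight function of polynomial growth with parameters `μ₀ ≤ μ₁ ≤ μ`. -/
structure IsWeight (n : ℕ) (Λ : En n → ℝ) (μ₀ μ₁ μ : ℝ) : Prop where
  pos : ∀ ξ, 0 < Λ ξ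
  smooth : ContDiff ℝ (⊤ : ℕ∞) Λ
  growth : ∃ C₀ C₁ : ℝ, 0 < C₀ ∧ C₀ ≤ C₁ ∧ ∀ ξ : En n,
    C₀ * (1 + ‖ξ‖) ^ μ₀ ≤ Λ ξ ∧ Λ ξ ≤ C₁ * (1 + ‖ξ‖) ^ μ₁
  hμ₀ : 0 < μ₀
  hμ₀₁ : μ₀ ≤ μ₁
  hμ₁ : μ₁ ≤ μ
  deriv_bound : ∀ (α γ : Fin n → ℕ), (∀ i, γ i ≤ 1) →
    ∃ C > 0, ∀ ξ : En n,
      |(∏ i, ξ i ^ γ i) * mpd (α + γ) Λ ξ| ≤ C * Λ ξ ^ (1 - (∑ i, (α i : ℝ)) / μ)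

/-- The symbol class `S^m_{ρ,Λ}`. -/
def SClass {n : ℕ} (Λ : En n → ℝ) (ρ m : ℝ) (σ : En n → En n → ℂ) : Prop :=
  ContDiff ℝ (⊤ : ℕ∞) (fun q : En n × En n => σ q.1 q.2) ∧
  ∀ α β : Fin n → ℕ, ∃ C > 0, ∀ x ξ : En n,
    ‖mixpd α β σ x ξ‖ ≤ C * Λ ξ ^ (m - ρ * ∑ i, (β i : ℝ))

/-- The symbol class `M^m_{ρ,Λ}`. -/
def MClass {n : ℕ} (Λ : En n → ℝ) (ρ m : ℝ) (σ : En n → En n → ℂ) : Prop :=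
  ∀ γ : Fin n → ℕ, (∀ i, γ i ≤ 1) →
    SClass Λ ρ m (fun x ξ => ((∏ i, ξ i ^ γ i : ℝ) : ℂ) * mixpd 0 γ σ x ξ)

/-- The Fourier transform `φ̂(ξ) = (2π)^{-n/2} ∫ e^{-ix·ξ} φ(x) dx`. -/
def ft {n : ℕ} (φ : En n → ℂ) (ξ : En n) : ℂ :=
  (((2 * Real.pi) ^ (-(n : ℝ) / 2) : ℝ) : ℂ) *
    ∫ (x : En n), Complex.exp (-Complex.I * (⟪x, ξ⟫ : ℂ)) * φ x

/-- The pseudo-differential operator `T_σ`. -/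
def pdo {n : ℕ} (σ : En n → En n → ℂ) (φ : En n → ℂ) (x : En n) : ℂ :=
  (((2 * Real.pi) ^ (-(n : ℝ) / 2) : ℝ) : ℂ) *
    ∫ (ξ : En n), Complex.exp (Complex.I * (⟪x, ξ⟫ : ℂ)) * σ x ξ * ft φ ξ

end

noncomputable section

/-- The SG symbol class `S^{m₁,m₂}_{ρ,Λ}`. -/
def SGClass {n : ℕ} (Λ : En n → ℝ) (ρ m₁ m₂ : ℝ) (σ : En n → En n → ℂ) : Prop :=
  ContDiff ℝ (⊤ : ℕ∞) (fun q : En n × En n => σ q.1 q.2) ∧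
  ∀ α β : Fin n → ℕ, ∃ C > 0, ∀ x ξ : En n,
    ‖mixpd α β σ x ξ‖ ≤
      C * Λ x ^ (m₂ - ρ * ∑ i, (α i : ℝ)) * Λ ξ ^ (m₁ - ρ * ∑ i, (β i : ℝ))

/-- The SG symbol class `M^{m₁,m₂}_{ρ,Λ}`. -/
def SGMClass {n : ℕ} (Λ : En n → ℝ) (ρ m₁ m₂ : ℝ) (σ : En n → En n → ℂ) : Prop :=
  ∀ γ δ : Fin n → ℕ, (∀ i, γ i ≤ 1) → (∀ i, δ i ≤ 1) →
    SGClass Λ ρ m₁ m₂ (fun x ξ =>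
      ((∏ i, x i ^ δ i : ℝ) : ℂ) * ((∏ i, ξ i ^ γ i : ℝ) : ℂ) * mixpd δ γ σ x ξ)

end
noncomputable section

/-- The squared weighted SG Sobolev norm `‖φ‖²_{s₁,s₂,2,Λ}`:
the squared `L²`-norm of `J_{-s₁,-s₂}φ`, where `J_{-s₁,-s₂}` is the pseudo-differential
operator with symbol `Λ(x)^{s₂} Λ(ξ)^{s₁}`. -/
def sgNormSq {n : ℕ} (Λ : En n → ℝ) (s₁ s₂ : ℝ) (φ : En n → ℂ) : ℝ :=
  ∫ (x : En n),
    ‖((Λ x ^ s₂ : ℝ) : ℂ) * ((((2 * Real.pi) ^ (-(n : ℝ) / 2) : ℝ)) : ℂ) *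
        ∫ (ξ : En n), Complex.exp (Complex.I * ((⟪x, ξ⟫ : ℝ) : ℂ)) *
          ((Λ ξ ^ s₁ : ℝ) : ℂ) * ft φ ξ‖ ^ 2

namespace SGGarding

/-! ### Families of smooth functions whose derivatives are all controlled by a weight -/

/-- The family `f` is smooth and every derivative of `f i` is bounded by a constant, uniform
in `i`, times the weight `w i`. -/
def SymbolBound {ι E F : Type*} [NormedAddCommGroup E] [NormedSpace ℝ E]
    [NormedAddCommGroup F] [NormedSpace ℝ F] (f : ι → E → F) (w : ι → E → ℝ) : Prop :=
  (∀ i, ContDiff ℝ (⊤ : ℕ∞) (f i)) ∧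
    ∀ k : ℕ, ∃ C : ℝ, 0 ≤ C ∧ ∀ i z, ‖iteratedFDeriv ℝ k (f i) z‖ ≤ C * w i z

namespace SymbolBound

variable {ι κ E E' F G : Type*} [NormedAddCommGroup E] [NormedSpace ℝ E]
  [NormedAddCommGroup E'] [NormedSpace ℝ E']
  [NormedAddCommGroup F] [NormedSpace ℝ F] [NormedAddCommGroup G] [NormedSpace ℝ G]
  {f g : ι → E → F} {w w' : ι → E → ℝ}

lemma mono (h : SymbolBound f w) (A : ℝ) (hA0 : 0 ≤ A) (hA : ∀ i z, w i z ≤ A * w' i z) :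
    SymbolBound f w' := by
  refine ⟨h.1, fun k => ?_⟩
  obtain ⟨C, hC, hb⟩ := h.2 k
  refine ⟨C * A, by positivity, fun i z => ?_⟩
  calc _ ≤ C * w i z := hb i z
    _ ≤ C * (A * w' i z) := by gcongr; exact hA i z
    _ = _ := by ring

lemma congr_weight (h : SymbolBound f w) (hw : ∀ i z, w i z = w' i z) : SymbolBound f w' :=
  h.mono 1 zero_le_one fun i z => by rw [hw, one_mul]

lemma congr_fun (h : SymbolBound f w) (hf : ∀ i z, f i z = g i z) : SymbolBound g w := by
  have : f = g := by ext i z; exact hf i z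
  exact this ▸ h

lemma reindex (h : SymbolBound f w) (a : κ → ι) :
    SymbolBound (fun k => f (a k)) (fun k => w (a k)) :=
  ⟨fun _ => h.1 _, fun k => let ⟨C, hC, hb⟩ := h.2 k; ⟨C, hC, fun _ _ => hb _ _⟩⟩

lemma exists_bound (h : SymbolBound f w) : ∃ C : ℝ, 0 ≤ C ∧ ∀ i z, ‖f i z‖ ≤ C * w i z := by
  obtain ⟨C, hC, hb⟩ := h.2 0
  exact ⟨C, hC, fun i z => by simpa using hb i z⟩

lemma add (hf : SymbolBound f w) (hg : SymbolBound g w) :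
    SymbolBound (fun i z => f i z + g i z) w := by
  refine ⟨fun i => (hf.1 i).add (hg.1 i), fun k => ?_⟩
  obtain ⟨C, hC, hb⟩ := hf.2 k
  obtain ⟨D, hD, hd⟩ := hg.2 k
  refine ⟨C + D, by positivity, fun i z => ?_⟩
  have : iteratedFDeriv ℝ k (fun z => f i z + g i z) z
      = iteratedFDeriv ℝ k (f i) z + iteratedFDeriv ℝ k (g i) z :=
    iteratedFDeriv_add_apply ((hf.1 i).contDiffAt.of_le (mod_cast le_top))
      ((hg.1 i).contDiffAt.of_le (mod_cast le_top))
  rw [this, add_mul]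
  exact (norm_add_le _ _).trans (add_le_add (hb i z) (hd i z))

lemma clm_comp (L : F →L[ℝ] G) (hf : SymbolBound f w) :
    SymbolBound (fun i z => L (f i z)) w := by
  refine ⟨fun i => L.contDiff.comp (hf.1 i), fun k => ?_⟩
  obtain ⟨C, hC, hb⟩ := hf.2 k
  refine ⟨‖L‖ * C, by positivity, fun i z => ?_⟩
  have := L.norm_iteratedFDeriv_comp_left (hf.1 i).contDiffAt (x := z) (N := (⊤ : ℕ∞))
    (n := k) (mod_cast le_top)
  calc _ ≤ ‖L‖ * ‖iteratedFDeriv ℝ k (f i) z‖ := this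
    _ ≤ ‖L‖ * (C * w i z) := by gcongr; exact hb i z
    _ = _ := by ring

lemma zero : SymbolBound (fun (_ : ι) (_ : E) => (0 : F)) w :=
  ⟨fun _ => contDiff_const, fun k => ⟨0, le_rfl, fun i z => by
    simp [iteratedFDeriv_fun_zero]⟩⟩

lemma sum {J : Type*} (s : Finset J) {f : J → ι → E → F}
    (hf : ∀ j ∈ s, SymbolBound (f j) w) :
    SymbolBound (fun i z => ∑ j ∈ s, f j i z) w := by
  classical
  induction s using Finset.induction_on with
  | empty => simpa using zero
  | insert a s ha ih =>
    have := (hf a (by simp)).add (ih fun j hj => hf j (by simp [hj]))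
    exact this.congr_fun fun i z => by rw [Finset.sum_insert ha]

lemma const (c : F) : SymbolBound (fun (_ : ι) (_ : E) => c) (fun _ _ => 1) := by
  refine ⟨fun _ => contDiff_const, fun k => ⟨‖c‖, norm_nonneg _, fun i z => ?_⟩⟩
  rcases Nat.eq_zero_or_pos k with rfl | hk
  · simp
  · rw [iteratedFDeriv_const_of_ne (by omega)]; simp

lemma smul {a : ι → E → ℝ} (ha : SymbolBound a w) (hf : SymbolBound f w') :
    SymbolBound (fun i z => a i z • f i z) (fun i z => w i z * w' i z) := by
  refine ⟨fun i => (ha.1 i).smul (hf.1 i), fun k => ?_⟩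
  choose C hC hb using ha.2
  choose D hD hd using hf.2
  refine ⟨∑ j ∈ Finset.range (k + 1), (k.choose j : ℝ) * C j * D (k - j),
    Finset.sum_nonneg fun j _ => mul_nonneg (mul_nonneg (by positivity) (hC _)) (hD _),
    fun i z => ?_⟩
  refine (norm_iteratedFDeriv_smul_le (ha.1 i) (hf.1 i) z (n := k) (mod_cast le_top)).trans ?_
  rw [Finset.sum_mul]
  refine Finset.sum_le_sum fun j _ => ?_
  calc _ ≤ (k.choose j : ℝ) * (C j * w i z) * (D (k - j) * w' i z) := by
        refine mul_le_mul (mul_le_mul_of_nonneg_left (hb j i z) (by positivity))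
          (hd _ i z) (norm_nonneg _) ?_
        exact mul_nonneg (by positivity) ((norm_nonneg _).trans (hb j i z))
    _ = _ := by ring

lemma mul {𝔸 : Type*} [NormedRing 𝔸] [NormedAlgebra ℝ 𝔸] {f g : ι → E → 𝔸}
    (hf : SymbolBound f w) (hg : SymbolBound g w') :
    SymbolBound (fun i z => f i z * g i z) (fun i z => w i z * w' i z) := by
  refine ⟨fun i => (hf.1 i).mul (hg.1 i), fun k => ?_⟩
  choose C hC hb using hf.2
  choose D hD hd using hg.2
  refine ⟨∑ j ∈ Finset.range (k + 1), (k.choose j : ℝ) * C j * D (k - j),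
    Finset.sum_nonneg fun j _ => mul_nonneg (mul_nonneg (by positivity) (hC _)) (hD _),
    fun i z => ?_⟩
  refine (norm_iteratedFDeriv_mul_le (hf.1 i) (hg.1 i) z (n := k) (mod_cast le_top)).trans ?_
  rw [Finset.sum_mul]
  refine Finset.sum_le_sum fun j _ => ?_
  calc _ ≤ (k.choose j : ℝ) * (C j * w i z) * (D (k - j) * w' i z) := by
        refine mul_le_mul (mul_le_mul_of_nonneg_left (hb j i z) (by positivity))
          (hd _ i z) (norm_nonneg _) ?_
        exact mul_nonneg (by positivity) ((norm_nonneg _).trans (hb j i z))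
    _ = _ := by ring

lemma const_mul {𝔸 : Type*} [NormedRing 𝔸] [NormedAlgebra ℝ 𝔸] {f : ι → E → 𝔸} (c : 𝔸)
    (hf : SymbolBound f w) : SymbolBound (fun i z => c * f i z) w :=
  ((const c).mul hf).congr_weight fun _ _ => one_mul _

lemma comp_clm (A : ι → E' →L[ℝ] E) (M : ℝ) (hA : ∀ i, ‖A i‖ ≤ M) (hf : SymbolBound f w) :
    SymbolBound (fun i z => f i (A i z)) (fun i z => w i (A i z)) := by
  refine ⟨fun i => (hf.1 i).comp (A i).contDiff, fun k => ?_⟩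
  obtain ⟨C, hC, hb⟩ := hf.2 k
  refine ⟨C * |M| ^ k, by positivity, fun i z => ?_⟩
  have h1 : iteratedFDeriv ℝ k (fun z => f i (A i z)) z
      = (iteratedFDeriv ℝ k (f i) (A i z)).compContinuousLinearMap fun _ => A i :=
    (A i).iteratedFDeriv_comp_right (n := (⊤ : ℕ∞)) (hf.1 i) z (mod_cast le_top)
  rw [h1]
  refine (ContinuousMultilinearMap.norm_compContinuousLinearMap_le _ _).trans ?_
  rw [Finset.prod_const, Finset.card_univ, Fintype.card_fin]
  calc _ ≤ (C * w i (A i z)) * |M| ^ k := by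
        gcongr
        · exact (norm_nonneg _).trans (hb i (A i z))
        · exact hb _ _
        · exact (hA i).trans (le_abs_self M)
    _ = _ := by ring

lemma fderiv (hf : SymbolBound f w) : SymbolBound (fun i z => fderiv ℝ (f i) z) w := by
  refine ⟨fun i => (hf.1 i).fderiv_right (by simp), fun k => ?_⟩
  obtain ⟨C, hC, hb⟩ := hf.2 (k + 1)
  exact ⟨C, hC, fun i z => by
    have := norm_iteratedFDeriv_fderiv (𝕜 := ℝ) (f := f i) (x := z) (n := k)
    exact this.trans_le (hb i z)⟩

lemma fderiv_apply (hf : SymbolBound f w) (v : E) :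
    SymbolBound (fun i z => _root_.fderiv ℝ (f i) z v) w :=
  hf.fderiv.clm_comp (ContinuousLinearMap.apply ℝ F v)

lemma of_fderiv (hs : ∀ i, ContDiff ℝ (⊤ : ℕ∞) (f i))
    (h0 : ∃ C : ℝ, 0 ≤ C ∧ ∀ i z, ‖f i z‖ ≤ C * w i z)
    (h1 : SymbolBound (fun i z => _root_.fderiv ℝ (f i) z) w) : SymbolBound f w := by
  refine ⟨hs, fun k => ?_⟩
  cases k with
  | zero => simpa using h0
  | succ k =>
    obtain ⟨C, hC, hb⟩ := h1.2 k
    exact ⟨C, hC, fun i z => by rw [← norm_iteratedFDeriv_fderiv]; exact hb i z⟩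

lemma clm (L : E →L[ℝ] F) : SymbolBound (fun (_ : ι) z => L z) (fun _ z => 1 + ‖z‖) := by
  refine of_fderiv (fun _ => L.contDiff) ⟨‖L‖, norm_nonneg _, fun i z => ?_⟩ ?_
  · exact (L.le_opNorm z).trans (by gcongr; linarith [norm_nonneg z])
  · refine ((const L).mono 1 zero_le_one fun i z => ?_).congr_fun fun i z => ?_
    · linarith [norm_nonneg z]
    · exact L.fderiv.symm

lemma rpow {f : ι → E → ℝ} (hw : ∀ i z, 0 < w i z) {c : ℝ} (hc : 0 < c)
    (hcf : ∀ i z, c * w i z ≤ f i z) (hf : SymbolBound f w) (s : ℝ) :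
    SymbolBound (fun i z => f i z ^ s) (fun i z => w i z ^ s) := by
  have hpos : ∀ i z, 0 < f i z := fun i z => (mul_pos hc (hw i z)).trans_le (hcf i z)
  have hsm : ∀ (s : ℝ) i, ContDiff ℝ (⊤ : ℕ∞) (fun z => f i z ^ s) := fun s i =>
    (hf.1 i).rpow_const_of_ne fun z => (hpos i z).ne'
  refine ⟨hsm s, fun k => ?_⟩
  induction k using Nat.strong_induction_on generalizing s with
  | _ k ih =>
  cases k with
  | zero =>
    obtain ⟨C, hC, hb⟩ := hf.exists_bound
    refine ⟨(C + c) ^ s + c ^ s, by positivity, fun i z => ?_⟩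
    simp only [norm_iteratedFDeriv_zero, Real.norm_eq_abs]
    rw [abs_of_nonneg (rpow_nonneg (hpos i z).le s), add_mul]
    have hwp := hw i z
    have h1 : f i z ≤ (C + c) * w i z := by
      have := hb i z
      rw [Real.norm_eq_abs] at this
      nlinarith [le_abs_self (f i z), mul_pos hc hwp]
    rcases le_total 0 s with hs | hs
    · have := rpow_le_rpow (hpos i z).le h1 hs
      rw [mul_rpow (by positivity) hwp.le] at this
      have : 0 ≤ c ^ s * w i z ^ s := by positivity
      linarith
    · have := rpow_le_rpow_of_nonpos (mul_pos hc hwp) (hcf i z) hs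
      rw [mul_rpow hc.le hwp.le] at this
      have : 0 ≤ (C + c) ^ s * w i z ^ s := by positivity
      linarith
  | succ k =>
    have ih' : ∀ j : Fin (k + 1), ∃ C : ℝ, 0 ≤ C ∧ ∀ i z,
        ‖iteratedFDeriv ℝ j (fun z => f i z ^ (s - 1)) z‖ ≤ C * w i z ^ (s - 1) :=
      fun j => ih j j.2 (s - 1)
    choose C hC hb using ih'
    have hD0 := (hf.fderiv.clm_comp (s • ContinuousLinearMap.id ℝ (E →L[ℝ] ℝ)))
    choose D hD hd using hD0.2
    refine ⟨∑ j : Fin (k + 1), (k.choose j : ℝ) * C j * D (k - j),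
      Finset.sum_nonneg fun j _ => mul_nonneg (mul_nonneg (by positivity) (hC _)) (hD _),
      fun i z => ?_⟩
    have hfd : _root_.fderiv ℝ (fun z => f i z ^ s)
        = fun z => (f i z ^ (s - 1)) •
            ((s • ContinuousLinearMap.id ℝ (E →L[ℝ] ℝ)) (_root_.fderiv ℝ (f i) z)) := by
      ext1 z
      have h := (((hf.1 i).differentiable (by simp) z).hasFDerivAt).rpow_const
        (p := s) (Or.inl (hpos i z).ne')
      rw [h.fderiv]
      simp [smul_smul, mul_comm]
    rw [← norm_iteratedFDeriv_fderiv, hfd]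
    refine (norm_iteratedFDeriv_smul_le (hsm (s - 1) i) (hD0.1 i) z (n := k)
      (mod_cast le_top)).trans ?_
    rw [Finset.sum_mul, ← Fin.sum_univ_eq_sum_range
      (fun j => (k.choose j : ℝ) * ‖iteratedFDeriv ℝ j (fun z => f i z ^ (s - 1)) z‖ *
        ‖iteratedFDeriv ℝ (k - j) (fun z => (s • ContinuousLinearMap.id ℝ (E →L[ℝ] ℝ))
          (_root_.fderiv ℝ (f i) z)) z‖)]
    refine Finset.sum_le_sum fun j _ => ?_
    have hws : w i z ^ s = w i z ^ (s - 1) * w i z := by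
      rw [← rpow_add_one (hw i z).ne', sub_add_cancel]
    calc _ ≤ (k.choose j : ℝ) * (C j * w i z ^ (s - 1)) * (D (k - j) * w i z) := by
          refine mul_le_mul (mul_le_mul_of_nonneg_left (hb j i z) (by positivity))
            (hd _ i z) (norm_nonneg _) ?_
          exact mul_nonneg (by positivity) ((norm_nonneg _).trans (hb j i z))
      _ = _ := by simp only [hws]; ring

end SymbolBound

/-! ### Iterated directional derivatives -/

section Directional

variable {ι E F J : Type*} [NormedAddCommGroup E] [NormedSpace ℝ E]
  [NormedAddCommGroup F] [NormedSpace ℝ F]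

/-- Directional derivative. -/
def dirDeriv (v : E) (f : E → F) : E → F := fun z => fderiv ℝ f z v

lemma contDiff_dirDeriv {f : E → F} (hf : ContDiff ℝ (⊤ : ℕ∞) f) (v : E) :
    ContDiff ℝ (⊤ : ℕ∞) (dirDeriv v f) :=
  (hf.fderiv_right (by simp)).clm_apply contDiff_const

lemma dirDeriv_comm {f : E → F} (hf : ContDiff ℝ (⊤ : ℕ∞) f) (v w : E) :
    dirDeriv v (dirDeriv w f) = dirDeriv w (dirDeriv v f) := by
  ext z
  have hd : DifferentiableAt ℝ (fderiv ℝ f) z :=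
    (hf.fderiv_right (m := (⊤ : ℕ∞)) (by simp)).differentiable (by simp) z
  have key : ∀ v w : E, dirDeriv v (dirDeriv w f) z = fderiv ℝ (fderiv ℝ f) z v w := by
    intro v w
    have : HasFDerivAt (dirDeriv w f)
        ((ContinuousLinearMap.apply ℝ F w).comp (fderiv ℝ (fderiv ℝ f) z)) z :=
      (ContinuousLinearMap.apply ℝ F w).hasFDerivAt.comp z hd.hasFDerivAt
    change fderiv ℝ (dirDeriv w f) z v = _
    rw [this.fderiv]
    simp
  rw [key, key]
  have h2 : ((2 : ℕ∞) : WithTop ℕ∞) ≤ ((⊤ : ℕ∞) : WithTop ℕ∞) := mod_cast le_top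
  exact (hf.contDiffAt.isSymmSndFDerivAt (by simpa using h2)).eq v w

/-- If the directional derivatives along all words in a finite spanning family are controlled
by the weight, so are all derivatives. -/
lemma SymbolBound.of_words [Fintype J] (v : J → E) (co : J → E →L[ℝ] ℝ)
    (hv : ∀ z, ∑ b, co b z • v b = z) {w : ι → E → ℝ}
    (S : (ι → E → F) → Prop) (hS : ∀ f, S f → ∀ b, S fun i => dirDeriv (v b) (f i))
    (hsm : ∀ f, S f → ∀ i, ContDiff ℝ (⊤ : ℕ∞) (f i))
    (hbd : ∀ f, S f → ∃ C : ℝ, 0 ≤ C ∧ ∀ i z, ‖f i z‖ ≤ C * w i z)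
    {f : ι → E → F} (hf : S f) : SymbolBound f w := by
  refine ⟨hsm f hf, fun k => ?_⟩
  induction k generalizing f with
  | zero => simpa using hbd f hf
  | succ k ih =>
    choose C hC hb using fun b => ih (hS f hf b)
    let L : J → F →L[ℝ] (E →L[ℝ] F) := fun b => ContinuousLinearMap.smulRightL ℝ E F (co b)
    refine ⟨∑ b, ‖L b‖ * C b, Finset.sum_nonneg fun b _ => mul_nonneg (norm_nonneg (L b)) (hC b),
      fun i z => ?_⟩
    have hfd : _root_.fderiv ℝ (f i) = fun z => ∑ b, L b (dirDeriv (v b) (f i) z) := by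
      ext z y
      conv_lhs => rw [← hv y]
      simp [L, dirDeriv, map_sum]
    have hsmb : ∀ b, ContDiff ℝ (⊤ : ℕ∞) (fun z => L b (dirDeriv (v b) (f i) z)) := fun b =>
      (L b).contDiff.comp (hsm _ (hS f hf b) i)
    rw [← norm_iteratedFDeriv_fderiv, hfd, iteratedFDeriv_fun_sum_apply
      fun b _ => (hsmb b).contDiffAt.of_le (mod_cast le_top), Finset.sum_mul]
    refine (norm_sum_le _ _).trans (Finset.sum_le_sum fun b _ => ?_)
    refine ((L b).norm_iteratedFDeriv_comp_left (N := (⊤ : ℕ∞))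
      (hsm _ (hS f hf b) i).contDiffAt (mod_cast le_top)).trans ?_
    rw [mul_assoc]
    gcongr
    exact hb b i z

end Directional

/-! ### Multi-index derivatives -/

section MultiIndex

variable {n : ℕ} {E F : Type*} [NormedAddCommGroup E] [NormedSpace ℝ E]
  [NormedAddCommGroup F] [NormedSpace ℝ F]

lemma contDiff_dirDeriv_iterate {f : E → F} (hf : ContDiff ℝ (⊤ : ℕ∞) f) (v : E) (k : ℕ) :
    ContDiff ℝ (⊤ : ℕ∞) ((dirDeriv v)^[k] f) := by
  induction k with
  | zero => exact hf
  | succ k ih => rw [Function.iterate_succ_apply']; exact contDiff_dirDeriv ih v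

lemma dirDeriv_iterate_comm {f : E → F} (hf : ContDiff ℝ (⊤ : ℕ∞) f) (v v' : E) (k : ℕ) :
    dirDeriv v' ((dirDeriv v)^[k] f) = (dirDeriv v)^[k] (dirDeriv v' f) := by
  induction k with
  | zero => rfl
  | succ k ih =>
    rw [Function.iterate_succ_apply', Function.iterate_succ_apply',
      dirDeriv_comm (contDiff_dirDeriv_iterate hf v k), ih]

/-- Iterated derivative along the directions `V i`, `α i` times each, for `i` in a list. -/
def listDeriv (V : Fin n → E) (l : List (Fin n)) (α : Fin n → ℕ) (f : E → F) : E → F :=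
  l.foldr (fun i g => (dirDeriv (V i))^[α i] g) f

lemma contDiff_listDeriv (V : Fin n → E) (l : List (Fin n)) (α : Fin n → ℕ) {f : E → F}
    (hf : ContDiff ℝ (⊤ : ℕ∞) f) : ContDiff ℝ (⊤ : ℕ∞) (listDeriv V l α f) := by
  induction l with
  | nil => exact hf
  | cons i l ih => exact contDiff_dirDeriv_iterate ih _ _

lemma dirDeriv_listDeriv (V : Fin n → E) (l : List (Fin n)) (α : Fin n → ℕ) {f : E → F}
    (hf : ContDiff ℝ (⊤ : ℕ∞) f) (v : E) :
    dirDeriv v (listDeriv V l α f) = listDeriv V l α (dirDeriv v f) := by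
  induction l with
  | nil => rfl
  | cons i l ih =>
    change dirDeriv v ((dirDeriv (V i))^[α i] (listDeriv V l α f)) = _
    rw [dirDeriv_iterate_comm (contDiff_listDeriv V l α hf), ih]
    rfl

lemma listDeriv_add_single_of_notMem (V : Fin n → E) {l : List (Fin n)} (α : Fin n → ℕ)
    (f : E → F) {i : Fin n} (hi : i ∉ l) :
    listDeriv V l (α + Pi.single i 1) f = listDeriv V l α f := by
  induction l with
  | nil => rfl
  | cons j l ih =>
    simp only [List.mem_cons, not_or] at hi
    change (dirDeriv (V j))^[(α + Pi.single i 1 : Fin n → ℕ) j]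
      (listDeriv V l (α + Pi.single i 1) f) = _
    rw [ih hi.2]
    simp only [Pi.add_apply, Pi.single_eq_of_ne (Ne.symm hi.1), add_zero]
    rfl

lemma listDeriv_add_single (V : Fin n → E) {l : List (Fin n)} (hl : l.Nodup) (α : Fin n → ℕ)
    {f : E → F} (hf : ContDiff ℝ (⊤ : ℕ∞) f) {i : Fin n} (hi : i ∈ l) :
    listDeriv V l (α + Pi.single i 1) f = dirDeriv (V i) (listDeriv V l α f) := by
  induction l with
  | nil => simp at hi
  | cons j l ih =>
    rw [List.nodup_cons] at hl
    change (dirDeriv (V j))^[(α + Pi.single i 1 : Fin n → ℕ) j]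
      (listDeriv V l (α + Pi.single i 1) f)
      = dirDeriv (V i) ((dirDeriv (V j))^[α j] (listDeriv V l α f))
    by_cases hij : i = j
    · subst hij
      rw [listDeriv_add_single_of_notMem V α f hl.1]
      simp only [Pi.add_apply, Pi.single_eq_same, Function.iterate_succ_apply']
    · have hil : i ∈ l := by simpa [hij] using hi
      rw [ih hl.2 hil, dirDeriv_iterate_comm (contDiff_listDeriv V l α hf)]
      simp only [Pi.add_apply, Pi.single_eq_of_ne (Ne.symm hij), add_zero]

/-- Multi-index derivative along the directions `V`. -/
def multiDeriv (V : Fin n → E) (α : Fin n → ℕ) (f : E → F) : E → F :=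
  listDeriv V (List.finRange n) α f

lemma contDiff_multiDeriv (V : Fin n → E) (α : Fin n → ℕ) {f : E → F}
    (hf : ContDiff ℝ (⊤ : ℕ∞) f) : ContDiff ℝ (⊤ : ℕ∞) (multiDeriv V α f) :=
  contDiff_listDeriv _ _ _ hf

lemma dirDeriv_multiDeriv (V : Fin n → E) (α : Fin n → ℕ) {f : E → F}
    (hf : ContDiff ℝ (⊤ : ℕ∞) f) (v : E) :
    dirDeriv v (multiDeriv V α f) = multiDeriv V α (dirDeriv v f) :=
  dirDeriv_listDeriv _ _ _ hf v

lemma multiDeriv_add_single (V : Fin n → E) (α : Fin n → ℕ) {f : E → F}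
    (hf : ContDiff ℝ (⊤ : ℕ∞) f) (i : Fin n) :
    multiDeriv V (α + Pi.single i 1) f = dirDeriv (V i) (multiDeriv V α f) :=
  listDeriv_add_single V (List.nodup_finRange n) α hf (List.mem_finRange i)

lemma listDeriv_zero (V : Fin n → E) (l : List (Fin n)) (f : E → F) :
    listDeriv V l 0 f = f := by
  induction l with
  | nil => rfl
  | cons i l ih => exact ih

lemma multiDeriv_zero (V : Fin n → E) (f : E → F) : multiDeriv V 0 f = f := listDeriv_zero _ _ _

/-- The coordinate directions in the first factor. -/
def dirX (i : Fin n) : En n × En n := (EuclideanSpace.single i 1, 0)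

/-- The coordinate directions in the second factor. -/
def dirXi (i : Fin n) : En n × En n := (0, EuclideanSpace.single i 1)

lemma dirDeriv_comp_clm_add {E' : Type*} [NormedAddCommGroup E'] [NormedSpace ℝ E']
    (A : E' →L[ℝ] E) (c : E) {f : E → F} (hf : ContDiff ℝ (⊤ : ℕ∞) f) (v : E') :
    dirDeriv v (fun y => f (A y + c)) = fun y => dirDeriv (A v) f (A y + c) := by
  ext y
  have h : HasFDerivAt (fun y => f (A y + c)) ((fderiv ℝ f (A y + c)).comp A) y :=
    ((hf.differentiable (by simp)) (A y + c)).hasFDerivAt.comp y (A.hasFDerivAt.add_const c)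
  change fderiv ℝ (fun y => f (A y + c)) y v = _
  rw [h.fderiv]
  rfl

lemma dirDeriv_iterate_comp_clm_add {E' : Type*} [NormedAddCommGroup E'] [NormedSpace ℝ E']
    (A : E' →L[ℝ] E) (c : E) {f : E → F} (hf : ContDiff ℝ (⊤ : ℕ∞) f) (v : E') (k : ℕ) :
    (dirDeriv v)^[k] (fun y => f (A y + c)) = fun y => (dirDeriv (A v))^[k] f (A y + c) := by
  induction k with
  | zero => rfl
  | succ k ih =>
    rw [Function.iterate_succ_apply', ih,
      dirDeriv_comp_clm_add A c (contDiff_dirDeriv_iterate hf _ k)]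
    ext y
    rw [Function.iterate_succ_apply']

lemma multiDeriv_comp_clm_add {E' : Type*} [NormedAddCommGroup E'] [NormedSpace ℝ E']
    (A : E' →L[ℝ] E) (c : E) {f : E → F} (hf : ContDiff ℝ (⊤ : ℕ∞) f) (V : Fin n → E')
    (α : Fin n → ℕ) :
    multiDeriv V α (fun y => f (A y + c)) =
      fun y => multiDeriv (fun i => A (V i)) α f (A y + c) := by
  unfold multiDeriv
  induction List.finRange n with
  | nil => rfl
  | cons i l ih =>
    change (dirDeriv (V i))^[α i] (listDeriv V l α (fun y => f (A y + c))) = _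
    rw [ih, dirDeriv_iterate_comp_clm_add A c (contDiff_listDeriv _ l α hf)]
    rfl

lemma mixpd_eq_multiDeriv (α β : Fin n → ℕ) {σ : En n → En n → ℂ}
    (hσ : ContDiff ℝ (⊤ : ℕ∞) (fun q : En n × En n => σ q.1 q.2)) (x ξ : En n) :
    mixpd α β σ x ξ =
      multiDeriv dirX α (multiDeriv dirXi β (fun q : En n × En n => σ q.1 q.2)) (x, ξ) := by
  have h1 : ∀ y, mpd β (σ y) ξ
      = multiDeriv dirXi β (fun q : En n × En n => σ q.1 q.2) (y, ξ) := by
    intro y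
    have := congrFun (multiDeriv_comp_clm_add (ContinuousLinearMap.inr ℝ (En n) (En n)) (y, 0) hσ
      (fun i => EuclideanSpace.single i (1 : ℝ)) β) ξ
    simp only [ContinuousLinearMap.inr_apply, Prod.mk_add_mk, zero_add, add_zero] at this
    exact this
  have h2 := congrFun (multiDeriv_comp_clm_add (ContinuousLinearMap.inl ℝ (En n) (En n)) (0, ξ)
    (contDiff_multiDeriv dirXi β hσ) (fun i => EuclideanSpace.single i (1 : ℝ)) α) x
  simp only [ContinuousLinearMap.inl_apply, Prod.mk_add_mk, zero_add, add_zero] at h2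
  simp only [mixpd, h1]
  exact h2

lemma sum_coord_smul (z : En n) : ∑ i, z i • EuclideanSpace.single i (1 : ℝ) = z := by
  ext j
  simp [Finset.sum_apply, Pi.single_apply]

end MultiIndex

/-! ### Weights -/

/-- The polynomial weight `1 + |t|²`. -/
def jb {n : ℕ} (t : En n) : ℝ := 1 + ‖t‖ ^ 2

lemma one_le_jb {n : ℕ} (t : En n) : 1 ≤ jb t := by unfold jb; nlinarith [sq_nonneg ‖t‖]

lemma jb_pos {n : ℕ} (t : En n) : 0 < jb t := zero_lt_one.trans_le (one_le_jb t)

lemma norm_le_jb {n : ℕ} (t : En n) : ‖t‖ ≤ jb t := by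
  unfold jb; nlinarith [sq_nonneg (‖t‖ - 1), sq_nonneg ‖t‖]

/-- The properties of a weight function used below. -/
structure SGWeight (n : ℕ) (Λ : En n → ℝ) (ρ : ℝ) : Prop where
  rho_pos : 0 < ρ
  lower : ∃ c > 0, ∀ x, c ≤ Λ x
  bound : SymbolBound (fun _ : Unit => Λ) (fun _ => Λ)
  bound_deriv : ∀ j, SymbolBound
    (fun _ : Unit => dirDeriv (EuclideanSpace.single j (1 : ℝ)) Λ) (fun _ x => Λ x ^ (1 - ρ))

lemma exists_rpow_le_rpow {X : Type*} {Λ : X → ℝ} (h : ∃ c > 0, ∀ x, c ≤ Λ x) {s t : ℝ}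
    (hst : s ≤ t) : ∃ C : ℝ, 0 < C ∧ ∀ x, Λ x ^ s ≤ C * Λ x ^ t := by
  obtain ⟨c, hc, hcl⟩ := h
  refine ⟨c ^ (s - t), by positivity, fun x => ?_⟩
  have hx : 0 < Λ x := hc.trans_le (hcl x)
  have h2 : Λ x ^ (s - t) ≤ c ^ (s - t) :=
    rpow_le_rpow_of_nonpos hc (hcl x) (by linarith)
  calc Λ x ^ s = Λ x ^ (s - t) * Λ x ^ t := by rw [← rpow_add hx]; ring_nf
    _ ≤ _ := by gcongr

namespace SGWeight
variable {n : ℕ} {Λ : En n → ℝ} {ρ : ℝ}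

lemma of_isWeight {μ₀ μ₁ μ : ℝ} (hw : IsWeight n Λ μ₀ μ₁ μ) (hρ : 0 < ρ) (hρμ : ρ ≤ 1 / μ) :
    SGWeight n Λ ρ := by
  have hlow : ∃ c > 0, ∀ x, c ≤ Λ x := by
    obtain ⟨C₀, C₁, h0, h01, hb⟩ := hw.growth
    refine ⟨C₀, h0, fun x => le_trans ?_ (hb x).1⟩
    have : 1 ≤ (1 + ‖x‖) ^ μ₀ := one_le_rpow (by linarith [norm_nonneg x]) hw.hμ₀.le
    nlinarith
  have key : ∀ α : Fin n → ℕ, SymbolBound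
      (fun _ : Unit => multiDeriv (fun i => EuclideanSpace.single i (1 : ℝ)) α Λ)
      (fun _ x => Λ x ^ (1 - ρ * ∑ i, (α i : ℝ))) := by
    intro α
    refine SymbolBound.of_words (fun i => EuclideanSpace.single i (1 : ℝ))
      (fun i => EuclideanSpace.proj i) (fun z => sum_coord_smul z)
      (fun f => ∃ β, f = fun _ =>
        multiDeriv (fun i => EuclideanSpace.single i (1 : ℝ)) (α + β) Λ) ?_ ?_ ?_ ⟨0, by simp⟩
    · rintro _ ⟨β, rfl⟩ b
      refine ⟨β + Pi.single b 1, ?_⟩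
      funext _
      rw [← add_assoc, multiDeriv_add_single _ _ hw.smooth]
    · rintro _ ⟨β, rfl⟩ _
      exact contDiff_multiDeriv _ _ hw.smooth
    · rintro _ ⟨β, rfl⟩
      obtain ⟨C, hC, hb⟩ := hw.deriv_bound (α + β) 0 (by simp)
      obtain ⟨D, hD, hd⟩ := exists_rpow_le_rpow hlow
        (s := 1 - (∑ i, ((α + β) i : ℝ)) / μ) (t := 1 - ρ * ∑ i, (α i : ℝ)) (by
          have h1 : ∑ i, ((α + β) i : ℝ) = ∑ i, (α i : ℝ) + ∑ i, (β i : ℝ) := by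
            rw [← Finset.sum_add_distrib]; simp
          have h2 : 0 ≤ ∑ i, (α i : ℝ) := by positivity
          have h3 : 0 ≤ ∑ i, (β i : ℝ) := by positivity
          have h4 : 0 < 1 / μ := hρ.trans_le hρμ
          rw [h1, div_eq_mul_one_div]
          nlinarith)
      refine ⟨C * D, by positivity, fun _ z => ?_⟩
      have := hb z
      simp only [Pi.zero_apply, pow_zero, Finset.prod_const_one, one_mul, add_zero] at this
      rw [mul_assoc]
      exact this.trans (mul_le_mul_of_nonneg_left (hd z) hC.le)
  refine ⟨hρ, hlow, ?_, fun j => ?_⟩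
  · have := key 0
    rw [multiDeriv_zero] at this
    exact this.congr_weight fun _ z => by simp
  · have := key (0 + Pi.single j 1)
    rw [multiDeriv_add_single _ _ hw.smooth, multiDeriv_zero] at this
    refine this.congr_weight fun _ z => ?_
    have : ∑ i, (((0 + Pi.single j 1 : Fin n → ℕ) i : ℕ) : ℝ) = 1 := by
      rw [← Nat.cast_sum]; simp
    rw [this, mul_one]

lemma pos (hΛ : SGWeight n Λ ρ) (x : En n) : 0 < Λ x := by
  obtain ⟨c, hc, h⟩ := hΛ.lower
  exact hc.trans_le (h x)

lemma smooth (hΛ : SGWeight n Λ ρ) : ContDiff ℝ (⊤ : ℕ∞) Λ := hΛ.bound.1 ()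

lemma norm_sub_rpow_le (hΛ : SGWeight n Λ ρ) :
    ∃ M : ℝ, 0 ≤ M ∧ ∀ x y, ‖Λ x ^ ρ - Λ y ^ ρ‖ ≤ M * ‖x - y‖ := by
  choose C hC hb using fun j => (hΛ.bound_deriv j).exists_bound
  refine ⟨ρ * ∑ j, C j, mul_nonneg hΛ.rho_pos.le (Finset.sum_nonneg fun j _ => hC j),
    fun x y => ?_⟩
  have hd : ∀ z, HasFDerivAt (fun z => Λ z ^ ρ) ((ρ * Λ z ^ (ρ - 1)) • fderiv ℝ Λ z) z :=
    fun z => ((hΛ.smooth.differentiable (by simp) z).hasFDerivAt).rpow_const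
      (Or.inl (hΛ.pos z).ne')
  refine Convex.norm_image_sub_le_of_norm_hasFDerivWithin_le
    (f := fun z => Λ z ^ ρ) (s := Set.univ) (fun z _ => (hd z).hasFDerivWithinAt) ?_
    convex_univ (Set.mem_univ y) (Set.mem_univ x)
  intro z _
  have hz := hΛ.pos z
  have h1 : ‖fderiv ℝ Λ z‖ ≤ (∑ j, C j) * Λ z ^ (1 - ρ) := by
    refine ContinuousLinearMap.opNorm_le_bound _
      (mul_nonneg (Finset.sum_nonneg fun j _ => hC j) (by positivity)) fun v => ?_
    conv_lhs => rw [← sum_coord_smul v]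
    rw [map_sum, Finset.sum_mul, Finset.sum_mul]
    refine (norm_sum_le _ _).trans (Finset.sum_le_sum fun j _ => ?_)
    rw [map_smul, norm_smul, mul_comm]
    exact mul_le_mul (hb j () z) (PiLp.norm_apply_le v j) (norm_nonneg _)
      (mul_nonneg (hC j) (by positivity))
  rw [norm_smul, Real.norm_eq_abs,
    abs_of_nonneg (mul_nonneg hΛ.rho_pos.le (rpow_nonneg hz.le _))]
  calc _ ≤ (ρ * Λ z ^ (ρ - 1)) * ((∑ j, C j) * Λ z ^ (1 - ρ)) :=
        mul_le_mul_of_nonneg_left h1 (mul_nonneg hΛ.rho_pos.le (by positivity))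
    _ = ρ * (∑ j, C j) * (Λ z ^ (ρ - 1) * Λ z ^ (1 - ρ)) := by ring
    _ = _ := by rw [← rpow_add hz]; simp

/-- Real powers of a weight vary slowly. -/
lemma moderate (hΛ : SGWeight n Λ ρ) (s : ℝ) : ∃ (C : ℝ) (K : ℕ), 0 < C ∧
    ∀ x y, Λ x ^ s ≤ C * Λ y ^ s * jb (x - y) ^ K := by
  obtain ⟨M, hM, hL⟩ := hΛ.norm_sub_rpow_le
  obtain ⟨c, hc, hcl⟩ := hΛ.lower
  have hρ := hΛ.rho_pos
  set A : ℝ := 1 + M / c ^ ρ with hA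
  have hA1 : 1 ≤ A := by rw [hA]; have : 0 ≤ M / c ^ ρ := by positivity
                         linarith
  have h1 : ∀ x y, Λ x ^ ρ ≤ (A * jb (x - y)) * Λ y ^ ρ := by
    intro x y
    have ha : c ^ ρ ≤ Λ y ^ ρ := rpow_le_rpow hc.le (hcl y) hρ.le
    have hb : Λ x ^ ρ ≤ Λ y ^ ρ + M * ‖x - y‖ := by
      have := hL x y
      rw [Real.norm_eq_abs] at this
      linarith [le_abs_self (Λ x ^ ρ - Λ y ^ ρ)]
    have hcp : 0 < c ^ ρ := by positivity
    have hM2 : M * ‖x - y‖ ≤ (M / c ^ ρ) * jb (x - y) * Λ y ^ ρ := by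
      have e : M = M / c ^ ρ * c ^ ρ := by field_simp
      calc M * ‖x - y‖ = (M / c ^ ρ) * ‖x - y‖ * c ^ ρ := by rw [e]; field_simp
        _ ≤ _ := by
          gcongr
          · exact mul_nonneg (by positivity) (jb_pos _).le
          · exact norm_le_jb _
    have hj := one_le_jb (x - y)
    have hyp : 0 < Λ y ^ ρ := rpow_pos_of_pos (hΛ.pos y) _
    calc _ ≤ _ := hb
      _ ≤ Λ y ^ ρ + (M / c ^ ρ) * jb (x - y) * Λ y ^ ρ := by linarith
      _ ≤ jb (x - y) * Λ y ^ ρ + (M / c ^ ρ) * jb (x - y) * Λ y ^ ρ := by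
        gcongr; exact le_mul_of_one_le_left hyp.le hj
      _ = _ := by rw [hA]; ring
  have hsym : ∀ x y : En n, jb (x - y) = jb (y - x) := fun x y => by
    unfold jb; rw [norm_sub_rev]
  have h2 : ∀ x y, Λ x ^ s ≤ (A * jb (x - y)) ^ (|s| / ρ) * Λ y ^ s := by
    intro x y
    have hx := hΛ.pos x
    have hy := hΛ.pos y
    have hjp : 0 < A * jb (x - y) := mul_pos (by linarith) (jb_pos _)
    have e : ∀ z, Λ z ^ s = (Λ z ^ ρ) ^ (s / ρ) := fun z => by
      rw [← rpow_mul (hΛ.pos z).le]; congr 1; field_simp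
    rcases le_total 0 s with hs | hs
    · rw [abs_of_nonneg hs, e x, e y, ← mul_rpow hjp.le (by positivity)]
      exact rpow_le_rpow (by positivity) (h1 x y) (by positivity)
    · have h3 := h1 y x
      rw [← hsym x y] at h3
      have h4 : (A * jb (x - y))⁻¹ * Λ y ^ ρ ≤ Λ x ^ ρ := by
        rw [inv_mul_le_iff₀ hjp]; exact h3
      rw [abs_of_nonpos hs, e x, e y]
      refine (rpow_le_rpow_of_nonpos (by positivity) h4
        (div_nonpos_of_nonpos_of_nonneg hs hρ.le)).trans_eq ?_
      rw [mul_rpow (by positivity) (by positivity), inv_rpow hjp.le, ← rpow_neg hjp.le, neg_div]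
  refine ⟨A ^ (|s| / ρ), ⌈|s| / ρ⌉₊, by positivity, fun x y => ?_⟩
  refine (h2 x y).trans ?_
  have hj := one_le_jb (x - y)
  rw [mul_rpow (by linarith) (jb_pos _).le, mul_right_comm]
  have hy : 0 < Λ y ^ s := rpow_pos_of_pos (hΛ.pos y) _
  gcongr
  rw [← rpow_natCast]
  exact rpow_le_rpow_of_exponent_le hj (Nat.le_ceil _)

end SGWeight

/-! ### The first-order calculus of SG symbols -/

section SGSymbol

variable {n : ℕ} {Λ : En n → ℝ} {ρ : ℝ}

/-- The product weight `Λ(x)^{m₂} Λ(ξ)^{m₁}`. -/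
def sgWt (Λ : En n → ℝ) (m₁ m₂ : ℝ) (q : En n × En n) : ℝ := Λ q.1 ^ m₂ * Λ q.2 ^ m₁

lemma SGWeight.sgWt_pos (hΛ : SGWeight n Λ ρ) (m₁ m₂ : ℝ) (q : En n × En n) :
    0 < sgWt Λ m₁ m₂ q :=
  mul_pos (rpow_pos_of_pos (hΛ.pos _) _) (rpow_pos_of_pos (hΛ.pos _) _)

lemma SGWeight.sgWt_mul (hΛ : SGWeight n Λ ρ) (a b a' b' : ℝ) (q : En n × En n) :
    sgWt Λ a b q * sgWt Λ a' b' q = sgWt Λ (a + a') (b + b') q := by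
  simp only [sgWt, rpow_add (hΛ.pos _)]; ring

lemma SGWeight.sgWt_rpow (hΛ : SGWeight n Λ ρ) (a b s : ℝ) (q : En n × En n) :
    sgWt Λ a b q ^ s = sgWt Λ (a * s) (b * s) q := by
  have h1 := hΛ.pos q.1
  have h2 := hΛ.pos q.2
  simp only [sgWt]
  rw [mul_rpow (by positivity) (by positivity), ← rpow_mul h1.le, ← rpow_mul h2.le]

lemma SGWeight.exists_sgWt_le (hΛ : SGWeight n Λ ρ) {a b a' b' : ℝ} (ha : a ≤ a') (hb : b ≤ b') :
    ∃ C : ℝ, 0 < C ∧ ∀ q, sgWt Λ a b q ≤ C * sgWt Λ a' b' q := by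
  obtain ⟨C, hC, h⟩ := exists_rpow_le_rpow hΛ.lower ha
  obtain ⟨D, hD, h'⟩ := exists_rpow_le_rpow hΛ.lower hb
  refine ⟨D * C, by positivity, fun q => ?_⟩
  have h1 := hΛ.pos q.1
  have h2 := hΛ.pos q.2
  calc _ ≤ (D * Λ q.1 ^ b') * (C * Λ q.2 ^ a') := by
        unfold sgWt
        gcongr
        · exact h' _
        · exact h _
    _ = _ := by unfold sgWt; ring

/-- A symbol controlled by `Λ(x)^{m₂} Λ(ξ)^{m₁}` that gains `ρ` in each factor with the first
derivative in the corresponding variable. -/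
structure SGSymbol {F : Type*} [NormedAddCommGroup F] [NormedSpace ℝ F] (Λ : En n → ℝ)
    (ρ m₁ m₂ : ℝ) (b : En n × En n → F) : Prop where
  base : SymbolBound (fun _ : Unit => b) (fun _ => sgWt Λ m₁ m₂)
  dx : ∀ k, SymbolBound (fun _ : Unit => dirDeriv (dirX k) b) (fun _ => sgWt Λ m₁ (m₂ - ρ))
  dxi : ∀ j, SymbolBound (fun _ : Unit => dirDeriv (dirXi j) b) (fun _ => sgWt Λ (m₁ - ρ) m₂)
  dxdxi : ∀ k j, SymbolBound (fun _ : Unit => dirDeriv (dirX k) (dirDeriv (dirXi j) b))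
    (fun _ => sgWt Λ (m₁ - ρ) (m₂ - ρ))

lemma sum_dir_smul (z : En n × En n) :
    ∑ b : Fin n ⊕ Fin n, (Sum.elim
      (fun i => (EuclideanSpace.proj i : En n →L[ℝ] ℝ).comp (ContinuousLinearMap.fst ℝ _ (En n)))
      (fun i => (EuclideanSpace.proj i : En n →L[ℝ] ℝ).comp (ContinuousLinearMap.snd ℝ (En n) _))
      b) z • (Sum.elim dirX dirXi b : En n × En n) = z := by
  rw [Fintype.sum_sum_type]
  ext j
  · simp [dirX, dirXi, Prod.fst_sum, Pi.single_apply]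
  · simp [dirX, dirXi, Prod.snd_sum, Pi.single_apply]

lemma SGSymbol.of_sgClass (hΛ : SGWeight n Λ ρ) {m₁ m₂ : ℝ} {σ : En n → En n → ℂ}
    (hσ : SGClass Λ ρ m₁ m₂ σ) :
    SGSymbol Λ ρ m₁ m₂ (fun q : En n × En n => σ q.1 q.2) := by
  set f : En n × En n → ℂ := fun q => σ q.1 q.2
  have hs : ContDiff ℝ (⊤ : ℕ∞) f := hσ.1
  have key : ∀ α β : Fin n → ℕ, SymbolBound
      (fun _ : Unit => multiDeriv dirX α (multiDeriv dirXi β f))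
      (fun _ => sgWt Λ (m₁ - ρ * ∑ i, (β i : ℝ)) (m₂ - ρ * ∑ i, (α i : ℝ))) := by
    intro α β
    refine SymbolBound.of_words (Sum.elim dirX dirXi) _ sum_dir_smul
      (fun g => ∃ α' β', g = fun _ => multiDeriv dirX (α + α') (multiDeriv dirXi (β + β') f))
      ?_ ?_ ?_ ⟨0, 0, by simp⟩
    · rintro _ ⟨α', β', rfl⟩ (b | b)
      · refine ⟨α' + Pi.single b 1, β', ?_⟩
        funext _
        rw [← add_assoc, multiDeriv_add_single _ _ (contDiff_multiDeriv _ _ hs)]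
        rfl
      · refine ⟨α', β' + Pi.single b 1, ?_⟩
        funext _
        rw [← add_assoc, multiDeriv_add_single _ _ hs,
          ← dirDeriv_multiDeriv _ _ (contDiff_multiDeriv _ _ hs)]
        rfl
    · rintro _ ⟨α', β', rfl⟩ _
      exact contDiff_multiDeriv _ _ (contDiff_multiDeriv _ _ hs)
    · rintro _ ⟨α', β', rfl⟩
      obtain ⟨C, hC, hb⟩ := hσ.2 (α + α') (β + β')
      have aux : ∀ (m : ℝ) (a a' : Fin n → ℕ),
          m - ρ * ∑ i, ((a + a') i : ℝ) ≤ m - ρ * ∑ i, (a i : ℝ) := by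
        intro m a a'
        have hρ := hΛ.rho_pos
        gcongr
        simp
      obtain ⟨D, hD, hd⟩ := hΛ.exists_sgWt_le (aux m₁ β β') (aux m₂ α α')
      refine ⟨C * D, by positivity, fun _ z => ?_⟩
      have h1 := hb z.1 z.2
      rw [mixpd_eq_multiDeriv _ _ hs, mul_assoc] at h1
      rw [mul_assoc]
      exact h1.trans (mul_le_mul_of_nonneg_left (hd z) hC.le)
  have h1 : ∀ j : Fin n, ∑ i, (((0 + Pi.single j 1 : Fin n → ℕ) i : ℕ) : ℝ) = 1 := fun j => by
    rw [← Nat.cast_sum]; simp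
  refine ⟨?_, fun k => ?_, fun j => ?_, fun k j => ?_⟩
  · have := key 0 0
    simpa [multiDeriv_zero] using this
  · have := key (0 + Pi.single k 1) 0
    rw [multiDeriv_add_single _ _ (contDiff_multiDeriv _ _ hs), h1] at this
    simpa [multiDeriv_zero] using this
  · have := key 0 (0 + Pi.single j 1)
    rw [multiDeriv_add_single _ _ hs, h1] at this
    simpa [multiDeriv_zero] using this
  · have := key (0 + Pi.single k 1) (0 + Pi.single j 1)
    rw [multiDeriv_add_single _ _ (contDiff_multiDeriv _ _ hs),
      multiDeriv_add_single _ _ hs, h1, h1] at this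
    simpa [multiDeriv_zero] using this

lemma SGSymbol.of_sgmClass (hΛ : SGWeight n Λ ρ) {m₁ m₂ : ℝ} {σ : En n → En n → ℂ}
    (hσ : SGMClass Λ ρ m₁ m₂ σ) :
    SGSymbol Λ ρ m₁ m₂ (fun q : En n × En n => σ q.1 q.2) := by
  have h := hσ 0 0 (by simp) (by simp)
  have hz : ∀ (g : En n → ℂ), mpd 0 g = g := fun g => multiDeriv_zero _ g
  have : (fun x ξ => ((∏ i, x i ^ (0 : Fin n → ℕ) i : ℝ) : ℂ) *
      ((∏ i, ξ i ^ (0 : Fin n → ℕ) i : ℝ) : ℂ) * mixpd 0 0 σ x ξ) = σ := by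
    funext x ξ
    simp [mixpd, hz]
  rw [this] at h
  exact .of_sgClass hΛ h

end SGSymbol

section DirDerivRules

variable {E F G : Type*} [NormedAddCommGroup E] [NormedSpace ℝ E]
  [NormedAddCommGroup F] [NormedSpace ℝ F] [NormedAddCommGroup G] [NormedSpace ℝ G]

lemma dirDeriv_add {f g : E → F} (hf : ContDiff ℝ (⊤ : ℕ∞) f) (hg : ContDiff ℝ (⊤ : ℕ∞) g)
    (v : E) : dirDeriv v (fun z => f z + g z) = fun z => dirDeriv v f z + dirDeriv v g z := by
  ext z
  simp only [dirDeriv]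
  rw [fderiv_fun_add (hf.differentiable (by simp) z) (hg.differentiable (by simp) z)]
  rfl

lemma dirDeriv_clm_comp (L : F →L[ℝ] G) {f : E → F} (hf : ContDiff ℝ (⊤ : ℕ∞) f) (v : E) :
    dirDeriv v (fun z => L (f z)) = fun z => L (dirDeriv v f z) := by
  ext z
  have := L.hasFDerivAt.comp z (hf.differentiable (by simp) z).hasFDerivAt
  change fderiv ℝ (L ∘ f) z v = _
  rw [this.fderiv]
  rfl

lemma dirDeriv_mul {𝔸 : Type*} [NormedCommRing 𝔸] [NormedAlgebra ℝ 𝔸] {f g : E → 𝔸}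
    (hf : ContDiff ℝ (⊤ : ℕ∞) f) (hg : ContDiff ℝ (⊤ : ℕ∞) g) (v : E) :
    dirDeriv v (fun z => f z * g z) = fun z => dirDeriv v f z * g z + f z * dirDeriv v g z := by
  ext z
  simp only [dirDeriv]
  rw [fderiv_fun_mul (hf.differentiable (by simp) z) (hg.differentiable (by simp) z)]
  simp [mul_comm, add_comm]

lemma dirDeriv_rpow {f : E → ℝ} (hf : ContDiff ℝ (⊤ : ℕ∞) f) (h0 : ∀ z, 0 < f z) (s : ℝ) (v : E) :
    dirDeriv v (fun z => f z ^ s) = fun z => s * (f z ^ (s - 1) * dirDeriv v f z) := by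
  ext z
  have := ((hf.differentiable (by simp) z).hasFDerivAt).rpow_const (p := s) (Or.inl (h0 z).ne')
  simp only [dirDeriv]
  rw [this.fderiv]
  simp [mul_assoc]

end DirDerivRules

namespace SGSymbol

variable {n : ℕ} {Λ : En n → ℝ} {ρ m₁ m₂ k₁ k₂ : ℝ} {F G : Type*}
  [NormedAddCommGroup F] [NormedSpace ℝ F] [NormedAddCommGroup G] [NormedSpace ℝ G]

lemma smooth {b : En n × En n → F} (hb : SGSymbol Λ ρ m₁ m₂ b) : ContDiff ℝ (⊤ : ℕ∞) b :=
  hb.base.1 ()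

lemma add {b c : En n × En n → F} (hb : SGSymbol Λ ρ m₁ m₂ b) (hc : SGSymbol Λ ρ m₁ m₂ c) :
    SGSymbol Λ ρ m₁ m₂ (fun q => b q + c q) := by
  refine ⟨hb.base.add hc.base, fun k => ?_, fun j => ?_, fun k j => ?_⟩
  · rw [dirDeriv_add hb.smooth hc.smooth]
    exact (hb.dx k).add (hc.dx k)
  · rw [dirDeriv_add hb.smooth hc.smooth]
    exact (hb.dxi j).add (hc.dxi j)
  · rw [dirDeriv_add hb.smooth hc.smooth,
      dirDeriv_add (contDiff_dirDeriv hb.smooth _) (contDiff_dirDeriv hc.smooth _)]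
    exact (hb.dxdxi k j).add (hc.dxdxi k j)

lemma clm_comp (L : F →L[ℝ] G) {b : En n × En n → F} (hb : SGSymbol Λ ρ m₁ m₂ b) :
    SGSymbol Λ ρ m₁ m₂ (fun q => L (b q)) := by
  refine ⟨hb.base.clm_comp L, fun k => ?_, fun j => ?_, fun k j => ?_⟩
  · rw [dirDeriv_clm_comp L hb.smooth]
    exact (hb.dx k).clm_comp L
  · rw [dirDeriv_clm_comp L hb.smooth]
    exact (hb.dxi j).clm_comp L
  · rw [dirDeriv_clm_comp L hb.smooth, dirDeriv_clm_comp L (contDiff_dirDeriv hb.smooth _)]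
    exact (hb.dxdxi k j).clm_comp L

lemma mono (hΛ : SGWeight n Λ ρ) {b : En n × En n → F} (hb : SGSymbol Λ ρ m₁ m₂ b)
    (h₁ : m₁ ≤ k₁) (h₂ : m₂ ≤ k₂) : SGSymbol Λ ρ k₁ k₂ b := by
  have aux : ∀ {a b a' b' : ℝ} {f : En n × En n → F},
      SymbolBound (fun _ : Unit => f) (fun _ => sgWt Λ a b) → a ≤ a' → b ≤ b' →
      SymbolBound (fun _ : Unit => f) (fun _ => sgWt Λ a' b') := by
    intro a b a' b' f hf ha hb
    obtain ⟨C, hC, h⟩ := hΛ.exists_sgWt_le ha hb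
    exact hf.mono C hC.le fun _ z => h z
  exact ⟨aux hb.base h₁ h₂, fun k => aux (hb.dx k) h₁ (by linarith),
    fun j => aux (hb.dxi j) (by linarith) h₂,
    fun k j => aux (hb.dxdxi k j) (by linarith) (by linarith)⟩

lemma mul (hΛ : SGWeight n Λ ρ) {𝔸 : Type*} [NormedCommRing 𝔸] [NormedAlgebra ℝ 𝔸]
    {b c : En n × En n → 𝔸} (hb : SGSymbol Λ ρ m₁ m₂ b) (hc : SGSymbol Λ ρ k₁ k₂ c) :
    SGSymbol Λ ρ (m₁ + k₁) (m₂ + k₂) (fun q => b q * c q) := by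
  have aux : ∀ {a a' d d' e e' : ℝ} {f g : En n × En n → 𝔸},
      SymbolBound (fun _ : Unit => f) (fun _ => sgWt Λ a a') →
      SymbolBound (fun _ : Unit => g) (fun _ => sgWt Λ d d') → a + d = e → a' + d' = e' →
      SymbolBound (fun _ : Unit => fun z => f z * g z) (fun _ => sgWt Λ e e') := by
    intro a a' d d' e e' f g hf hg h1 h2
    exact (hf.mul hg).congr_weight fun _ z => by rw [hΛ.sgWt_mul, h1, h2]
  refine ⟨aux hb.base hc.base rfl rfl, fun k => ?_, fun j => ?_, fun k j => ?_⟩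
  · rw [dirDeriv_mul hb.smooth hc.smooth]
    exact (aux (hb.dx k) hc.base (by ring) (by ring)).add
      (aux hb.base (hc.dx k) (by ring) (by ring))
  · rw [dirDeriv_mul hb.smooth hc.smooth]
    exact (aux (hb.dxi j) hc.base (by ring) (by ring)).add
      (aux hb.base (hc.dxi j) (by ring) (by ring))
  · have sb := contDiff_dirDeriv hb.smooth (dirXi j)
    have sc := contDiff_dirDeriv hc.smooth (dirXi j)
    rw [dirDeriv_mul hb.smooth hc.smooth, dirDeriv_add (sb.mul hc.smooth) (hb.smooth.mul sc),
      dirDeriv_mul sb hc.smooth, dirDeriv_mul hb.smooth sc]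
    exact ((aux (hb.dxdxi k j) hc.base (by ring) (by ring)).add
      (aux (hb.dxi j) (hc.dx k) (by ring) (by ring))).add
      ((aux (hb.dx k) (hc.dxi j) (by ring) (by ring)).add
      (aux hb.base (hc.dxdxi k j) (by ring) (by ring)))

lemma rpow (hΛ : SGWeight n Λ ρ) {f : En n × En n → ℝ} (hf : SGSymbol Λ ρ m₁ m₂ f) {c : ℝ}
    (hc : 0 < c) (hcf : ∀ q, c * sgWt Λ m₁ m₂ q ≤ f q) (s : ℝ) :
    SGSymbol Λ ρ (m₁ * s) (m₂ * s) (fun q => f q ^ s) := by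
  have hpos : ∀ q, 0 < f q := fun q => (mul_pos hc (hΛ.sgWt_pos _ _ q)).trans_le (hcf q)
  have hp : ∀ s : ℝ, SymbolBound (fun _ : Unit => fun q => f q ^ s)
      (fun _ => sgWt Λ (m₁ * s) (m₂ * s)) := fun s =>
    (hf.base.rpow (fun _ z => hΛ.sgWt_pos _ _ z) hc (fun _ z => hcf z) s).congr_weight
      fun _ z => hΛ.sgWt_rpow _ _ _ z
  have aux : ∀ {a a' d d' e e' : ℝ} {f g : En n × En n → ℝ},
      SymbolBound (fun _ : Unit => f) (fun _ => sgWt Λ a a') →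
      SymbolBound (fun _ : Unit => g) (fun _ => sgWt Λ d d') → a + d = e → a' + d' = e' →
      SymbolBound (fun _ : Unit => fun z => f z * g z) (fun _ => sgWt Λ e e') := by
    intro a a' d d' e e' f g hf hg h1 h2
    exact (hf.mul hg).congr_weight fun _ z => by rw [hΛ.sgWt_mul, h1, h2]
  refine ⟨hp s, fun k => ?_, fun j => ?_, fun k j => ?_⟩
  · rw [dirDeriv_rpow hf.smooth hpos]
    exact (aux (hp (s - 1)) (hf.dx k) (by ring) (by ring)).const_mul s
  · rw [dirDeriv_rpow hf.smooth hpos]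
    exact (aux (hp (s - 1)) (hf.dxi j) (by ring) (by ring)).const_mul s
  · have sp := (hp (s - 1)).1 ()
    have sx := contDiff_dirDeriv hf.smooth (dirXi j)
    have e : dirDeriv (dirX k) (dirDeriv (dirXi j) fun q => f q ^ s)
        = fun q => s * ((s - 1) * (f q ^ (s - 1 - 1) * dirDeriv (dirX k) f q) *
            dirDeriv (dirXi j) f q
              + f q ^ (s - 1) * dirDeriv (dirX k) (dirDeriv (dirXi j) f) q) := by
      have h1 := dirDeriv_clm_comp (s • ContinuousLinearMap.id ℝ ℝ) (sp.mul sx) (dirX k)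
      simp only [_root_.smul_apply, ContinuousLinearMap.id_apply, smul_eq_mul] at h1
      rw [dirDeriv_rpow hf.smooth hpos, h1, dirDeriv_mul sp sx, dirDeriv_rpow hf.smooth hpos]
    rw [e]
    exact ((aux ((aux (hp (s - 1 - 1)) (hf.dx k) rfl rfl).const_mul (s - 1)) (hf.dxi j)
      (by ring) (by ring)).add
      (aux (hp (s - 1)) (hf.dxdxi k j) (by ring) (by ring))).const_mul s

lemma const_mul {𝔸 : Type*} [NormedCommRing 𝔸] [NormedAlgebra ℝ 𝔸]
    {b : En n × En n → 𝔸} (a : 𝔸) (hb : SGSymbol Λ ρ m₁ m₂ b) :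
    SGSymbol Λ ρ m₁ m₂ (fun q => a * b q) :=
  hb.clm_comp (ContinuousLinearMap.mul ℝ 𝔸 a)

lemma weight_fst (hΛ : SGWeight n Λ ρ) (s : ℝ) :
    SGSymbol Λ ρ 0 s (fun q => Λ q.1 ^ s) := by
  have e : ∀ v, dirDeriv v (fun q : En n × En n => Λ q.1) = fun q => dirDeriv v.1 Λ q.1 := by
    intro v
    have := dirDeriv_comp_clm_add (ContinuousLinearMap.fst ℝ (En n) (En n)) 0 hΛ.smooth v
    simpa using this
  have z : dirDeriv (0 : En n) Λ = fun _ => 0 := by ext; simp [dirDeriv]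
  have hA : ‖ContinuousLinearMap.fst ℝ (En n) (En n)‖ ≤ 1 := ContinuousLinearMap.norm_fst_le ..
  have h1 : SGSymbol Λ ρ 0 1 (fun q => Λ q.1) := by
    refine ⟨?_, fun k => ?_, fun j => ?_, fun k j => ?_⟩
    · exact (hΛ.bound.comp_clm (fun _ => ContinuousLinearMap.fst ℝ (En n) (En n)) 1
        fun _ => hA).congr_weight fun _ z => by simp [sgWt]
    · rw [e]
      exact ((hΛ.bound_deriv k).comp_clm (fun _ => ContinuousLinearMap.fst ℝ (En n) (En n)) 1
        fun _ => hA).congr_weight fun _ z => by simp [sgWt]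
    · rw [e, dirXi, z]
      exact .zero
    · rw [e (dirXi j), dirXi, z]
      refine SymbolBound.zero.congr_fun fun _ q => ?_
      simp [dirDeriv]
  have := h1.rpow hΛ one_pos (fun q => by simp [sgWt]) s
  simpa using this

lemma weight_snd (hΛ : SGWeight n Λ ρ) (s : ℝ) :
    SGSymbol Λ ρ s 0 (fun q => Λ q.2 ^ s) := by
  have e : ∀ v, dirDeriv v (fun q : En n × En n => Λ q.2) = fun q => dirDeriv v.2 Λ q.2 := by
    intro v
    have := dirDeriv_comp_clm_add (ContinuousLinearMap.snd ℝ (En n) (En n)) 0 hΛ.smooth v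
    simpa using this
  have z : dirDeriv (0 : En n) Λ = fun _ => 0 := by ext; simp [dirDeriv]
  have hA : ‖ContinuousLinearMap.snd ℝ (En n) (En n)‖ ≤ 1 := ContinuousLinearMap.norm_snd_le ..
  have h1 : SGSymbol Λ ρ 1 0 (fun q => Λ q.2) := by
    refine ⟨?_, fun k => ?_, fun j => ?_, fun k j => ?_⟩
    · exact (hΛ.bound.comp_clm (fun _ => ContinuousLinearMap.snd ℝ (En n) (En n)) 1
        fun _ => hA).congr_weight fun _ z => by simp [sgWt]
    · rw [e, dirX, z]
      exact .zero
    · rw [e]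
      exact ((hΛ.bound_deriv j).comp_clm (fun _ => ContinuousLinearMap.snd ℝ (En n) (En n)) 1
        fun _ => hA).congr_weight fun _ z => by simp [sgWt]
    · rw [dirDeriv_comm (f := fun q : En n × En n => Λ q.2) (hΛ.smooth.comp contDiff_snd),
        e (dirX k), dirX, z]
      refine SymbolBound.zero.congr_fun fun _ q => ?_
      simp [dirDeriv]
  have := h1.rpow hΛ one_pos (fun q => by simp [sgWt]) s
  simpa using this

lemma weight (hΛ : SGWeight n Λ ρ) (m₁ m₂ : ℝ) : SGSymbol Λ ρ m₁ m₂ (sgWt Λ m₁ m₂) := by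
  have := (weight_fst hΛ m₂).mul hΛ (weight_snd hΛ m₁)
  rw [zero_add, add_zero] at this
  exact this

end SGSymbol

/-! ### Phases and Schwartz functions -/

section Phase

variable {n : ℕ}

/-- The phase `e^{i⟨x,t⟩}`. -/
def ph (x t : En n) : ℂ := Complex.exp (Complex.I * ((⟪x, t⟫ : ℝ) : ℂ))

lemma norm_ph (x t : En n) : ‖ph x t‖ = 1 := by
  rw [ph, mul_comm, Complex.norm_exp_ofReal_mul_I]

lemma ph_sub (x s t : En n) : ph x (s - t) = ph x s * (starRingEnd ℂ) (ph x t) := by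
  rw [ph, ph, ph, ← Complex.exp_conj, ← Complex.exp_add, inner_sub_right]
  congr 1
  simp
  ring

lemma continuous_ph : Continuous fun q : En n × En n => ph q.1 q.2 := by
  unfold ph; fun_prop

lemma hasDerivAt_ph (x t v : En n) (r : ℝ) :
    HasDerivAt (fun s : ℝ => ph (x + s • v) t)
      (Complex.I * ((⟪v, t⟫ : ℝ) : ℂ) * ph (x + r • v) t) r := by
  have h1 : HasDerivAt (fun s : ℝ => ((⟪x + s • v, t⟫ : ℝ) : ℂ)) ((⟪v, t⟫ : ℝ) : ℂ) r := by
    have : HasDerivAt (fun s : ℝ => (⟪x + s • v, t⟫ : ℝ)) ⟪v, t⟫ r := by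
      have e : (fun s : ℝ => (⟪x + s • v, t⟫ : ℝ)) = fun s => ⟪x, t⟫ + s * ⟪v, t⟫ := by
        ext s; rw [inner_add_left, real_inner_smul_left]
      rw [e]
      simpa using ((hasDerivAt_id r).mul_const ⟪v, t⟫).const_add ⟪x, t⟫
    exact this.ofReal_comp
  have := (h1.const_mul Complex.I).cexp
  rwa [mul_comm] at this

lemma contDiff_ph (x : En n) : ContDiff ℝ (⊤ : ℕ∞) (ph x) := by
  unfold ph
  have h : ContDiff ℝ (⊤ : ℕ∞) (fun t : En n => ((⟪x, t⟫ : ℝ) : ℂ)) :=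
    Complex.ofRealCLM.contDiff.comp (innerSL ℝ x).contDiff
  exact (contDiff_const.mul h).cexp

lemma dirDeriv_ph (x v : En n) :
    dirDeriv v (ph x) = fun t => Complex.I * ((⟪x, v⟫ : ℝ) : ℂ) * ph x t := by
  ext t
  have h1 : HasDerivAt (fun s : ℝ => ph x (t + s • v))
      (Complex.I * ((⟪x, v⟫ : ℝ) : ℂ) * ph x t) 0 := by
    have := hasDerivAt_ph t x v 0
    simp only [ph, zero_smul, add_zero] at this ⊢
    simpa only [real_inner_comm] using this
  have h2 : HasDerivAt (fun s : ℝ => ph x (t + s • v)) (fderiv ℝ (ph x) t v) 0 :=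
    ((contDiff_ph x).differentiable (by simp) t).hasFDerivAt.hasLineDerivAt v
  exact h2.unique h1

lemma symbolBound_ph (x : En n) : SymbolBound (fun _ : Unit => ph x) (fun _ _ => 1) := by
  refine SymbolBound.of_words (fun i => EuclideanSpace.single i (1 : ℝ))
    (fun i => EuclideanSpace.proj i) (fun z => sum_coord_smul z)
    (fun f => ∃ a : ℂ, f = fun _ t => a * ph x t) ?_ ?_ ?_ ⟨1, by simp⟩
  · rintro _ ⟨a, rfl⟩ b
    refine ⟨a * (Complex.I * ((⟪x, EuclideanSpace.single b (1 : ℝ)⟫ : ℝ) : ℂ)), ?_⟩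
    funext _
    have := dirDeriv_clm_comp (ContinuousLinearMap.mul ℝ ℂ a) (contDiff_ph x)
      (EuclideanSpace.single b (1 : ℝ))
    rw [dirDeriv_ph] at this
    simpa [mul_assoc] using this
  · rintro _ ⟨a, rfl⟩ _
    exact contDiff_const.mul (contDiff_ph x)
  · rintro _ ⟨a, rfl⟩
    exact ⟨‖a‖, norm_nonneg _, fun _ z => by simp [norm_ph]⟩

lemma SymbolBound.hasTemperateGrowth {E F : Type*} [NormedAddCommGroup E] [NormedSpace ℝ E]
    [NormedAddCommGroup F] [NormedSpace ℝ F] {f : E → F} {K : ℕ}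
    (h : SymbolBound (fun _ : Unit => f) (fun _ z => (1 + ‖z‖) ^ K)) :
    f.HasTemperateGrowth :=
  ⟨h.1 (), fun k => let ⟨C, _, hb⟩ := h.2 k; ⟨K, C, fun z => hb () z⟩⟩

lemma hasTemperateGrowth_ph (x : En n) : (ph x).HasTemperateGrowth :=
  SymbolBound.hasTemperateGrowth (K := 0) (by simpa using symbolBound_ph x)

/-- Multiplication of a Schwartz function by the phase `e^{i⟨x,·⟩}`. -/
def modulate (x : En n) (u : SchwartzMap (En n) ℂ) : SchwartzMap (En n) ℂ :=
  SchwartzMap.smulLeftCLM ℂ (ph x) u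

lemma modulate_apply (x : En n) (u : SchwartzMap (En n) ℂ) (t : En n) :
    modulate x u t = ph x t * u t := by
  rw [modulate, SchwartzMap.smulLeftCLM_apply_apply (hasTemperateGrowth_ph x), smul_eq_mul]

open LineDeriv in
/-- Partial derivatives of Schwartz functions. -/
def sDeriv (j : Fin n) (u : SchwartzMap (En n) ℂ) : SchwartzMap (En n) ℂ :=
  ∂_{EuclideanSpace.single j (1 : ℝ)} u

lemma sDeriv_apply (j : Fin n) (u : SchwartzMap (En n) ℂ) (t : En n) :
    sDeriv j u t = dirDeriv (EuclideanSpace.single j (1 : ℝ)) u t :=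
  SchwartzMap.lineDerivOp_apply_eq_fderiv ..

lemma sDeriv_modulate (j : Fin n) (x : En n) (u : SchwartzMap (En n) ℂ) :
    sDeriv j (modulate x u) = (Complex.I * ((x j : ℝ) : ℂ)) • modulate x u
      + modulate x (sDeriv j u) := by
  ext t
  have e : (modulate x u : En n → ℂ) = fun t => ph x t * u t := by
    ext t; exact modulate_apply x u t
  rw [sDeriv_apply, e, dirDeriv_mul (contDiff_ph x) (u.smooth _), dirDeriv_ph]
  simp [modulate_apply, sDeriv_apply, EuclideanSpace.inner_single_right]
  ring

end Phase

/-! ### A bilinear pairing of Schwartz functions -/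

section Pairing

variable {n : ℕ}

lemma integrable_one_add_pow_mul (u : SchwartzMap (En n) ℂ) (K : ℕ) :
    Integrable fun x => (1 + ‖x‖) ^ K * ‖u x‖ := by
  have h1 := (u.integrable_pow_mul volume K).add u.integrable.norm
  refine (h1.const_mul (2 ^ K)).mono'
    (by have := u.continuous; fun_prop) (ae_of_all _ fun x => ?_)
  rw [norm_of_nonneg (by positivity)]
  have h2 : (1 + ‖x‖) ^ K ≤ 2 ^ K * (‖x‖ ^ K + 1) := by
    rcases le_total ‖x‖ 1 with h | h
    · calc _ ≤ (2 : ℝ) ^ K := by gcongr; linarith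
        _ ≤ _ := le_mul_of_one_le_right (by positivity)
          (by linarith [pow_nonneg (norm_nonneg x) K])
    · calc _ ≤ (2 * ‖x‖) ^ K := by gcongr; linarith
        _ ≤ _ := by rw [mul_pow]; gcongr; linarith
  calc _ ≤ 2 ^ K * (‖x‖ ^ K + 1) * ‖u x‖ := by gcongr
    _ = _ := by simp only [Pi.add_apply]; ring

lemma integrable_pow_mul_prod (u v : SchwartzMap (En n) ℂ) (K : ℕ) :
    Integrable fun p : En n × En n => (1 + ‖p‖) ^ K * (‖u p.1‖ * ‖v p.2‖) := by
  have h := (integrable_one_add_pow_mul u K).mul_prod (integrable_one_add_pow_mul v K)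
  refine h.mono' (by have := u.continuous; have := v.continuous; fun_prop)
    (ae_of_all _ fun p => ?_)
  rw [norm_of_nonneg (by positivity)]
  have : 1 + ‖p‖ ≤ (1 + ‖p.1‖) * (1 + ‖p.2‖) := by
    have h1 := norm_nonneg p.1
    have h2 := norm_nonneg p.2
    rw [Prod.norm_def]
    rcases max_cases ‖p.1‖ ‖p.2‖ with h | h <;> nlinarith
  calc _ ≤ ((1 + ‖p.1‖) * (1 + ‖p.2‖)) ^ K * (‖u p.1‖ * ‖v p.2‖) := by gcongr
    _ = _ := by rw [mul_pow]; ring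

/-- The pairing `∬ a(ξ,η) u(ξ) conj (v(η))`. -/
def pairing (a : En n × En n → ℂ) (u v : SchwartzMap (En n) ℂ) : ℂ :=
  ∫ p, a p * (u p.1 * (starRingEnd ℂ) (v p.2))

lemma continuous_tensor (u v : SchwartzMap (En n) ℂ) :
    Continuous fun p : En n × En n => u p.1 * (starRingEnd ℂ) (v p.2) := by
  have := u.continuous; have := v.continuous; fun_prop

lemma norm_mul_tensor_le {a : ℂ} {A : ℝ} (p : En n × En n) (u v : SchwartzMap (En n) ℂ)
    (ha : ‖a‖ ≤ A) :
    ‖a * (u p.1 * (starRingEnd ℂ) (v p.2))‖ ≤ A * (‖u p.1‖ * ‖v p.2‖) := by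
  rw [norm_mul, norm_mul, RCLike.norm_conj]
  gcongr

lemma integrable_pairing {a : En n × En n → ℂ} (ha : Continuous a) {C : ℝ} {K : ℕ}
    (hb : ∀ p, ‖a p‖ ≤ C * (1 + ‖p‖) ^ K) (u v : SchwartzMap (En n) ℂ) :
    Integrable fun p : En n × En n => a p * (u p.1 * (starRingEnd ℂ) (v p.2)) := by
  refine ((integrable_pow_mul_prod u v K).const_mul C).mono'
    (ha.mul (continuous_tensor u v)).aestronglyMeasurable (ae_of_all _ fun p => ?_)
  exact (norm_mul_tensor_le p u v (hb p)).trans_eq (mul_assoc _ _ _)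

lemma norm_pairing_le {a : En n × En n → ℂ} {C : ℝ} {K : ℕ}
    (hb : ∀ p, ‖a p‖ ≤ C * (1 + ‖p‖) ^ K) (u v : SchwartzMap (En n) ℂ) :
    ‖pairing a u v‖ ≤ C * ∫ p : En n × En n, (1 + ‖p‖) ^ K * (‖u p.1‖ * ‖v p.2‖) := by
  rw [← integral_const_mul]
  refine norm_integral_le_of_norm_le ((integrable_pow_mul_prod u v K).const_mul C)
    (ae_of_all _ fun p => ?_)
  exact (norm_mul_tensor_le p u v (hb p)).trans_eq (mul_assoc _ _ _)

/-- Differentiation of the pairing in a parameter. -/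
lemma hasDerivAt_pairing {A A' : ℝ → En n × En n → ℂ} {t₀ C C₀ : ℝ} {K K₀ : ℕ}
    (hA : ∀ t, Continuous (A t)) (hA' : Continuous (A' t₀))
    (hd : ∀ t ∈ Metric.ball t₀ 1, ∀ p, HasDerivAt (fun s => A s p) (A' t p) t)
    (hb : ∀ p, ‖A t₀ p‖ ≤ C₀ * (1 + ‖p‖) ^ K₀)
    (hb' : ∀ t ∈ Metric.ball t₀ 1, ∀ p, ‖A' t p‖ ≤ C * (1 + ‖p‖) ^ K)
    (u v : SchwartzMap (En n) ℂ) :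
    HasDerivAt (fun t => pairing (A t) u v) (pairing (A' t₀) u v) t₀ := by
  unfold pairing
  refine (hasDerivAt_integral_of_dominated_loc_of_deriv_le
    (F := fun t p => A t p * (u p.1 * (starRingEnd ℂ) (v p.2)))
    (F' := fun t p => A' t p * (u p.1 * (starRingEnd ℂ) (v p.2)))
    (bound := fun p : En n × En n => C * ((1 + ‖p‖) ^ K * (‖u p.1‖ * ‖v p.2‖)))
    (Metric.ball_mem_nhds t₀ one_pos) ?_ (integrable_pairing (hA t₀) hb u v) ?_ ?_ ?_ ?_).2
  · exact Eventually.of_forall fun t => ((hA t).mul (continuous_tensor u v)).aestronglyMeasurable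
  · exact (hA'.mul (continuous_tensor u v)).aestronglyMeasurable
  · refine ae_of_all _ fun p t ht => ?_
    exact (norm_mul_tensor_le p u v (hb' t ht p)).trans_eq (mul_assoc _ _ _)
  · exact (integrable_pow_mul_prod u v K).const_mul C
  · exact ae_of_all _ fun p t ht => (hd t ht p).mul_const _

lemma dirDeriv_tensor (u v : SchwartzMap (En n) ℂ) (d : En n × En n) :
    dirDeriv d (fun p : En n × En n => u p.1 * (starRingEnd ℂ) (v p.2)) = fun p =>
      dirDeriv d.1 u p.1 * (starRingEnd ℂ) (v p.2)
        + u p.1 * (starRingEnd ℂ) (dirDeriv d.2 v p.2) := by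
  have su : ContDiff ℝ (⊤ : ℕ∞) (fun p : En n × En n => u p.1) := (u.smooth _).comp contDiff_fst
  have sv : ContDiff ℝ (⊤ : ℕ∞) (fun p : En n × En n => v p.2) := (v.smooth _).comp contDiff_snd
  have e1 : dirDeriv d (fun p : En n × En n => u p.1) = fun p => dirDeriv d.1 u p.1 := by
    simpa using dirDeriv_comp_clm_add (ContinuousLinearMap.fst ℝ (En n) (En n)) 0 (u.smooth ⊤) d
  have e2 : dirDeriv d (fun p : En n × En n => v p.2) = fun p => dirDeriv d.2 v p.2 := by
    simpa using dirDeriv_comp_clm_add (ContinuousLinearMap.snd ℝ (En n) (En n)) 0 (v.smooth ⊤) d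
  have e3 := dirDeriv_clm_comp (Complex.conjCLE : ℂ →L[ℝ] ℂ) sv d
  have s3 : ContDiff ℝ (⊤ : ℕ∞) (fun p : En n × En n => (starRingEnd ℂ) (v p.2)) :=
    (Complex.conjCLE : ℂ →L[ℝ] ℂ).contDiff.comp sv
  have e4 : dirDeriv d (fun p : En n × En n => (starRingEnd ℂ) (v p.2))
      = fun p => (starRingEnd ℂ) (dirDeriv d.2 v p.2) := by
    rw [e2] at e3
    exact e3
  rw [dirDeriv_mul su s3, e1, e4]

/-- Integration by parts in the pairing. -/
lemma pairing_dirDeriv {a : En n × En n → ℂ} {K : ℕ}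
    (ha : SymbolBound (fun _ : Unit => a) (fun _ z => (1 + ‖z‖) ^ K))
    (u v u' v' : SchwartzMap (En n) ℂ) (d : En n × En n)
    (hu : ∀ p : En n × En n, u' p.1 * (starRingEnd ℂ) (v' p.2)
      = dirDeriv d (fun p : En n × En n => u p.1 * (starRingEnd ℂ) (v p.2)) p) :
    pairing a u' v' = -pairing (dirDeriv d a) u v := by
  obtain ⟨C, hC, hb⟩ := ha.exists_bound
  obtain ⟨D, hD, hd⟩ := (ha.fderiv_apply d).exists_bound
  have sa : ContDiff ℝ (⊤ : ℕ∞) a := ha.1 ()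
  have h1 := integrable_pairing (contDiff_dirDeriv sa d).continuous (fun p => hd () p) u v
  have h2 := integrable_pairing sa.continuous (fun p => hb () p) u' v'
  have h3 := integrable_pairing sa.continuous (fun p => hb () p) u v
  have hT : Differentiable ℝ (fun p : En n × En n => u p.1 * (starRingEnd ℂ) (v p.2)) := by
    have su : ContDiff ℝ (⊤ : ℕ∞) (fun p : En n × En n => u p.1) := (u.smooth _).comp contDiff_fst
    have sv : ContDiff ℝ (⊤ : ℕ∞) (fun p : En n × En n => v p.2) := (v.smooth _).comp contDiff_snd
    have s3 : ContDiff ℝ (⊤ : ℕ∞) (fun p : En n × En n => (starRingEnd ℂ) (v p.2)) :=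
      (Complex.conjCLE : ℂ →L[ℝ] ℂ).contDiff.comp sv
    exact (su.mul s3).differentiable (by simp)
  simp_rw [hu] at h2
  have : (volume : Measure (En n × En n)).IsAddHaarMeasure :=
    inferInstanceAs ((volume : Measure (En n)).prod volume).IsAddHaarMeasure
  have := integral_mul_fderiv_eq_neg_fderiv_mul_of_integrable h1 h2 h3
    (fun x _ => sa.differentiable (by simp) x) (fun x _ => hT x)
  unfold pairing
  simp_rw [hu]
  exact this

lemma pairing_sDeriv_left {a : En n × En n → ℂ} {K : ℕ}
    (ha : SymbolBound (fun _ : Unit => a) (fun _ z => (1 + ‖z‖) ^ K))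
    (u v : SchwartzMap (En n) ℂ) (j : Fin n) :
    pairing a (sDeriv j u) v = -pairing (dirDeriv (dirX j) a) u v := by
  refine pairing_dirDeriv ha u v _ _ _ fun p => ?_
  rw [dirDeriv_tensor, sDeriv_apply]
  simp [dirX, dirDeriv]

lemma pairing_sDeriv_right {a : En n × En n → ℂ} {K : ℕ}
    (ha : SymbolBound (fun _ : Unit => a) (fun _ z => (1 + ‖z‖) ^ K))
    (u v : SchwartzMap (En n) ℂ) (j : Fin n) :
    pairing a u (sDeriv j v) = -pairing (dirDeriv (dirXi j) a) u v := by
  refine pairing_dirDeriv ha u v _ _ _ fun p => ?_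
  rw [dirDeriv_tensor, sDeriv_apply]
  simp [dirXi, dirDeriv]

end Pairing

/-! ### Temperate amplitudes -/

section Temperate

variable {ι κ E F : Type*} [NormedAddCommGroup E] [NormedSpace ℝ E]
  [NormedAddCommGroup F] [NormedSpace ℝ F]

lemma SymbolBound.translate {f : ι → E → F} {w : ι → E → ℝ} (hf : SymbolBound f w) (b : ι → E) :
    SymbolBound (fun i z => f i (z + b i)) (fun i z => w i (z + b i)) := by
  refine ⟨fun i => (hf.1 i).comp (contDiff_id.add contDiff_const), fun k => ?_⟩
  obtain ⟨C, hC, hb⟩ := hf.2 k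
  exact ⟨C, hC, fun i z => by rw [iteratedFDeriv_comp_add_right]; exact hb i _⟩

/-- Freezing the first variable of a family. -/
lemma SymbolBound.slice {E' : Type*} [NormedAddCommGroup E'] [NormedSpace ℝ E']
    {f : ι → E × E' → F} {w : ι → E × E' → ℝ} (hf : SymbolBound f w) :
    SymbolBound (fun (k : ι × E) p => f k.1 (k.2, p)) (fun k p => w k.1 (k.2, p)) := by
  have h := ((hf.reindex (fun k : ι × E => k.1)).translate (fun k => (k.2, 0))).comp_clm
    (fun _ => ContinuousLinearMap.inr ℝ E E') ‖ContinuousLinearMap.inr ℝ E E'‖ (fun _ => le_rfl)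
  simpa using h

/-- Families with uniformly polynomially bounded derivatives. -/
def Temperate (c : ι → E → F) : Prop :=
  ∃ K : ℕ, SymbolBound c (fun _ z => (1 + ‖z‖) ^ K)

namespace Temperate

lemma smooth {c : ι → E → F} (hc : Temperate c) (i : ι) : ContDiff ℝ (⊤ : ℕ∞) (c i) :=
  hc.choose_spec.1 i

lemma of_le {c : ι → E → F} {w : ι → E → ℝ} (hc : SymbolBound c w) {A : ℝ} (hA : 0 ≤ A) {K : ℕ}
    (h : ∀ i z, w i z ≤ A * (1 + ‖z‖) ^ K) : Temperate c :=
  ⟨K, hc.mono A hA h⟩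

lemma exists_ge {c : ι → E → F} {K : ℕ} (hc : SymbolBound c (fun _ z => (1 + ‖z‖) ^ K))
    {K' : ℕ} (h : K ≤ K') : SymbolBound c (fun _ z => (1 + ‖z‖) ^ K') :=
  hc.mono 1 zero_le_one fun i z => by
    rw [one_mul]
    exact pow_le_pow_right₀ (by linarith [norm_nonneg z]) h

lemma add {c d : ι → E → F} (hc : Temperate c) (hd : Temperate d) :
    Temperate (fun i z => c i z + d i z) := by
  obtain ⟨K, hK⟩ := hc
  obtain ⟨K', hK'⟩ := hd
  exact ⟨max K K', (exists_ge hK (le_max_left _ _)).add (exists_ge hK' (le_max_right _ _))⟩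

lemma mul {𝔸 : Type*} [NormedRing 𝔸] [NormedAlgebra ℝ 𝔸] {c d : ι → E → 𝔸} (hc : Temperate c)
    (hd : Temperate d) : Temperate (fun i z => c i z * d i z) := by
  obtain ⟨K, hK⟩ := hc
  obtain ⟨K', hK'⟩ := hd
  exact ⟨K + K', (hK.mul hK').congr_weight fun i z => (pow_add _ _ _).symm⟩

lemma dirDeriv {c : ι → E → F} (hc : Temperate c) (v : E) :
    Temperate (fun i => dirDeriv v (c i)) := by
  obtain ⟨K, hK⟩ := hc
  exact ⟨K, hK.fderiv_apply v⟩

lemma clm (L : E →L[ℝ] F) : Temperate (fun (_ : ι) z => L z) :=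
  ⟨1, (SymbolBound.clm L).congr_weight fun _ _ => (pow_one _).symm⟩

lemma const (a : F) : Temperate (fun (_ : ι) (_ : E) => a) :=
  ⟨0, (SymbolBound.const a).congr_weight fun _ _ => (pow_zero _).symm⟩

lemma const_mul {𝔸 : Type*} [NormedRing 𝔸] [NormedAlgebra ℝ 𝔸] {c : ι → E → 𝔸} (a : 𝔸)
    (hc : Temperate c) : Temperate (fun i z => a * c i z) :=
  (const a).mul hc

lemma sum {J : Type*} (s : Finset J) {c : J → ι → E → F} (h : ∀ j ∈ s, Temperate (c j)) :
    Temperate (fun i z => ∑ j ∈ s, c j i z) := by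
  classical
  induction s using Finset.induction_on with
  | empty => simpa using const (0 : F)
  | insert a s ha ih =>
    simp only [Finset.sum_insert ha]
    exact (h a (by simp)).add (ih fun j hj => h j (by simp [hj]))

lemma reindex {c : ι → E → F} (hc : Temperate c) (a : κ → ι) : Temperate (fun k => c (a k)) := by
  obtain ⟨K, hK⟩ := hc
  exact ⟨K, hK.reindex a⟩

lemma comp_clm {E' : Type*} [NormedAddCommGroup E'] [NormedSpace ℝ E'] {c : ι → E → F}
    (hc : Temperate c) (A : E' →L[ℝ] E) : Temperate (fun i z => c i (A z)) := by
  obtain ⟨K, hK⟩ := hc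
  refine of_le (hK.comp_clm (fun _ => A) ‖A‖ fun _ => le_rfl) (A := (1 + ‖A‖) ^ K)
    (by positivity) (K := K) fun i z => ?_
  rw [← mul_pow]
  have := A.le_opNorm z
  have := norm_nonneg A
  have := norm_nonneg z
  gcongr
  nlinarith

end Temperate

end Temperate

/-! ### Oscillatory forms -/

section Form

variable {n : ℕ} {ι κ : Type*}

lemma pairing_add_smul_left {a : En n × En n → ℂ} (ha : Continuous a) {C : ℝ} {K : ℕ}
    (hb : ∀ p, ‖a p‖ ≤ C * (1 + ‖p‖) ^ K) (z : ℂ) (u u' v : SchwartzMap (En n) ℂ) :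
    pairing a (z • u + u') v = z * pairing a u v + pairing a u' v := by
  unfold pairing
  rw [← integral_const_mul, ← integral_add ((integrable_pairing ha hb u v).const_mul z)
    (integrable_pairing ha hb u' v)]
  congr 1
  ext p
  simp
  ring

/-- The variables `(x, ξ, η)` of an amplitude. -/
abbrev Ph3 (n : ℕ) := En n × (En n × En n)

/-- The contribution of frequency pairs at the point `x`. -/
def amp (c : Ph3 n → ℂ) (u : SchwartzMap (En n) ℂ) (x : En n) : ℂ :=
  pairing (fun p => c (x, p)) (modulate x u) (modulate x u)

/-- The oscillatory form `∭ e^{i⟨x,ξ-η⟩} c(x,ξ,η) u(ξ) conj (u(η))`. -/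
def form (c : Ph3 n → ℂ) (u : SchwartzMap (En n) ℂ) : ℂ := ∫ x, amp c u x

lemma amp_eq (c : Ph3 n → ℂ) (u : SchwartzMap (En n) ℂ) (x : En n) :
    amp c u x = pairing (fun p => ph x (p.1 - p.2) * c (x, p)) u u := by
  unfold amp pairing
  congr 1
  ext p
  simp only [modulate_apply, ph_sub, map_mul]
  ring

lemma norm_le_sum_abs (x : En n) : ‖x‖ ≤ ∑ j, |x j| := by
  conv_lhs => rw [← sum_coord_smul x]
  refine (norm_sum_le _ _).trans (Finset.sum_le_sum fun j _ => ?_)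
  simp [norm_smul]

lemma exists_pairing_decay (N : ℕ) {a : κ → En n × En n → ℂ} {lam : κ → ℝ} {K : ℕ}
    (hl : ∀ k, 0 ≤ lam k) (ha : SymbolBound a (fun k p => lam k * (1 + ‖p‖) ^ K))
    (u v : SchwartzMap (En n) ℂ) : ∃ C : ℝ, 0 ≤ C ∧ ∀ k x,
      ‖x‖ ^ N * ‖pairing (a k) (modulate x u) (modulate x v)‖ ≤ C * lam k := by
  induction N generalizing a u with
  | zero =>
    obtain ⟨C, hC, hb⟩ := ha.exists_bound
    refine ⟨C * ∫ p : En n × En n, (1 + ‖p‖) ^ K * (‖u p.1‖ * ‖v p.2‖),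
      mul_nonneg hC (integral_nonneg fun p => by positivity), fun k x => ?_⟩
    have := norm_pairing_le (a := a k) (C := C * lam k) (K := K)
      (fun p => (hb k p).trans_eq (mul_assoc _ _ _).symm) (modulate x u) (modulate x v)
    simp only [modulate_apply, norm_mul, norm_ph, one_mul] at this
    rw [pow_zero, one_mul]
    exact this.trans_eq (by ring)
  | succ N ih =>
    have key : ∀ j, ∃ C : ℝ, 0 ≤ C ∧ ∀ k x, ‖x‖ ^ N * (|x j| *
        ‖pairing (a k) (modulate x u) (modulate x v)‖) ≤ C * lam k := by
      intro j
      obtain ⟨C, hC, h1⟩ := ih (ha.fderiv_apply (dirX j)) u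
      obtain ⟨D, hD, h2⟩ := ih ha (sDeriv j u)
      refine ⟨C + D, by positivity, fun k x => ?_⟩
      obtain ⟨B, hB, hb⟩ := ha.exists_bound
      have hak : SymbolBound (fun _ : Unit => a k) (fun _ p => (1 + ‖p‖) ^ K) :=
        (ha.reindex (fun _ : Unit => k)).mono (lam k) (hl k) fun _ _ => le_rfl
      have e := pairing_sDeriv_left hak (modulate x u) (modulate x v) j
      rw [sDeriv_modulate, pairing_add_smul_left (ha.1 k).continuous
        (fun p => (hb k p).trans_eq (mul_assoc _ _ _).symm)] at e
      have e' : |x j| * ‖pairing (a k) (modulate x u) (modulate x v)‖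
          = ‖-pairing (dirDeriv (dirX j) (a k)) (modulate x u) (modulate x v)
            - pairing (a k) (modulate x (sDeriv j u)) (modulate x v)‖ := by
        rw [← e, add_sub_cancel_right]
        simp
      rw [e', add_mul]
      calc _ ≤ ‖x‖ ^ N * (‖pairing (dirDeriv (dirX j) (a k)) (modulate x u) (modulate x v)‖
            + ‖pairing (a k) (modulate x (sDeriv j u)) (modulate x v)‖) := by
            gcongr
            exact (norm_sub_le _ _).trans_eq (by rw [norm_neg])
        _ ≤ _ := by rw [mul_add]; exact add_le_add (h1 k x) (h2 k x)
    choose C hC h using key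
    refine ⟨∑ j, C j, Finset.sum_nonneg fun j _ => hC j, fun k x => ?_⟩
    calc _ ≤ ‖x‖ ^ N * ((∑ j, |x j|) * ‖pairing (a k) (modulate x u) (modulate x v)‖) := by
          rw [pow_succ, mul_assoc]
          gcongr
          exact norm_le_sum_abs x
      _ = ∑ j, ‖x‖ ^ N * (|x j| * ‖pairing (a k) (modulate x u) (modulate x v)‖) := by
          rw [Finset.sum_mul, Finset.mul_sum]
      _ ≤ _ := by rw [Finset.sum_mul]; exact Finset.sum_le_sum fun j _ => h j k x

lemma one_add_norm_pair_le {E E' : Type*} [NormedAddCommGroup E] [NormedAddCommGroup E']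
    (x : E) (p : E') : 1 + ‖(x, p)‖ ≤ (1 + ‖x‖) * (1 + ‖p‖) := by
  have h1 := norm_nonneg x
  have h2 := norm_nonneg p
  rw [Prod.norm_def]
  rcases max_cases ‖x‖ ‖p‖ with h | h <;> simp only at h ⊢ <;> nlinarith

/-- Rapid decay of the local contributions of a temperate family. -/
lemma Temperate.exists_amp_decay {c : ι → Ph3 n → ℂ} (hc : Temperate c)
    (u : SchwartzMap (En n) ℂ) : ∃ C : ℝ, 0 ≤ C ∧ ∀ i x,
      ‖amp (c i) u x‖ ≤ C * (1 + ‖x‖) ^ (-(n + 1 : ℝ)) := by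
  obtain ⟨K, hK⟩ := hc
  have h : SymbolBound (fun (k : ι × En n) p => c k.1 (k.2, p))
      (fun k p => (1 + ‖k.2‖) ^ K * (1 + ‖p‖) ^ K) :=
    hK.slice.mono 1 zero_le_one fun k p => by
      rw [one_mul, ← mul_pow]
      gcongr
      exact one_add_norm_pair_le _ _
  have hl : ∀ k : ι × En n, 0 ≤ (1 + ‖k.2‖) ^ K := fun k => by positivity
  obtain ⟨C, hC, h0⟩ := exists_pairing_decay 0 hl h u u
  obtain ⟨D, hD, h1⟩ := exists_pairing_decay (K + (n + 1)) hl h u u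
  refine ⟨2 ^ (K + (n + 1)) * (C * 2 ^ K + D), by positivity, fun i x => ?_⟩
  have e : (1 + ‖x‖) ^ (-(n + 1 : ℝ)) = ((1 + ‖x‖) ^ (n + 1))⁻¹ := by
    rw [Real.rpow_neg (by positivity)]
    norm_cast
  rw [e, ← div_eq_mul_inv, le_div_iff₀ (by positivity)]
  have h0' := h0 (i, x) x
  have h1' := h1 (i, x) x
  simp only [pow_zero, one_mul] at h0' h1'
  change ‖amp (c i) u x‖ ≤ _ at h0'
  change _ * ‖amp (c i) u x‖ ≤ _ at h1'
  have hx := norm_nonneg x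
  rcases le_total ‖x‖ 1 with hx1 | hx1
  · calc _ ≤ (C * (1 + ‖x‖) ^ K) * (1 + ‖x‖) ^ (n + 1) := by gcongr
      _ ≤ (C * 2 ^ K) * 2 ^ (n + 1) := by gcongr <;> linarith
      _ ≤ (C * 2 ^ K + D) * 2 ^ (K + (n + 1)) := by
          exact mul_le_mul (by linarith) (pow_le_pow_right₀ (by norm_num) (by omega))
            (by positivity) (by positivity)
      _ = _ := mul_comm _ _
  · have h3 : (1 + ‖x‖) ^ K * (‖amp (c i) u x‖ * (1 + ‖x‖) ^ (n + 1))
        ≤ (1 + ‖x‖) ^ K * (2 ^ (K + (n + 1)) * D) := by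
      calc _ = (1 + ‖x‖) ^ (K + (n + 1)) * ‖amp (c i) u x‖ := by rw [pow_add]; ring
        _ ≤ (2 * ‖x‖) ^ (K + (n + 1)) * ‖amp (c i) u x‖ := by gcongr; linarith
        _ = 2 ^ (K + (n + 1)) * (‖x‖ ^ (K + (n + 1)) * ‖amp (c i) u x‖) := by
          rw [mul_pow]; ring
        _ ≤ 2 ^ (K + (n + 1)) * (D * (1 + ‖x‖) ^ K) := by gcongr
        _ = _ := by ring
    refine (le_of_mul_le_mul_left h3 (by positivity)).trans ?_
    gcongr
    have : 0 ≤ C * 2 ^ K := by positivity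
    linarith

lemma integrable_decay : Integrable fun x : En n => (1 + ‖x‖) ^ (-(n + 1 : ℝ)) :=
  integrable_one_add_norm (by simp)

lemma aestronglyMeasurable_amp {c : Ph3 n → ℂ} (hc : Continuous c) (u : SchwartzMap (En n) ℂ) :
    AEStronglyMeasurable (amp c u) := by
  have e : amp c u = fun x => ∫ p : En n × En n,
      (ph x (p.1 - p.2) * c (x, p)) * (u p.1 * (starRingEnd ℂ) (u p.2)) := by
    ext x; rw [amp_eq]; rfl
  rw [e]
  have h1 : Continuous fun z : Ph3 n => ph z.1 (z.2.1 - z.2.2) :=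
    continuous_ph.comp (by fun_prop : Continuous fun z : Ph3 n => (z.1, z.2.1 - z.2.2))
  have h2 : Continuous fun z : Ph3 n => (ph z.1 (z.2.1 - z.2.2) * c z)
      * (u z.2.1 * (starRingEnd ℂ) (u z.2.2)) :=
    (h1.mul hc).mul ((continuous_tensor u u).comp continuous_snd)
  exact (h2.stronglyMeasurable.integral_prod_right' (ν := volume)).aestronglyMeasurable

lemma Temperate.integrable_amp {c : ι → Ph3 n → ℂ} (hc : Temperate c) (i : ι)
    (u : SchwartzMap (En n) ℂ) : Integrable (amp (c i) u) := by
  obtain ⟨C, hC, h⟩ := hc.exists_amp_decay u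
  exact (integrable_decay.const_mul C).mono'
    (aestronglyMeasurable_amp (hc.smooth i).continuous u) (ae_of_all _ (h i))

lemma Temperate.exists_slice_bound {c : ι → Ph3 n → ℂ} (hc : Temperate c) :
    ∃ (C : ℝ) (K : ℕ), 0 ≤ C ∧ ∀ i x p,
      ‖c i (x, p)‖ ≤ C * (1 + ‖x‖) ^ K * (1 + ‖p‖) ^ K := by
  obtain ⟨K, hK⟩ := hc
  obtain ⟨C, hC, h⟩ := hK.exists_bound
  refine ⟨C, K, hC, fun i x p => (h i (x, p)).trans ?_⟩
  rw [mul_assoc, ← mul_pow]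
  gcongr
  exact one_add_norm_pair_le _ _

lemma continuous_slice {c : Ph3 n → ℂ} (hc : Continuous c) (x : En n) :
    Continuous fun p => c (x, p) := hc.comp (by fun_prop)

lemma amp_add {c d : ι → Ph3 n → ℂ} (hc : Temperate c) (hd : Temperate d) (i : ι)
    (u : SchwartzMap (En n) ℂ) (x : En n) :
    amp (fun z => c i z + d i z) u x = amp (c i) u x + amp (d i) u x := by
  obtain ⟨C, K, hC, h⟩ := hc.exists_slice_bound
  obtain ⟨D, K', hD, h'⟩ := hd.exists_slice_bound
  unfold amp pairing
  rw [← integral_add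
    (integrable_pairing (continuous_slice (hc.smooth i).continuous x) (h i x) _ _)
    (integrable_pairing (continuous_slice (hd.smooth i).continuous x) (h' i x) _ _)]
  congr 1
  ext p
  ring

lemma amp_const_mul (z : ℂ) (c : Ph3 n → ℂ) (u : SchwartzMap (En n) ℂ) (x : En n) :
    amp (fun q => z * c q) u x = z * amp c u x := by
  unfold amp pairing
  rw [← integral_const_mul]
  congr 1
  ext p
  ring

lemma form_add {c d : ι → Ph3 n → ℂ} (hc : Temperate c) (hd : Temperate d) (i : ι)
    (u : SchwartzMap (En n) ℂ) :
    form (fun z => c i z + d i z) u = form (c i) u + form (d i) u := by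
  unfold form
  rw [← integral_add (hc.integrable_amp i u) (hd.integrable_amp i u)]
  congr 1
  ext x
  exact amp_add hc hd i u x

lemma form_const_mul (z : ℂ) (c : Ph3 n → ℂ) (u : SchwartzMap (En n) ℂ) :
    form (fun q => z * c q) u = z * form c u := by
  unfold form
  rw [← integral_const_mul]
  congr 1
  ext x
  exact amp_const_mul z c u x

lemma form_zero (u : SchwartzMap (En n) ℂ) : form (fun _ => 0) u = 0 := by
  simpa using form_const_mul (n := n) 0 (fun _ => 0) u

lemma form_sum {J : Type*} (s : Finset J) {c : J → ι → Ph3 n → ℂ}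
    (h : ∀ j ∈ s, Temperate (c j)) (i : ι) (u : SchwartzMap (En n) ℂ) :
    form (fun z => ∑ j ∈ s, c j i z) u = ∑ j ∈ s, form (c j i) u := by
  classical
  induction s using Finset.induction_on with
  | empty => simpa using form_zero u
  | insert a s ha ih =>
    simp only [Finset.sum_insert ha]
    have hs : ∀ j ∈ s, Temperate (c j) := fun j hj => h j (by simp [hj])
    rw [form_add (h a (by simp)) (Temperate.sum s hs) i u, ih hs]

end Form

section FormCalculus

variable {n : ℕ} {ι κ : Type*}

/-- The coordinate directions in the position variable of an amplitude. -/
def dirU (j : Fin n) : Ph3 n := (EuclideanSpace.single j 1, 0)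

/-- The map `(x, ξ, η) ↦ ξ - η`. -/
def diffCLM : Ph3 n →L[ℝ] En n :=
  (ContinuousLinearMap.fst ℝ (En n) (En n) - ContinuousLinearMap.snd ℝ (En n) (En n)).comp
    (ContinuousLinearMap.snd ℝ (En n) (En n × En n))

@[simp] lemma diffCLM_apply (z : Ph3 n) : diffCLM z = z.2.1 - z.2.2 := rfl

/-- The functions `(x, ξ, η) ↦ ξ_j - η_j`. -/
def diffCoord (j : Fin n) : Ph3 n →L[ℝ] ℂ :=
  Complex.ofRealCLM.comp ((EuclideanSpace.proj j : En n →L[ℝ] ℝ).comp diffCLM)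

@[simp] lemma diffCoord_apply (j : Fin n) (z : Ph3 n) :
    diffCoord j z = (((z.2.1 - z.2.2) j : ℝ) : ℂ) := rfl

lemma dirDeriv_diffCoord_mul (j k : Fin n) {c : Ph3 n → ℂ} (hc : ContDiff ℝ (⊤ : ℕ∞) c) :
    dirDeriv (dirU k) (fun z => diffCoord j z * c z)
      = fun z => diffCoord j z * dirDeriv (dirU k) c z := by
  rw [dirDeriv_mul (diffCoord j).contDiff hc]
  ext z
  have : dirDeriv (dirU k) (fun z => diffCoord j z) z = 0 := by
    change fderiv ℝ (diffCoord j) z (dirU k) = 0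
    rw [ContinuousLinearMap.fderiv]
    simp [dirU]
  rw [this, zero_mul, zero_add]

lemma norm_ph_mul (x t : En n) (a : ℂ) : ‖ph x t * a‖ = ‖a‖ := by
  rw [norm_mul, norm_ph, one_mul]

lemma continuous_ph_mul {c : Ph3 n → ℂ} (hc : Continuous c) (x : En n) :
    Continuous fun p : En n × En n => ph x (p.1 - p.2) * c (x, p) :=
  (continuous_ph.comp (by fun_prop : Continuous fun p : En n × En n => (x, p.1 - p.2))).mul
    (continuous_slice hc x)

lemma hasLineDerivAt_amp {c : Ph3 n → ℂ} (hc : Temperate (fun _ : Unit => c)) (j : Fin n)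
    (u : SchwartzMap (En n) ℂ) (x : En n) :
    HasLineDerivAt ℝ (amp c u)
      (amp (fun z => Complex.I * (diffCoord j z * c z) + dirDeriv (dirU j) c z) u x) x
      (EuclideanSpace.single j 1) := by
  have hc' : Temperate (fun (_ : Unit) z =>
      Complex.I * (diffCoord j z * c z) + dirDeriv (dirU j) c z) :=
    (((Temperate.clm (diffCoord j)).mul hc).const_mul _).add (hc.dirDeriv (dirU j))
  obtain ⟨C₀, K₀, hC₀, h₀⟩ := hc.exists_slice_bound
  obtain ⟨C, K, hC, h⟩ := hc'.exists_slice_bound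
  have sc : ContDiff ℝ (⊤ : ℕ∞) c := hc.smooth ()
  set v : En n := EuclideanSpace.single j 1 with hv
  have hv1 : ‖v‖ = 1 := by simp [hv]
  have key := hasDerivAt_pairing (t₀ := 0) (C := C * (2 + ‖x‖) ^ K) (K := K)
    (C₀ := C₀ * (1 + ‖x‖) ^ K₀) (K₀ := K₀)
    (A := fun t p => ph (x + t • v) (p.1 - p.2) * c (x + t • v, p))
    (A' := fun t p => ph (x + t • v) (p.1 - p.2) * (Complex.I * (diffCoord j (x + t • v, p)
      * c (x + t • v, p)) + dirDeriv (dirU j) c (x + t • v, p)))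
    (fun t => continuous_ph_mul sc.continuous _)
    (continuous_ph_mul (hc'.smooth ()).continuous _) ?_ ?_ ?_ u u
  · unfold HasLineDerivAt
    have e : (fun t : ℝ => amp c u (x + t • v)) = fun t =>
        pairing (fun p => ph (x + t • v) (p.1 - p.2) * c (x + t • v, p)) u u := by
      ext t; exact amp_eq c u _
    rw [e, amp_eq]
    simpa using key
  · intro t _ p
    have h1 : HasDerivAt (fun s : ℝ => c (x + s • v, p))
        (dirDeriv (dirU j) c (x + t • v, p)) t := by
      have h2 := (sc.differentiable (by simp) (x + t • v, p)).hasFDerivAt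
      have h3 : HasDerivAt (fun s : ℝ => ((x + s • v, p) : Ph3 n)) (dirU j) t := by
        have : HasDerivAt (fun s : ℝ => x + s • v) v t := by
          simpa using ((hasDerivAt_id t).smul_const v).const_add x
        exact this.prodMk (hasDerivAt_const t p)
      exact h2.comp_hasDerivAt t h3
    have h4 := (hasDerivAt_ph x (p.1 - p.2) v t).mul h1
    refine h4.congr_deriv ?_
    simp [hv, EuclideanSpace.inner_single_left]
    ring
  · intro p
    rw [norm_ph_mul]
    simpa using h₀ () x p
  · intro t ht p
    rw [norm_ph_mul]
    refine (h () (x + t • v) p).trans ?_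
    have h5 : ‖t • v‖ ≤ 1 := by
      rw [norm_smul, hv1, mul_one]
      simpa using (Metric.mem_ball.1 ht).le
    have h6 : 1 + ‖x + t • v‖ ≤ 2 + ‖x‖ := by linarith [norm_add_le x (t • v)]
    exact mul_le_mul_of_nonneg_right (mul_le_mul_of_nonneg_left
      (pow_le_pow_left₀ (by positivity) h6 K) hC) (by positivity)

/-- Integration by parts: multiplication by `ξ - η` becomes differentiation in `x`. -/
lemma form_diffCoord_mul {c : ι → Ph3 n → ℂ} (hc : Temperate c) (j : Fin n) (i : ι)
    (u : SchwartzMap (En n) ℂ) :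
    form (fun z => diffCoord j z * c i z) u = Complex.I * form (dirDeriv (dirU j) (c i)) u := by
  have h1 : Temperate (fun (i : ι) z => Complex.I * (diffCoord j z * c i z)) :=
    ((Temperate.clm (diffCoord j)).mul hc).const_mul _
  have h2 := hc.dirDeriv (dirU j)
  have h0 : ∫ x, amp (fun z => Complex.I * (diffCoord j z * c i z)
      + dirDeriv (dirU j) (c i) z) u x = 0 := by
    have := integral_bilinear_hasLineDerivAt_right_eq_neg_left_of_integrable (μ := volume)
      (B := ContinuousLinearMap.mul ℝ ℂ) (f := fun _ : En n => (1 : ℂ)) (f' := fun _ => 0)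
      (g := amp (c i) u) (g' := amp (fun z => Complex.I * (diffCoord j z * c i z)
        + dirDeriv (dirU j) (c i) z) u) (v := EuclideanSpace.single j 1) (by simp)
      (by simpa using (h1.add h2).integrable_amp i u) (by simpa using hc.integrable_amp i u)
      (fun x _ => by simpa [HasLineDerivAt] using hasDerivAt_const (0 : ℝ) (1 : ℂ))
      (fun x _ => hasLineDerivAt_amp (hc.reindex (fun _ : Unit => i)) j u x)
    simpa using this
  have e := form_add h1 h2 i u
  rw [form_const_mul] at e
  have h3 : form (fun z => Complex.I * (diffCoord j z * c i z) + dirDeriv (dirU j) (c i) z) u = 0 :=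
    h0
  rw [h3] at e
  have hI : Complex.I * Complex.I = -1 := Complex.I_mul_I
  linear_combination Complex.I * e + (form (fun z => diffCoord j z * c i z) u) * hI

/-- Differentiation of the form with respect to a parameter of the amplitude. -/
lemma hasDerivAt_form {c c' : ℝ → Ph3 n → ℂ} (hc : Temperate c) (hc' : Temperate c')
    (hd : ∀ t z, HasDerivAt (fun s => c s z) (c' t z) t) (u : SchwartzMap (En n) ℂ) (t : ℝ) :
    HasDerivAt (fun s => form (c s) u) (form (c' t) u) t := by
  obtain ⟨C₀, K₀, hC₀, h₀⟩ := hc.exists_slice_bound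
  obtain ⟨C, K, hC, h⟩ := hc'.exists_slice_bound
  obtain ⟨D, hD, hb⟩ := hc'.exists_amp_decay u
  refine (hasDerivAt_integral_of_dominated_loc_of_deriv_le (F := fun s x => amp (c s) u x)
    (F' := fun s x => amp (c' s) u x) (bound := fun x => D * (1 + ‖x‖) ^ (-(n + 1 : ℝ)))
    (Metric.ball_mem_nhds t one_pos) ?_ (hc.integrable_amp t u) ?_ ?_ ?_ ?_).2
  · exact Eventually.of_forall fun s => aestronglyMeasurable_amp (hc.smooth s).continuous u
  · exact aestronglyMeasurable_amp (hc'.smooth t).continuous u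
  · exact ae_of_all _ fun x s _ => hb s x
  · exact integrable_decay.const_mul D
  · refine ae_of_all _ fun x s _ => ?_
    exact hasDerivAt_pairing (A := fun s p => c s (x, p)) (A' := fun s p => c' s (x, p))
      (fun s => continuous_slice (hc.smooth s).continuous x)
      (continuous_slice (hc'.smooth s).continuous x) (fun r _ p => hd r (x, p))
      (fun p => h₀ s x p) (fun r _ p => h r x p) _ _

end FormCalculus

/-! ### Reduction to amplitudes decaying off the diagonal -/

section Lowering

variable {n : ℕ} {ι κ : Type*}

lemma symbolBound_jb : SymbolBound (fun (_ : ι) (t : En n) => jb t) (fun _ => jb) := by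
  refine SymbolBound.of_fderiv (fun _ => ?_) ⟨1, zero_le_one, fun _ t => ?_⟩ ?_
  · unfold jb
    exact contDiff_const.add (contDiff_norm_sq ℝ)
  · rw [one_mul, norm_of_nonneg (jb_pos t).le]
  · have e : ∀ t : En n, fderiv ℝ jb t = ((2 : ℝ) • innerSL ℝ : En n →L[ℝ] En n →L[ℝ] ℝ) t := by
      intro t
      unfold jb
      rw [fderiv_const_add, fderiv_norm_sq]
      ext v
      simp
    refine ((SymbolBound.clm ((2 : ℝ) • innerSL ℝ : En n →L[ℝ] En n →L[ℝ] ℝ)).mono 2 (by norm_num)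
      fun i t => ?_).congr_fun fun i t => (e t).symm
    linarith [one_le_jb t, norm_le_jb t]

lemma symbolBound_jb_diff (r : ℝ) :
    SymbolBound (fun (_ : ι) (z : Ph3 n) => jb (diffCLM z) ^ r)
      (fun _ z => jb (diffCLM z) ^ r) :=
  ((symbolBound_jb.comp_clm (fun _ => diffCLM) _ (fun _ => le_rfl)).rpow
    (fun _ _ => jb_pos _) one_pos (fun _ _ => (one_mul _).le) r)

/-- Weights on amplitudes which are moderate in `x` and powers of `1 + |ξ - η|²`. -/
lemma temperate_of_weight {lam : En n → ℝ} (hl : ∀ x, 0 < lam x) {A : ℝ} {K : ℕ}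
    (hA : ∀ x, lam x ≤ A * (1 + ‖x‖) ^ K) {c : ι → Ph3 n → ℂ} {r : ℝ}
    (hc : SymbolBound c (fun _ z => lam z.1 * jb (diffCLM z) ^ r)) : Temperate c := by
  have hA0 : 0 < A := by
    have := (hl 0).trans_le (hA 0)
    simpa using this
  refine Temperate.of_le hc (A := A * 4 ^ ⌈|r|⌉₊) (by positivity) (K := K + 2 * ⌈|r|⌉₊)
    fun _ z => ?_
  have h1 : ‖z.1‖ ≤ ‖z‖ := norm_fst_le z
  have h2 : jb (diffCLM z) ≤ 4 * (1 + ‖z‖) ^ 2 := by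
    have h3 : ‖z.2.1 - z.2.2‖ ≤ 2 * ‖z‖ := by
      have := norm_sub_le z.2.1 z.2.2
      have := (norm_fst_le z.2).trans (norm_snd_le z)
      have := (norm_snd_le z.2).trans (norm_snd_le z)
      linarith
    have := norm_nonneg z
    have := norm_nonneg (z.2.1 - z.2.2)
    rw [jb, diffCLM_apply]
    nlinarith
  have h4 : jb (diffCLM z) ^ r ≤ (4 * (1 + ‖z‖) ^ 2) ^ ⌈|r|⌉₊ := by
    calc _ ≤ jb (diffCLM z) ^ ((⌈|r|⌉₊ : ℕ) : ℝ) :=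
          Real.rpow_le_rpow_of_exponent_le (one_le_jb _) ((le_abs_self r).trans (Nat.le_ceil _))
      _ = jb (diffCLM z) ^ ⌈|r|⌉₊ := Real.rpow_natCast _ _
      _ ≤ _ := pow_le_pow_left₀ (jb_pos _).le h2 _
  calc _ ≤ (A * (1 + ‖z‖) ^ K) * (4 * (1 + ‖z‖) ^ 2) ^ ⌈|r|⌉₊ := by
        refine mul_le_mul ((hA _).trans ?_) h4 (Real.rpow_nonneg (jb_pos _).le _) (by positivity)
        gcongr
    _ = _ := by rw [mul_pow, ← pow_mul, pow_add]; ring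

lemma jb_eq_sum (t : En n) : jb t = 1 + ∑ j, t j ^ 2 := by
  rw [jb, EuclideanSpace.norm_sq_eq]
  simp

lemma exists_lower_one {lam : En n → ℝ} (hl : ∀ x, 0 < lam x) {A : ℝ} {K : ℕ}
    (hA : ∀ x, lam x ≤ A * (1 + ‖x‖) ^ K) {c : ι → Ph3 n → ℂ} {r : ℝ}
    (hc : SymbolBound c (fun _ z => lam z.1 * jb (diffCLM z) ^ r)) :
    ∃ c' : ι → Ph3 n → ℂ, SymbolBound c' (fun _ z => lam z.1 * jb (diffCLM z) ^ (r - 1)) ∧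
      ∀ i u, form (c i) u = form (c' i) u := by
  set d : ι → Ph3 n → ℂ := fun i z => (jb (diffCLM z) ^ (-1 : ℝ)) • c i z with hd
  have sd : SymbolBound d (fun _ z => lam z.1 * jb (diffCLM z) ^ (r - 1)) :=
    ((symbolBound_jb_diff (-1)).smul hc).congr_weight fun _ z => by
      rw [sub_eq_add_neg, Real.rpow_add (jb_pos _)]
      ring
  have hw : ∀ (_ : ι) (z : Ph3 n), 0 ≤ lam z.1 * jb (diffCLM z) ^ (r - 1) := fun _ z =>
    mul_nonneg (hl _).le (Real.rpow_nonneg (jb_pos _).le _)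
  have td : Temperate d := temperate_of_weight hl hA sd
  have t1 : ∀ j, Temperate (fun i z => diffCoord j z * d i z) := fun j => (Temperate.clm _).mul td
  have t2 : ∀ j, Temperate (fun i z => diffCoord j z * (diffCoord j z * d i z)) := fun j =>
    (Temperate.clm _).mul (t1 j)
  have t3 : ∀ j, Temperate (fun i => dirDeriv (dirU j) (dirDeriv (dirU j) (d i))) := fun j =>
    (td.dirDeriv _).dirDeriv _
  have t4 : ∀ j, Temperate (fun i z => (-1) * dirDeriv (dirU j) (dirDeriv (dirU j) (d i)) z) :=
    fun j => (t3 j).const_mul _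
  refine ⟨fun i z => d i z + ∑ j, (-1) * dirDeriv (dirU j) (dirDeriv (dirU j) (d i)) z,
    sd.add (SymbolBound.sum _ fun j _ =>
      ((sd.fderiv_apply (dirU j)).fderiv_apply (dirU j)).const_mul (-1)), fun i u => ?_⟩
  have e : c i = fun z => d i z + ∑ j, diffCoord j z * (diffCoord j z * d i z) := by
    ext z
    have h1 : (jb (diffCLM z) : ℂ) * d i z = c i z := by
      rw [hd]
      simp only [Real.rpow_neg_one, Complex.real_smul, Complex.ofReal_inv]
      rw [← mul_assoc, mul_inv_cancel₀, one_mul]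
      exact_mod_cast (jb_pos _).ne'
    rw [← h1, jb_eq_sum]
    push_cast
    rw [add_mul, one_mul, Finset.sum_mul]
    congr 1
    refine Finset.sum_congr rfl fun j _ => ?_
    rw [diffCoord_apply, diffCLM_apply]
    ring
  have hj : ∀ j, form (fun z => diffCoord j z * (diffCoord j z * d i z)) u
      = form (fun z => (-1) * dirDeriv (dirU j) (dirDeriv (dirU j) (d i)) z) u := by
    intro j
    rw [form_diffCoord_mul (t1 j) j i u, dirDeriv_diffCoord_mul j j (td.smooth i),
      form_diffCoord_mul (td.dirDeriv (dirU j)) j i u, form_const_mul, ← mul_assoc,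
      Complex.I_mul_I]
  rw [e, form_add td (Temperate.sum _ fun j _ => t2 j) i u,
    form_add td (Temperate.sum _ fun j _ => t4 j) i u,
    form_sum _ (fun j _ => t2 j) i u, form_sum _ (fun j _ => t4 j) i u,
    Finset.sum_congr rfl fun j _ => hj j]

lemma exists_lower {lam : En n → ℝ} (hl : ∀ x, 0 < lam x) {A : ℝ} {K : ℕ}
    (hA : ∀ x, lam x ≤ A * (1 + ‖x‖) ^ K) (M : ℕ) {c : ι → Ph3 n → ℂ} {r : ℝ}
    (hc : SymbolBound c (fun _ z => lam z.1 * jb (diffCLM z) ^ r)) :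
    ∃ c' : ι → Ph3 n → ℂ, SymbolBound c' (fun _ z => lam z.1 * jb (diffCLM z) ^ (r - M)) ∧
      ∀ i u, form (c i) u = form (c' i) u := by
  induction M with
  | zero => exact ⟨c, by simpa using hc, fun _ _ => rfl⟩
  | succ M ih =>
    obtain ⟨c', h1, h2⟩ := ih
    obtain ⟨c'', h3, h4⟩ := exists_lower_one hl hA h1
    refine ⟨c'', by simpa [sub_sub] using h3, fun i u => (h2 i u).trans (h4 i u)⟩

end Lowering

/-! ### Regularization of Schwartz functions -/

section Resolvent

variable {n : ℕ} {κ : Type*}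

open FourierTransform

/-- The Fourier multiplier with symbol `(1 + |t|²)⁻¹`. -/
def resolvent (f : SchwartzMap (En n) ℂ) : SchwartzMap (En n) ℂ :=
  SchwartzMap.fourierMultiplierCLM ℂ (fun t : En n => (1 + ‖t‖ ^ 2) ^ (-1 : ℝ)) f

lemma fourier_resolvent (f : SchwartzMap (En n) ℂ) (t : En n) :
    𝓕 (resolvent f) t = ((jb t)⁻¹ : ℝ) * 𝓕 f t := by
  rw [resolvent, SchwartzMap.fourierMultiplierCLM_apply, FourierTransform.fourier_fourierInv_eq,
    SchwartzMap.smulLeftCLM_apply_apply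
      (Function.hasTemperateGrowth_one_add_norm_sq_rpow (En n) (-1)), Real.rpow_neg_one]
  simp [jb]

lemma fourier_iterate_resolvent (N : ℕ) (f : SchwartzMap (En n) ℂ) (t : En n) :
    𝓕 (resolvent^[N] f) t = (((jb t)⁻¹ ^ N : ℝ) : ℂ) * 𝓕 f t := by
  induction N with
  | zero => simp
  | succ N ih =>
    rw [Function.iterate_succ_apply', fourier_resolvent, ih, pow_succ]
    push_cast
    ring

open LineDeriv Laplacian in
lemma resolvent_eq (f : SchwartzMap (En n) ℂ) :
    f = resolvent f
      + ∑ j, (-((2 * π) ^ 2)⁻¹ : ℝ) • sDeriv j (sDeriv j (resolvent f)) := by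
  have h1 : ∑ j, sDeriv j (sDeriv j (resolvent f)) = Δ (resolvent f) := by
    rw [SchwartzMap.laplacian_eq_sum (EuclideanSpace.basisFun (Fin n) ℝ)]
    simp [sDeriv]
  have h2 : f = resolvent f
      + SchwartzMap.fourierMultiplierCLM ℂ (fun t : En n => ‖t‖ ^ 2) (resolvent f) := by
    have h3 : 𝓕 f = 𝓕 (resolvent f)
        + 𝓕 (SchwartzMap.fourierMultiplierCLM ℂ (fun t : En n => ‖t‖ ^ 2) (resolvent f)) := by
      ext t
      rw [add_apply, SchwartzMap.fourierMultiplierCLM_apply,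
        FourierTransform.fourier_fourierInv_eq,
        SchwartzMap.smulLeftCLM_apply_apply (by fun_prop), fourier_resolvent, Complex.real_smul]
      have h4 : ((jb t : ℝ) : ℂ) ≠ 0 := by exact_mod_cast (jb_pos t).ne'
      have h5 : ((jb t : ℝ) : ℂ) = 1 + ((‖t‖ ^ 2 : ℝ) : ℂ) := by rw [jb]; push_cast; ring
      rw [← mul_assoc, ← add_mul, Complex.ofReal_inv]
      have h6 : ((jb t : ℝ) : ℂ)⁻¹ + ((‖t‖ ^ 2 : ℝ) : ℂ) * ((jb t : ℝ) : ℂ)⁻¹ = 1 := by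
        rw [← one_add_mul, ← h5, mul_inv_cancel₀ h4]
      rw [h6, one_mul]
    rw [← FourierTransform.fourier_add] at h3
    simpa using congrArg (𝓕⁻ ·) h3
  rw [← Finset.smul_sum, h1, SchwartzMap.laplacian_eq_fourierMultiplierCLM, smul_smul]
  have h7 : (-((2 * π) ^ 2)⁻¹ * -(2 * π) ^ 2 : ℝ) = 1 := by
    have := Real.pi_pos
    field_simp
  rw [h7, one_smul]
  exact h2

end Resolvent

/-! ### Boundedness of the form -/

section Regularization

variable {n : ℕ} {κ : Type*}

lemma pairing_add_sum_left {a : En n × En n → ℂ} (ha : Continuous a) {C : ℝ} {K : ℕ}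
    (hb : ∀ p, ‖a p‖ ≤ C * (1 + ‖p‖) ^ K) (r : ℝ) (u v : SchwartzMap (En n) ℂ)
    (w : Fin n → SchwartzMap (En n) ℂ) :
    pairing a (u + ∑ j, r • w j) v = pairing a u v + ∑ j, r * pairing a (w j) v := by
  unfold pairing
  simp_rw [← integral_const_mul]
  rw [← integral_finsetSum _ fun j _ => (integrable_pairing ha hb (w j) v).const_mul _,
    ← integral_add (integrable_pairing ha hb u v)
      (integrable_finsetSum _ fun j _ => (integrable_pairing ha hb (w j) v).const_mul _)]
  congr 1
  ext p
  simp only [add_apply, sum_apply, smul_apply, Complex.real_smul,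
    add_mul, mul_add, Finset.sum_mul, Finset.mul_sum]
  congr 1
  exact Finset.sum_congr rfl fun j _ => by ring

lemma pairing_add_sum_right {a : En n × En n → ℂ} (ha : Continuous a) {C : ℝ} {K : ℕ}
    (hb : ∀ p, ‖a p‖ ≤ C * (1 + ‖p‖) ^ K) (r : ℝ) (u v : SchwartzMap (En n) ℂ)
    (w : Fin n → SchwartzMap (En n) ℂ) :
    pairing a u (v + ∑ j, r • w j) = pairing a u v + ∑ j, r * pairing a u (w j) := by
  unfold pairing
  simp_rw [← integral_const_mul]
  rw [← integral_finsetSum _ fun j _ => (integrable_pairing ha hb u (w j)).const_mul _,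
    ← integral_add (integrable_pairing ha hb u v)
      (integrable_finsetSum _ fun j _ => (integrable_pairing ha hb u (w j)).const_mul _)]
  congr 1
  ext p
  simp only [add_apply, sum_apply, smul_apply, Complex.real_smul,
    mul_add, Finset.mul_sum, map_add, map_sum, map_mul, Complex.conj_ofReal]
  congr 1
  exact Finset.sum_congr rfl fun j _ => by ring

lemma pairing_add_sum_amp {a : En n × En n → ℂ} {b : Fin n → En n × En n → ℂ} (ha : Continuous a)
    (hb : ∀ j, Continuous (b j)) {A : ℝ} {B : Fin n → ℝ} {K : ℕ}
    (hA : ∀ p, ‖a p‖ ≤ A * (1 + ‖p‖) ^ K)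
    (hB : ∀ j p, ‖b j p‖ ≤ B j * (1 + ‖p‖) ^ K) (r : ℝ) (u v : SchwartzMap (En n) ℂ) :
    pairing (fun p => a p + ∑ j, (r : ℂ) * b j p) u v
      = pairing a u v + ∑ j, r * pairing (b j) u v := by
  unfold pairing
  simp_rw [← integral_const_mul]
  rw [← integral_finsetSum _ fun j _ => (integrable_pairing (hb j) (hB j) u v).const_mul _,
    ← integral_add (integrable_pairing ha hA u v)
      (integrable_finsetSum _ fun j _ => (integrable_pairing (hb j) (hB j) u v).const_mul _)]
  congr 1
  ext p
  simp only [add_mul, Finset.sum_mul]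
  congr 1
  exact Finset.sum_congr rfl fun j _ => by ring

lemma exists_pairing_transfer (dir : Fin n → En n × En n) (r : ℝ)
    {a : κ → En n × En n → ℂ} {w : κ → En n × En n → ℝ} {B : κ → ℝ}
    (hB : ∀ k p, w k p ≤ B k) (ha : SymbolBound a w) :
    ∃ a' : κ → En n × En n → ℂ, SymbolBound a' w ∧ ∀ k u v,
      pairing (a' k) u v = pairing (a k) u v
        + ∑ j, r * pairing (dirDeriv (dir j) (dirDeriv (dir j) (a k))) u v := by
  have h2 : ∀ j, SymbolBound (fun k => dirDeriv (dir j) (dirDeriv (dir j) (a k))) w := fun j =>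
    (ha.fderiv_apply (dir j)).fderiv_apply (dir j)
  refine ⟨fun k p => a k p + ∑ j, (r : ℂ) * dirDeriv (dir j) (dirDeriv (dir j) (a k)) p,
    ha.add (SymbolBound.sum _ fun j _ => (h2 j).const_mul _), fun k u v => ?_⟩
  obtain ⟨A, hA, hA'⟩ := ha.exists_bound
  choose D hD hD' using fun j => (h2 j).exists_bound
  refine pairing_add_sum_amp (ha.1 k).continuous (fun j => ((h2 j).1 k).continuous) (K := 0)
    (A := A * B k) (B := fun j => D j * B k) (fun p => (hA' k p).trans ?_)
    (fun j p => (hD' j k p).trans ?_) r u v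
  · rw [pow_zero, mul_one]
    exact mul_le_mul_of_nonneg_left (hB k p) hA
  · rw [pow_zero, mul_one]
    exact mul_le_mul_of_nonneg_left (hB k p) (hD j)

lemma exists_pairing_resolvent {a : κ → En n × En n → ℂ} {w : κ → En n × En n → ℝ} {B : κ → ℝ}
    (hB0 : ∀ k, 0 ≤ B k) (hB : ∀ k p, w k p ≤ B k) (ha : SymbolBound a w) :
    ∃ a' : κ → En n × En n → ℂ, SymbolBound a' w ∧ ∀ k f g,
      pairing (a k) f g = pairing (a' k) (resolvent f) (resolvent g) := by
  have temper : ∀ {b : κ → En n × En n → ℂ}, SymbolBound b w → ∀ k,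
      SymbolBound (fun _ : Unit => b k) (fun _ p => (1 + ‖p‖) ^ 0) := fun hb k =>
    (hb.reindex (fun _ : Unit => k)).mono (B k) (hB0 k) fun _ p => by simpa using hB k p
  have bd : ∀ {b : κ → En n × En n → ℂ}, SymbolBound b w → ∀ k, ∃ C : ℝ,
      ∀ p, ‖b k p‖ ≤ C * (1 + ‖p‖) ^ 0 := fun hb k =>
    let ⟨C, _, h⟩ := (temper hb k).exists_bound
    ⟨C, fun p => h () p⟩
  obtain ⟨a₁, h₁, e₁⟩ := exists_pairing_transfer dirX (-((2 * π) ^ 2)⁻¹) hB ha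
  obtain ⟨a₂, h₂, e₂⟩ := exists_pairing_transfer dirXi (-((2 * π) ^ 2)⁻¹) hB h₁
  refine ⟨a₂, h₂, fun k f g => ?_⟩
  obtain ⟨C, hC⟩ := bd ha k
  obtain ⟨D, hD⟩ := bd h₁ k
  have left : pairing (a k) f g = pairing (a₁ k) (resolvent f) g := by
    conv_lhs => rw [resolvent_eq f]
    rw [pairing_add_sum_left (ha.1 k).continuous hC, e₁]
    congr 1
    refine Finset.sum_congr rfl fun j _ => ?_
    have hd : SymbolBound (fun k => dirDeriv (dirX j) (a k)) w := ha.fderiv_apply (dirX j)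
    rw [pairing_sDeriv_left (temper ha k), pairing_sDeriv_left (temper hd k), neg_neg]
  have right : pairing (a₁ k) (resolvent f) g
      = pairing (a₂ k) (resolvent f) (resolvent g) := by
    conv_lhs => rw [resolvent_eq g]
    rw [pairing_add_sum_right (h₁.1 k).continuous hD, e₂]
    congr 1
    refine Finset.sum_congr rfl fun j _ => ?_
    have hd : SymbolBound (fun k => dirDeriv (dirXi j) (a₁ k)) w := h₁.fderiv_apply (dirXi j)
    rw [pairing_sDeriv_right (temper h₁ k), pairing_sDeriv_right (temper hd k), neg_neg]
  rw [left, right]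

lemma exists_pairing_iterate_resolvent (N : ℕ) {a : κ → En n × En n → ℂ}
    {w : κ → En n × En n → ℝ} {B : κ → ℝ}
    (hB0 : ∀ k, 0 ≤ B k) (hB : ∀ k p, w k p ≤ B k) (ha : SymbolBound a w) :
    ∃ a' : κ → En n × En n → ℂ, SymbolBound a' w ∧ ∀ k f g,
      pairing (a k) f g = pairing (a' k) (resolvent^[N] f) (resolvent^[N] g) := by
  induction N with
  | zero => exact ⟨a, ha, fun _ _ _ => rfl⟩
  | succ N ih =>
    obtain ⟨a₁, h₁, e₁⟩ := ih
    obtain ⟨a₂, h₂, e₂⟩ := exists_pairing_resolvent hB0 hB h₁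
    refine ⟨a₂, h₂, fun k f g => ?_⟩
    rw [e₁, e₂, Function.iterate_succ_apply', Function.iterate_succ_apply']

end Regularization

section Schur

variable {n : ℕ}

/-- The integrable kernel `(1 + |t|²)^{-(n+1)}`. -/
def decay (t : En n) : ℝ := (jb t)⁻¹ ^ (n + 1)

lemma decay_nonneg (t : En n) : 0 ≤ decay t :=
  pow_nonneg (inv_nonneg.2 (jb_pos t).le) _

lemma continuous_jb : Continuous (jb : En n → ℝ) := by unfold jb; fun_prop

lemma continuous_decay : Continuous (decay : En n → ℝ) :=
  (continuous_jb.inv₀ fun t => (jb_pos t).ne').pow _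

lemma lintegral_decay_ne_top : ∫⁻ t : En n, ENNReal.ofReal (decay t) ≠ ⊤ := by
  have h : Integrable (fun t : En n => (1 + ‖t‖ ^ 2) ^ (-(2 * (n + 1) : ℝ) / 2)) :=
    integrable_rpow_neg_one_add_norm_sq (by rw [finrank_euclideanSpace_fin]; linarith)
  have e : (fun t : En n => (1 + ‖t‖ ^ 2) ^ (-(2 * (n + 1) : ℝ) / 2)) = decay := by
    ext t
    have h1 : (-(2 * (n + 1) : ℝ) / 2) = -((n + 1 : ℕ) : ℝ) := by push_cast; ring
    rw [decay, jb, h1, Real.rpow_neg (by positivity), Real.rpow_natCast, inv_pow]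
  rw [e] at h
  exact h.lintegral_lt_top.ne

lemma mul_le_sq_add_sq (x y : ℝ≥0∞) : x * y ≤ x ^ 2 + y ^ 2 := by
  rcases le_total x y with h | h
  · calc x * y ≤ y * y := by gcongr
      _ = y ^ 2 := (sq y).symm
      _ ≤ _ := le_add_self
  · calc x * y ≤ x * x := by gcongr
      _ = x ^ 2 := (sq x).symm
      _ ≤ _ := le_self_add

/-- Schur's test for kernels bounded by a convolution kernel. -/
lemma enorm_pairing_le {a : En n × En n → ℂ} {B : ℝ} (hB : 0 ≤ B)
    (ha : ∀ p, ‖a p‖ ≤ B * decay (p.1 - p.2)) (f : SchwartzMap (En n) ℂ) :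
    ‖pairing a f f‖ₑ ≤ 2 * ENNReal.ofReal B * (∫⁻ t : En n, ENNReal.ofReal (decay t))
      * ∫⁻ t, ‖f t‖ₑ ^ 2 := by
  set I := ∫⁻ t : En n, ENNReal.ofReal (decay t) with hI
  have mJ : Measurable fun t : En n => ENNReal.ofReal (decay t) :=
    continuous_decay.measurable.ennreal_ofReal
  have mf : Measurable fun t => ‖f t‖ₑ ^ 2 := f.continuous.measurable.enorm.pow_const 2
  have m1 : Measurable fun p : En n × En n => ENNReal.ofReal (decay (p.1 - p.2)) :=
    mJ.comp (measurable_fst.sub measurable_snd)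
  have m2 : Measurable fun p : En n × En n => ENNReal.ofReal (decay (p.1 - p.2)) * ‖f p.1‖ₑ ^ 2 :=
    m1.mul (mf.comp measurable_fst)
  have m3 : Measurable fun p : En n × En n => ENNReal.ofReal (decay (p.1 - p.2)) * ‖f p.2‖ₑ ^ 2 :=
    m1.mul (mf.comp measurable_snd)
  have e1 : ∫⁻ p : En n × En n, ENNReal.ofReal (decay (p.1 - p.2)) * ‖f p.1‖ₑ ^ 2
      = I * ∫⁻ t, ‖f t‖ₑ ^ 2 := by
    rw [Measure.volume_eq_prod, lintegral_prod _ m2.aemeasurable, ← lintegral_const_mul _ mf]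
    congr 1
    ext t
    dsimp only
    rw [lintegral_mul_const' (‖f t‖ₑ ^ 2) _ (by simp), lintegral_sub_left_eq_self
      (fun t => ENNReal.ofReal (decay t)) t]
  have e2 : ∫⁻ p : En n × En n, ENNReal.ofReal (decay (p.1 - p.2)) * ‖f p.2‖ₑ ^ 2
      = I * ∫⁻ t, ‖f t‖ₑ ^ 2 := by
    rw [Measure.volume_eq_prod, lintegral_prod_symm _ m3.aemeasurable, ← lintegral_const_mul _ mf]
    congr 1
    ext t
    dsimp only
    rw [lintegral_mul_const' (‖f t‖ₑ ^ 2) _ (by simp), lintegral_sub_right_eq_self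
      (fun t => ENNReal.ofReal (decay t)) t]
  calc ‖pairing a f f‖ₑ ≤ ∫⁻ p : En n × En n, ‖a p * (f p.1 * (starRingEnd ℂ) (f p.2))‖ₑ :=
        enorm_integral_le_lintegral_enorm _
    _ ≤ ∫⁻ p : En n × En n, ENNReal.ofReal B * (ENNReal.ofReal (decay (p.1 - p.2)) * ‖f p.1‖ₑ ^ 2
          + ENNReal.ofReal (decay (p.1 - p.2)) * ‖f p.2‖ₑ ^ 2) := by
        refine lintegral_mono fun p => ?_
        rw [enorm_mul, enorm_mul, RCLike.enorm_conj, ← mul_add, ← mul_assoc (ENNReal.ofReal B),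
          ← ENNReal.ofReal_mul hB]
        gcongr
        · rw [← ofReal_norm]
          exact ENNReal.ofReal_le_ofReal (ha p)
        · exact mul_le_sq_add_sq _ _
    _ = ENNReal.ofReal B * (I * (∫⁻ t, ‖f t‖ₑ ^ 2) + I * ∫⁻ t, ‖f t‖ₑ ^ 2) := by
        rw [lintegral_const_mul' _ _ ENNReal.ofReal_ne_top, lintegral_add_left m2, e1, e2]
    _ = _ := by ring

open FourierTransform

lemma lintegral_enorm_sq_fourier (f : SchwartzMap (En n) ℂ) :
    ∫⁻ t, ‖𝓕 f t‖ₑ ^ 2 = ∫⁻ t, ‖f t‖ₑ ^ 2 := by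
  have key : ∀ g : SchwartzMap (En n) ℂ, ∫⁻ t, ‖g t‖ₑ ^ 2 = ENNReal.ofReal (∫ t, ‖g t‖ ^ 2) := by
    intro g
    have h : Integrable fun t => ‖g t‖ ^ 2 :=
      (g.memLp (2 : ℕ)).integrable_norm_pow two_ne_zero
    rw [ofReal_integral_eq_lintegral_ofReal h (ae_of_all _ fun t => by positivity)]
    congr 1
    ext t
    rw [ENNReal.ofReal_pow (norm_nonneg _), ofReal_norm]
  rw [key, key, SchwartzMap.integral_norm_sq_fourier]

/-- The unnormalized inverse Fourier transform `∫ e^{i⟨y,ξ⟩} u(ξ) dξ`. -/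
def invF (u : En n → ℂ) (y : En n) : ℂ := ∫ ξ, ph y ξ * u ξ

lemma fourier_modulate (x t : En n) (u : SchwartzMap (En n) ℂ) :
    𝓕 (modulate x u) t = invF u (x - (2 * π) • t) := by
  rw [SchwartzMap.fourier_coe, Real.fourier_eq', invF]
  congr 1
  ext ξ
  rw [modulate_apply, smul_eq_mul, ← mul_assoc, ph, ph, ← Complex.exp_add, inner_sub_left,
    real_inner_smul_left, real_inner_comm ξ t]
  congr 2
  push_cast
  ring

lemma continuous_invF (u : SchwartzMap (En n) ℂ) : Continuous (invF u) := by
  have h : (invF u : En n → ℂ) = fun y => 𝓕 (modulate 0 u) ((-(2 * π)⁻¹ : ℝ) • y) := by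
    ext y
    rw [fourier_modulate, smul_smul]
    have := Real.pi_pos
    have h1 : (2 * π * -(2 * π)⁻¹ : ℝ) = -1 := by field_simp
    rw [h1]
    simp
  rw [h]
  exact (𝓕 (modulate 0 u)).continuous.comp (by fun_prop)

end Schur

section Boundedness

variable {n : ℕ} {ι : Type*} {Λ : En n → ℝ} {ρ : ℝ}

lemma amp_tensor (f g : En n → En n → ℂ) (u : SchwartzMap (En n) ℂ) (x : En n) :
    amp (fun z => f z.1 z.2.1 * (starRingEnd ℂ) (g z.1 z.2.2)) u x
      = invF (fun ξ => f x ξ * u ξ) x * (starRingEnd ℂ) (invF (fun ξ => g x ξ * u ξ) x) := by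
  unfold amp pairing invF
  rw [← integral_conj, Measure.volume_eq_prod, ← integral_prod_mul]
  congr 1
  ext p
  simp only [modulate_apply, map_mul]
  ring

lemma jb_le_sq (x : En n) : jb x ≤ (1 + ‖x‖) ^ 2 := by
  unfold jb
  nlinarith [norm_nonneg x]

lemma SGWeight.exists_rpow_le (hΛ : SGWeight n Λ ρ) (s : ℝ) :
    ∃ (A : ℝ) (K : ℕ), 0 < A ∧ ∀ x, Λ x ^ s ≤ A * (1 + ‖x‖) ^ K := by
  obtain ⟨C, K, hC, h⟩ := hΛ.moderate s
  have hp : 0 < Λ 0 ^ s := Real.rpow_pos_of_pos (hΛ.pos 0) s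
  refine ⟨C * Λ 0 ^ s, 2 * K, by positivity, fun x => (h x 0).trans ?_⟩
  rw [sub_zero, pow_mul]
  gcongr
  · exact (jb_pos x).le
  · exact jb_le_sq x

lemma jb_smul_le (t : En n) : jb ((2 * π) • t) ≤ (2 * π) ^ 2 * jb t := by
  have h : (1 : ℝ) ≤ (2 * π) ^ 2 := by nlinarith [Real.pi_gt_three]
  unfold jb
  rw [norm_smul, mul_pow, Real.norm_eq_abs, sq_abs]
  linarith

/-- The weighted norm `∫ Λ(x)^s |∫ e^{i⟨x,ξ⟩} u(ξ) dξ|² dx`. -/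
def wNorm (Λ : En n → ℝ) (s : ℝ) (u : SchwartzMap (En n) ℂ) : ℝ :=
  ∫ x, Λ x ^ s * ‖invF u x‖ ^ 2

lemma SymbolBound.rpow_weight (hΛ : SGWeight n Λ ρ) (s : ℝ) :
    SymbolBound (fun (_ : ι) x => Λ x ^ s) (fun _ x => Λ x ^ s) :=
  (SymbolBound.rpow (fun _ => hΛ.pos) one_pos (fun _ x => (one_mul (Λ x)).le) hΛ.bound s).reindex
    (fun _ : ι => ())

lemma SGWeight.temperate_rpow_ofReal (hΛ : SGWeight n Λ ρ) (s : ℝ) :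
    Temperate (fun (_ : ι) x => ((Λ x ^ s : ℝ) : ℂ)) := by
  obtain ⟨A, K, hA, h⟩ := hΛ.exists_rpow_le s
  exact Temperate.of_le (SymbolBound.clm_comp Complex.ofRealCLM (SymbolBound.rpow_weight hΛ s))
    hA.le fun _ x => h x

lemma integrable_wNorm (hΛ : SGWeight n Λ ρ) (s : ℝ) (u : SchwartzMap (En n) ℂ) :
    Integrable fun x => Λ x ^ s * ‖invF u x‖ ^ 2 := by
  have hT : Temperate (fun (_ : Unit) (z : Ph3 n) => ((Λ z.1 ^ s : ℝ) : ℂ)) :=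
    (hΛ.temperate_rpow_ofReal s).comp_clm (ContinuousLinearMap.fst ℝ (En n) (En n × En n))
  refine (hT.integrable_amp () u).norm.congr (ae_of_all _ fun x => ?_)
  have h := amp_tensor (fun x _ => ((Λ x ^ s : ℝ) : ℂ)) (fun _ _ => 1) u x
  simp only [map_one, mul_one, one_mul] at h
  have h2 : invF (fun ξ => ((Λ x ^ s : ℝ) : ℂ) * u ξ) x = ((Λ x ^ s : ℝ) : ℂ) * invF u x := by
    unfold invF
    rw [← integral_const_mul]
    congr 1
    ext ξ
    ring
  change ‖amp (fun z => ((Λ z.1 ^ s : ℝ) : ℂ)) u x‖ = _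
  rw [h, h2, norm_mul, norm_mul, RCLike.norm_conj, Complex.norm_real, Real.norm_eq_abs,
    abs_of_pos (Real.rpow_pos_of_pos (hΛ.pos x) s)]
  ring

lemma wNorm_nonneg (hΛ : SGWeight n Λ ρ) (s : ℝ) (u : SchwartzMap (En n) ℂ) : 0 ≤ wNorm Λ s u :=
  integral_nonneg fun x => mul_nonneg (Real.rpow_pos_of_pos (hΛ.pos x) s).le (by positivity)

lemma lintegral_wNorm (hΛ : SGWeight n Λ ρ) (s : ℝ) (u : SchwartzMap (En n) ℂ) :
    ∫⁻ x, ENNReal.ofReal (Λ x ^ s) * ‖invF u x‖ₑ ^ 2 = ENNReal.ofReal (wNorm Λ s u) := by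
  have hp := fun x => (Real.rpow_pos_of_pos (hΛ.pos x) s).le
  rw [wNorm, ofReal_integral_eq_lintegral_ofReal (integrable_wNorm hΛ s u)
    (ae_of_all _ fun x => mul_nonneg (hp x) (by positivity))]
  congr 1
  ext x
  rw [ENNReal.ofReal_mul (hp x), ENNReal.ofReal_pow (norm_nonneg _), ofReal_norm]

lemma inv_jb_pow_mul_le (t : En n) (K : ℕ) :
    ((jb t)⁻¹ ^ (K + n + 1)) ^ 2 * jb t ^ K ≤ decay t := by
  have h0 := jb_pos t
  have h1 : (jb t)⁻¹ ≤ 1 := inv_le_one_of_one_le₀ (one_le_jb t)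
  have e : ((jb t)⁻¹ ^ (K + n + 1)) ^ 2 * jb t ^ K = (jb t)⁻¹ ^ (K + n + 1) * decay t := by
    have e' : (jb t)⁻¹ ^ (K + n + 1) * jb t ^ K = decay t := by
      rw [decay, show K + n + 1 = (n + 1) + K by ring, pow_add, mul_assoc, ← mul_pow,
        inv_mul_cancel₀ h0.ne', one_pow, mul_one]
    rw [← e']
    ring
  rw [e]
  exact mul_le_of_le_one_left (decay_nonneg t) (pow_le_one₀ (inv_nonneg.2 h0.le) h1)

/-- The form averaged against translates is controlled by the weighted norm. -/
lemma exists_lintegral_translate_le (hΛ : SGWeight n Λ ρ) (s : ℝ) : ∃ (K : ℕ) (C : ℝ), 0 ≤ C ∧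
    ∀ u : SchwartzMap (En n) ℂ,
      ∫⁻ x, ENNReal.ofReal (Λ x ^ s) * ∫⁻ t : En n,
        ENNReal.ofReal (((jb t)⁻¹ ^ (K + n + 1)) ^ 2) * ‖invF u (x - (2 * π) • t)‖ₑ ^ 2
      ≤ ENNReal.ofReal (C * wNorm Λ s u) := by
  obtain ⟨C, K, hC, h⟩ := hΛ.moderate s
  have hp := fun x => Real.rpow_pos_of_pos (hΛ.pos x) s
  set I := ∫⁻ t : En n, ENNReal.ofReal (decay t) with hI
  have hIt : I ≠ ⊤ := lintegral_decay_ne_top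
  refine ⟨K, C * ((2 * π) ^ 2) ^ K * I.toReal, by positivity, fun u => ?_⟩
  have mΛ : Measurable fun x => ENNReal.ofReal (Λ x ^ s) :=
    ((hΛ.smooth.continuous.rpow_const fun x => Or.inl (hΛ.pos x).ne').measurable).ennreal_ofReal
  have mF : Measurable fun y => ‖invF u y‖ₑ ^ 2 := (continuous_invF u).measurable.enorm.pow_const 2
  have mJ : Measurable fun t : En n => ENNReal.ofReal (((jb t)⁻¹ ^ (K + n + 1)) ^ 2) :=
    ((((continuous_jb.inv₀ fun t => (jb_pos t).ne').pow _).pow 2).measurable).ennreal_ofReal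
  have mFs : Measurable fun p : En n × En n => ‖invF u (p.1 - (2 * π) • p.2)‖ₑ ^ 2 :=
    mF.comp (by fun_prop)
  have mU : Measurable fun p : En n × En n => ENNReal.ofReal (Λ p.1 ^ s) *
      (ENNReal.ofReal (((jb p.2)⁻¹ ^ (K + n + 1)) ^ 2) * ‖invF u (p.1 - (2 * π) • p.2)‖ₑ ^ 2) :=
    (mΛ.comp measurable_fst).mul ((mJ.comp measurable_snd).mul mFs)
  calc ∫⁻ x, ENNReal.ofReal (Λ x ^ s) * ∫⁻ t : En n,
        ENNReal.ofReal (((jb t)⁻¹ ^ (K + n + 1)) ^ 2) * ‖invF u (x - (2 * π) • t)‖ₑ ^ 2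
      = ∫⁻ x, ∫⁻ t : En n, ENNReal.ofReal (Λ x ^ s) *
        (ENNReal.ofReal (((jb t)⁻¹ ^ (K + n + 1)) ^ 2) * ‖invF u (x - (2 * π) • t)‖ₑ ^ 2) := by
        congr 1
        ext x
        rw [lintegral_const_mul' _ _ ENNReal.ofReal_ne_top]
    _ = ∫⁻ t : En n, ∫⁻ x, ENNReal.ofReal (Λ x ^ s) *
        (ENNReal.ofReal (((jb t)⁻¹ ^ (K + n + 1)) ^ 2) * ‖invF u (x - (2 * π) • t)‖ₑ ^ 2) :=
        lintegral_lintegral_swap mU.aemeasurable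
    _ = ∫⁻ t : En n, ∫⁻ y, ENNReal.ofReal (Λ (y + (2 * π) • t) ^ s) *
        (ENNReal.ofReal (((jb t)⁻¹ ^ (K + n + 1)) ^ 2) * ‖invF u y‖ₑ ^ 2) := by
        congr 1
        ext t
        rw [← lintegral_add_right_eq_self _ ((2 * π) • t)]
        simp only [add_sub_cancel_right]
    _ ≤ ∫⁻ t : En n, ∫⁻ y, (ENNReal.ofReal (C * ((2 * π) ^ 2) ^ K) * ENNReal.ofReal (decay t)) *
        (ENNReal.ofReal (Λ y ^ s) * ‖invF u y‖ₑ ^ 2) := by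
        refine lintegral_mono fun t => lintegral_mono fun y => ?_
        rw [← mul_assoc, ← mul_assoc]
        refine mul_le_mul_left ?_ _
        rw [← ENNReal.ofReal_mul (hp _).le, ← ENNReal.ofReal_mul (by positivity),
          ← ENNReal.ofReal_mul (mul_nonneg (by positivity) (decay_nonneg t))]
        refine ENNReal.ofReal_le_ofReal ?_
        have hj : jb ((2 * π) • t) ^ K ≤ ((2 * π) ^ 2) ^ K * jb t ^ K := by
          rw [← mul_pow]
          exact pow_le_pow_left₀ (jb_pos _).le (jb_smul_le t) K
        have h1 := h (y + (2 * π) • t) y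
        rw [add_sub_cancel_left] at h1
        have hy := (hp y).le
        calc Λ (y + (2 * π) • t) ^ s * ((jb t)⁻¹ ^ (K + n + 1)) ^ 2
            ≤ (C * Λ y ^ s * (((2 * π) ^ 2) ^ K * jb t ^ K)) * ((jb t)⁻¹ ^ (K + n + 1)) ^ 2 := by
              gcongr
              exact h1.trans (by gcongr)
          _ = C * ((2 * π) ^ 2) ^ K * Λ y ^ s * (((jb t)⁻¹ ^ (K + n + 1)) ^ 2 * jb t ^ K) := by
              ring
          _ ≤ C * ((2 * π) ^ 2) ^ K * Λ y ^ s * decay t := by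
              gcongr
              exact inv_jb_pow_mul_le t K
          _ = _ := by ring
    _ = ENNReal.ofReal (C * ((2 * π) ^ 2) ^ K) * I * ENNReal.ofReal (wNorm Λ s u) := by
        have e : ∀ t : En n, ∫⁻ y, (ENNReal.ofReal (C * ((2 * π) ^ 2) ^ K)
            * ENNReal.ofReal (decay t)) * (ENNReal.ofReal (Λ y ^ s) * ‖invF u y‖ₑ ^ 2)
            = (ENNReal.ofReal (C * ((2 * π) ^ 2) ^ K) * ENNReal.ofReal (decay t))
              * ENNReal.ofReal (wNorm Λ s u) := fun t => by
          rw [lintegral_const_mul' _ _ (by finiteness), lintegral_wNorm hΛ]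
        simp_rw [e]
        rw [lintegral_mul_const' _ _ ENNReal.ofReal_ne_top,
          lintegral_const_mul' _ _ ENNReal.ofReal_ne_top]
    _ = _ := by
        rw [ENNReal.ofReal_mul (p := C * ((2 * π) ^ 2) ^ K * I.toReal) (by positivity),
          ENNReal.ofReal_mul (p := C * ((2 * π) ^ 2) ^ K) (by positivity),
          ENNReal.ofReal_toReal hIt]

/-- Boundedness of forms whose amplitude is controlled by a power of the weight in `x` and
grows polynomially off the diagonal. -/
lemma exists_norm_form_le (hΛ : SGWeight n Λ ρ) {s r : ℝ} {c : ι → Ph3 n → ℂ}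
    (hc : SymbolBound c (fun _ z => Λ z.1 ^ s * jb (diffCLM z) ^ r)) :
    ∃ C : ℝ, 0 ≤ C ∧ ∀ i u, ‖form (c i) u‖ ≤ C * wNorm Λ s u := by
  have hp := fun x => Real.rpow_pos_of_pos (hΛ.pos x) s
  obtain ⟨A₀, K₀, -, hA₀⟩ := hΛ.exists_rpow_le s
  obtain ⟨c', hc', e⟩ := exists_lower hp hA₀ (⌈r⌉₊ + n + 1) hc
  obtain ⟨K, C, hC, hK⟩ := exists_lintegral_translate_le hΛ s
  have hs : SymbolBound (fun (k : ι × En n) p => c' k.1 (k.2, p))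
      (fun k p => Λ k.2 ^ s * decay (p.1 - p.2)) := by
    refine (SymbolBound.slice hc').mono 1 zero_le_one fun k p => ?_
    rw [one_mul]
    change Λ k.2 ^ s * jb (p.1 - p.2) ^ _ ≤ _
    refine mul_le_mul_of_nonneg_left ?_ (hp _).le
    rw [decay, ← Real.rpow_natCast, Real.inv_rpow (jb_pos _).le, ← Real.rpow_neg (jb_pos _).le]
    refine Real.rpow_le_rpow_of_exponent_le (one_le_jb _) ?_
    push_cast
    linarith [Nat.le_ceil r]
  have hdec : ∀ t : En n, decay t ≤ 1 := fun t =>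
    pow_le_one₀ (inv_nonneg.2 (jb_pos t).le) (inv_le_one_of_one_le₀ (one_le_jb t))
  obtain ⟨a, ha, ea⟩ := exists_pairing_iterate_resolvent (K + n + 1)
    (B := fun k : ι × En n => Λ k.2 ^ s)
    (fun k => (hp k.2).le) (fun k p => mul_le_of_le_one_right (hp k.2).le (hdec _)) hs
  obtain ⟨D, hD, hD'⟩ := ha.exists_bound
  set I := ∫⁻ t : En n, ENNReal.ofReal (decay t) with hI
  have hIt : I ≠ ⊤ := lintegral_decay_ne_top
  refine ⟨2 * D * I.toReal * C, by positivity, fun i u => ?_⟩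
  have hamp : ∀ x, ‖amp (c' i) u x‖ₑ ≤ ENNReal.ofReal (2 * D * I.toReal) *
      (ENNReal.ofReal (Λ x ^ s) * ∫⁻ t : En n,
        ENNReal.ofReal (((jb t)⁻¹ ^ (K + n + 1)) ^ 2) * ‖invF u (x - (2 * π) • t)‖ₑ ^ 2) := by
    intro x
    have e1 : amp (c' i) u x = pairing (a (i, x)) (resolvent^[K + n + 1] (modulate x u))
        (resolvent^[K + n + 1] (modulate x u)) := ea (i, x) _ _
    rw [e1]
    refine (enorm_pairing_le (mul_nonneg hD (hp x).le) (fun p => (hD' (i, x) p).trans_eq ?_)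
      _).trans_eq ?_
    · ring
    · rw [← lintegral_enorm_sq_fourier]
      have e2 : ∀ t, ‖FourierTransform.fourier (resolvent^[K + n + 1] (modulate x u)) t‖ₑ ^ 2
          = ENNReal.ofReal (((jb t)⁻¹ ^ (K + n + 1)) ^ 2) * ‖invF u (x - (2 * π) • t)‖ₑ ^ 2 := by
        intro t
        have h0 : 0 ≤ (jb t)⁻¹ ^ (K + n + 1) := pow_nonneg (inv_nonneg.2 (jb_pos t).le) _
        rw [fourier_iterate_resolvent, fourier_modulate, enorm_mul, mul_pow,
          ENNReal.ofReal_pow h0, ← ofReal_norm, Complex.norm_real, Real.norm_of_nonneg h0]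
      simp_rw [e2]
      rw [ENNReal.ofReal_mul hD, ENNReal.ofReal_mul (by positivity),
        ENNReal.ofReal_mul zero_le_two, ENNReal.ofReal_toReal hIt, ENNReal.ofReal_ofNat]
      ring
  rw [← ENNReal.ofReal_le_ofReal_iff (mul_nonneg (by positivity) (wNorm_nonneg hΛ s u)),
    ofReal_norm, e, form]
  calc ‖∫ x, amp (c' i) u x‖ₑ ≤ ∫⁻ x, ‖amp (c' i) u x‖ₑ := enorm_integral_le_lintegral_enorm _
    _ ≤ _ := lintegral_mono hamp
    _ = _ := lintegral_const_mul' _ _ ENNReal.ofReal_ne_top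
    _ ≤ ENNReal.ofReal (2 * D * I.toReal) * ENNReal.ofReal (C * wNorm Λ s u) := by
        gcongr
        exact hK u
    _ = _ := by rw [← ENNReal.ofReal_mul (by positivity), mul_assoc _ C]

end Boundedness

/-! ### Forms with SG amplitudes -/

section SGForm

variable {n : ℕ} {ι : Type*} {Λ : En n → ℝ} {ρ : ℝ}

/-- Multiplication of a Schwartz function by a power of the weight. -/
def wMul (Λ : En n → ℝ) (s : ℝ) (u : SchwartzMap (En n) ℂ) : SchwartzMap (En n) ℂ :=
  SchwartzMap.smulLeftCLM ℂ (fun ξ => ((Λ ξ ^ s : ℝ) : ℂ)) u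

lemma SGWeight.wMul_apply (hΛ : SGWeight n Λ ρ) (s : ℝ) (u : SchwartzMap (En n) ℂ) (ξ : En n) :
    wMul Λ s u ξ = ((Λ ξ ^ s : ℝ) : ℂ) * u ξ := by
  obtain ⟨K, hK⟩ := hΛ.temperate_rpow_ofReal (ι := Unit) s
  rw [wMul, SchwartzMap.smulLeftCLM_apply_apply hK.hasTemperateGrowth, smul_eq_mul]

/-- The map `(x, ξ, η) ↦ ξ`. -/
def projXi : Ph3 n →L[ℝ] En n :=
  (ContinuousLinearMap.fst ℝ (En n) (En n)).comp (ContinuousLinearMap.snd ℝ (En n) (En n × En n))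

/-- The map `(x, ξ, η) ↦ η`. -/
def projEta : Ph3 n →L[ℝ] En n :=
  (ContinuousLinearMap.snd ℝ (En n) (En n)).comp (ContinuousLinearMap.snd ℝ (En n) (En n × En n))

lemma symbolBound_rpow_comp (hΛ : SGWeight n Λ ρ) (s : ℝ) (A : Ph3 n →L[ℝ] En n) :
    SymbolBound (fun (_ : ι) z => ((Λ (A z) ^ s : ℝ) : ℂ)) (fun _ z => Λ (A z) ^ s) :=
  (SymbolBound.clm_comp Complex.ofRealCLM (SymbolBound.rpow_weight hΛ s)).comp_clm (fun _ => A) ‖A‖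
    fun _ => le_rfl

lemma jb_neg (t : En n) : jb (-t) = jb t := by rw [jb, norm_neg, jb]

lemma temperate_of_sgBound (hΛ : SGWeight n Λ ρ) {a k r : ℝ} {c : ι → Ph3 n → ℂ}
    (hc : SymbolBound c (fun _ z => Λ z.1 ^ a * Λ z.2.1 ^ k * jb (diffCLM z) ^ r)) :
    Temperate c := by
  have hp := hΛ.pos
  obtain ⟨A, K, -, hA⟩ := hΛ.exists_rpow_le a
  have h1 : Temperate fun i z => ((Λ (projXi z) ^ (-k) : ℝ) : ℂ) * c i z := by
    refine temperate_of_weight (lam := fun x => Λ x ^ a) (r := r)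
      (fun x => Real.rpow_pos_of_pos (hp x) a) hA
      (((symbolBound_rpow_comp hΛ (-k) projXi).mul hc).congr_weight fun _ z => ?_)
    have h : Λ z.2.1 ^ (-k) * Λ z.2.1 ^ k = 1 := by
      rw [← Real.rpow_add (hp _), neg_add_cancel, Real.rpow_zero]
    change Λ z.2.1 ^ (-k) * _ = _
    linear_combination Λ z.1 ^ a * jb (diffCLM z) ^ r * h
  have h2 := ((hΛ.temperate_rpow_ofReal (ι := ι) k).comp_clm projXi).mul h1
  obtain ⟨K', h3⟩ := h2
  refine ⟨K', h3.congr_fun fun i z => ?_⟩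
  rw [← mul_assoc, ← Complex.ofReal_mul, ← Real.rpow_add (hp _), add_neg_cancel, Real.rpow_zero,
    Complex.ofReal_one, one_mul]

lemma form_eq_form_wMul (hΛ : SGWeight n Λ ρ) (s : ℝ) (c : Ph3 n → ℂ) (u : SchwartzMap (En n) ℂ) :
    form c u = form (fun z => c z * (((Λ (projXi z) ^ (-s) : ℝ) : ℂ)
      * ((Λ (projEta z) ^ (-s) : ℝ) : ℂ))) (wMul Λ s u) := by
  have h : ∀ ξ, ((Λ ξ ^ (-s) : ℝ) : ℂ) * ((Λ ξ ^ s : ℝ) : ℂ) = 1 := fun ξ => by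
    rw [← Complex.ofReal_mul, ← Real.rpow_add (hΛ.pos _), neg_add_cancel, Real.rpow_zero,
      Complex.ofReal_one]
  unfold form amp pairing
  congr 1
  ext x
  congr 1
  ext p
  simp only [modulate_apply, hΛ.wMul_apply, map_mul, Complex.conj_ofReal]
  have e1 := h p.1
  have e2 := h p.2
  change _ = c (x, p) * (((Λ p.1 ^ (-s) : ℝ) : ℂ) * ((Λ p.2 ^ (-s) : ℝ) : ℂ)) * _
  linear_combination -(c (x, p) * ph x p.1 * u p.1 * (starRingEnd ℂ) (ph x p.2)
    * (starRingEnd ℂ) (u p.2)) * (e1 + ((Λ p.1 ^ (-s) : ℝ) : ℂ) * ((Λ p.1 ^ s : ℝ) : ℂ) * e2 )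

lemma exists_norm_form_le_of_sgBound (hΛ : SGWeight n Λ ρ) {a k r : ℝ} {c : ι → Ph3 n → ℂ}
    (hc : SymbolBound c (fun _ z => Λ z.1 ^ a * Λ z.2.1 ^ k * jb (diffCLM z) ^ r)) :
    ∃ C : ℝ, 0 ≤ C ∧ ∀ i u, ‖form (c i) u‖ ≤ C * wNorm Λ a (wMul Λ (k / 2) u) := by
  have hp := hΛ.pos
  obtain ⟨C, K, hC, hmod⟩ := hΛ.moderate (-(k / 2))
  have hb : SymbolBound (fun i z => c i z * (((Λ (projXi z) ^ (-(k / 2)) : ℝ) : ℂ)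
      * ((Λ (projEta z) ^ (-(k / 2)) : ℝ) : ℂ)))
      (fun _ z => Λ z.1 ^ a * jb (diffCLM z) ^ (r + K)) := by
    refine (hc.mul ((symbolBound_rpow_comp hΛ _ projXi).mul
      (symbolBound_rpow_comp hΛ _ projEta))).mono C hC.le fun _ z => ?_
    change Λ z.1 ^ a * Λ z.2.1 ^ k * jb (diffCLM z) ^ r
      * (Λ z.2.1 ^ (-(k / 2)) * Λ z.2.2 ^ (-(k / 2))) ≤ _
    have h0 := (Real.rpow_pos_of_pos (hp z.1) a).le
    have h1 := Real.rpow_pos_of_pos (hp z.2.1) k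
    have h2 := Real.rpow_pos_of_pos (hp z.2.1) (-(k / 2))
    have h3 := Real.rpow_pos_of_pos (jb_pos (diffCLM z)) r
    have hm := hmod z.2.2 z.2.1
    rw [← neg_sub, jb_neg] at hm
    have h4 : Λ z.2.1 ^ k * (Λ z.2.1 ^ (-(k / 2)) * Λ z.2.1 ^ (-(k / 2))) = 1 := by
      rw [← Real.rpow_add (hp _), ← Real.rpow_add (hp _)]
      ring_nf
      exact Real.rpow_zero _
    calc Λ z.1 ^ a * Λ z.2.1 ^ k * jb (diffCLM z) ^ r
          * (Λ z.2.1 ^ (-(k / 2)) * Λ z.2.2 ^ (-(k / 2)))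
        ≤ Λ z.1 ^ a * Λ z.2.1 ^ k * jb (diffCLM z) ^ r
          * (Λ z.2.1 ^ (-(k / 2)) * (C * Λ z.2.1 ^ (-(k / 2)) * jb (z.2.1 - z.2.2) ^ K)) := by
          gcongr
      _ = C * (Λ z.1 ^ a * (jb (diffCLM z) ^ r * jb (diffCLM z) ^ K))
          * (Λ z.2.1 ^ k * (Λ z.2.1 ^ (-(k / 2)) * Λ z.2.1 ^ (-(k / 2)))) := by
          rw [diffCLM_apply]
          ring
      _ = _ := by rw [h4, mul_one, Real.rpow_add (jb_pos _), Real.rpow_natCast]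
  obtain ⟨D, hD, h⟩ := exists_norm_form_le hΛ hb
  exact ⟨D, hD, fun i u => by rw [form_eq_form_wMul hΛ (k / 2)]; exact h i _⟩

/-- The map `(x, ξ, η) ↦ (x, ξ + θ(η - ξ))`. -/
def shift (θ : ℝ) : Ph3 n →L[ℝ] En n × En n :=
  ((ContinuousLinearMap.fst ℝ (En n) (En n × En n)).prod projXi)
    - θ • ((0 : Ph3 n →L[ℝ] En n).prod diffCLM)

lemma shift_apply (θ : ℝ) (z : Ph3 n) : shift θ z = (z.1, z.2.1 - θ • (z.2.1 - z.2.2)) := by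
  simp [shift, projXi]

lemma norm_shift_sin_le (t : ℝ) : ‖(shift (Real.sin t) : Ph3 n →L[ℝ] En n × En n)‖
    ≤ ‖(ContinuousLinearMap.fst ℝ (En n) (En n × En n)).prod projXi‖
      + ‖(0 : Ph3 n →L[ℝ] En n).prod diffCLM‖ := by
  refine (norm_sub_le _ _).trans (add_le_add_right ?_ _)
  rw [norm_smul]
  exact mul_le_of_le_one_left (norm_nonneg _) (Real.abs_sin_le_one t)

lemma symbolBound_mul_shift (hΛ : SGWeight n Λ ρ) {a k a' k' C : ℝ} {K : ℕ} (hC : 0 < C)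
    (hmod : ∀ x y, Λ x ^ k' ≤ C * Λ y ^ k' * jb (x - y) ^ K) {f g : En n × En n → ℂ}
    (hf : SymbolBound (fun _ : Unit => f) (fun _ => sgWt Λ k a))
    (hg : SymbolBound (fun _ : Unit => g) (fun _ => sgWt Λ k' a')) :
    SymbolBound (fun (t : ℝ) (z : Ph3 n) => f (shift 0 z) * g (shift (Real.sin t) z))
      (fun _ z => Λ z.1 ^ (a + a') * Λ z.2.1 ^ (k + k') * jb (diffCLM z) ^ (K : ℝ)) := by
  have hp := hΛ.pos
  refine (((hf.reindex fun _ : ℝ => ()).comp_clm (fun _ => shift 0) _ fun _ => le_rfl).mul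
    ((hg.reindex fun _ : ℝ => ()).comp_clm (fun t => shift (Real.sin t)) _
      norm_shift_sin_le)).mono C hC.le fun t z => ?_
  rw [shift_apply, shift_apply, zero_smul, sub_zero]
  change Λ z.1 ^ a * Λ z.2.1 ^ k
    * (Λ z.1 ^ a' * Λ (z.2.1 - Real.sin t • (z.2.1 - z.2.2)) ^ k') ≤ _
  have h0 := (Real.rpow_pos_of_pos (hp z.1) a).le
  have h1 := (Real.rpow_pos_of_pos (hp z.2.1) k).le
  have h2 := (Real.rpow_pos_of_pos (hp z.1) a').le
  have h3 := (Real.rpow_pos_of_pos (hp z.2.1) k').le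
  have hj : jb (z.2.1 - Real.sin t • (z.2.1 - z.2.2) - z.2.1) ≤ jb (diffCLM z) := by
    rw [sub_sub_cancel_left, jb_neg, diffCLM_apply, jb, jb, norm_smul]
    have : ‖Real.sin t‖ ≤ 1 := Real.abs_sin_le_one t
    have h5 : ‖Real.sin t‖ * ‖z.2.1 - z.2.2‖ ≤ ‖z.2.1 - z.2.2‖ :=
      mul_le_of_le_one_left (norm_nonneg _) this
    gcongr
  calc Λ z.1 ^ a * Λ z.2.1 ^ k
        * (Λ z.1 ^ a' * Λ (z.2.1 - Real.sin t • (z.2.1 - z.2.2)) ^ k')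
      ≤ Λ z.1 ^ a * Λ z.2.1 ^ k * (Λ z.1 ^ a' * (C * Λ z.2.1 ^ k' * jb (diffCLM z) ^ K)) := by
        have h6 := pow_le_pow_left₀ (jb_pos _).le hj K
        gcongr
        exact (hmod _ z.2.1).trans (by gcongr)
    _ = _ := by
        rw [Real.rpow_add (hp _), Real.rpow_add (hp _), Real.rpow_natCast]
        ring

lemma SymbolBound.cos {E : Type*} [NormedAddCommGroup E] [NormedSpace ℝ E] :
    SymbolBound (fun (t : ℝ) (_ : E) => ((-Real.cos t : ℝ) : ℂ)) (fun _ _ => 1) := by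
  refine ⟨fun _ => contDiff_const, fun k => ⟨1, zero_le_one, fun t z => ?_⟩⟩
  rcases Nat.eq_zero_or_pos k with rfl | hk
  · rw [norm_iteratedFDeriv_zero, Complex.norm_real, norm_neg, mul_one]
    exact Real.abs_cos_le_one t
  · rw [iteratedFDeriv_const_of_ne (by omega)]
    simp

lemma dirDeriv_comp_shift {g : En n × En n → ℂ} (hg : ContDiff ℝ (⊤ : ℕ∞) g) (θ : ℝ) (j : Fin n) :
    dirDeriv (dirU j) (fun z : Ph3 n => g (shift θ z))
      = fun z => dirDeriv (dirX j) g (shift θ z) := by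
  have h := dirDeriv_comp_clm_add (shift θ) 0 hg (dirU j : Ph3 n)
  simp only [add_zero] at h
  rw [h, shift_apply]
  simp [dirU, dirX]

lemma hasDerivAt_comp_shift {g : En n × En n → ℂ} (hg : ContDiff ℝ (⊤ : ℕ∞) g) (z : Ph3 n)
    (t : ℝ) :
    HasDerivAt (fun t => g (shift (Real.sin t) z))
      (∑ j, diffCoord j z * (((-Real.cos t : ℝ) : ℂ)
        * dirDeriv (dirXi j) g (shift (Real.sin t) z))) t := by
  have h1 : HasDerivAt (fun t => shift (Real.sin t) z)
      (-(Real.cos t • ((0 : En n), diffCLM z))) t := by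
    have h := ((Real.hasDerivAt_sin t).smul_const ((0 : En n), diffCLM z)).const_sub
      ((z.1, z.2.1) : En n × En n)
    refine h.congr_of_eventuallyEq (Eventually.of_forall fun s => ?_)
    simp [shift_apply]
  have h2 := ((hg.differentiable (by simp)) (shift (Real.sin t) z)).hasFDerivAt.comp_hasDerivAt t h1
  refine h2.congr_deriv ?_
  have h3 : ((0 : En n), diffCLM z) = ∑ j, (diffCLM z) j • (dirXi j : En n × En n) := by
    conv_lhs => rw [← sum_coord_smul (diffCLM z)]
    refine Prod.ext ?_ ?_
    · simp [Prod.fst_sum, dirXi]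
    · simp [Prod.snd_sum, dirXi]
  rw [h3, map_neg, map_smul, map_sum, Finset.smul_sum, ← Finset.sum_neg_distrib]
  refine Finset.sum_congr rfl fun j _ => ?_
  rw [map_smul, diffCoord_apply, dirDeriv, diffCLM_apply, Complex.real_smul, Complex.real_smul]
  push_cast
  ring

/-- Replacing the second frequency variable by the first one changes the form of a product of
two SG symbols by a term of lower order. -/
lemma exists_norm_form_sub_le (hΛ : SGWeight n Λ ρ) {k a k' a' : ℝ} {f g : En n × En n → ℂ}
    (hf : SGSymbol Λ ρ k a f) (hg : SGSymbol Λ ρ k' a' g) :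
    ∃ C : ℝ, 0 ≤ C ∧ ∀ u, ‖form (fun z => f (z.1, z.2.1) * g (z.1, z.2.2)) u
      - form (fun z => f (z.1, z.2.1) * g (z.1, z.2.1)) u‖
      ≤ C * wNorm Λ (a + a' - ρ) (wMul Λ ((k + k' - ρ) / 2) u) := by
  obtain ⟨D, L, hD, hmod₀⟩ := hΛ.moderate k'
  obtain ⟨C, K, hC, hmod⟩ := hΛ.moderate (k' - ρ)
  set c : ℝ → Ph3 n → ℂ := fun t z => f (shift 0 z) * g (shift (Real.sin t) z) with hcdef
  have hcT : Temperate c := temperate_of_sgBound hΛ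
    (symbolBound_mul_shift hΛ hD hmod₀ hf.base hg.base)
  set e : Fin n → ℝ → Ph3 n → ℂ := fun j t z => ((-Real.cos t : ℝ) : ℂ)
    * (f (shift 0 z) * dirDeriv (dirXi j) g (shift (Real.sin t) z)) with hedef
  have heT : ∀ j, Temperate (e j) := fun j =>
    temperate_of_sgBound hΛ ((SymbolBound.cos.mul
      (symbolBound_mul_shift hΛ hC hmod hf.base (hg.dxi j))).congr_weight fun _ _ => one_mul _)
  have heT' : ∀ j, Temperate (fun t z => diffCoord j z * e j t z) := fun j =>
    (Temperate.clm (diffCoord j)).mul (heT j)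
  have hd : ∀ t z, HasDerivAt (fun s => c s z) (∑ j, diffCoord j z * e j t z) t := fun t z => by
    refine ((hasDerivAt_comp_shift hg.smooth z t).const_mul (f (shift 0 z))).congr_deriv ?_
    rw [Finset.mul_sum]
    exact Finset.sum_congr rfl fun j _ => by simp only [hedef]; ring
  have heB : ∀ j, SymbolBound (fun t => dirDeriv (dirU j) (e j t))
      (fun _ z => Λ z.1 ^ (a + a' - ρ) * Λ z.2.1 ^ (k + k' - ρ) * jb (diffCLM z) ^ (K : ℝ)) := by
    intro j
    have h1 := symbolBound_mul_shift hΛ hC hmod (hf.dx j) (hg.dxi j)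
    have h2 := symbolBound_mul_shift hΛ hC hmod hf.base (hg.dxdxi j j)
    have h1' := h1.congr_weight (w' := fun _ z => Λ z.1 ^ (a + a' - ρ) * Λ z.2.1 ^ (k + k' - ρ)
      * jb (diffCLM z) ^ (K : ℝ)) fun _ z => by
        rw [show a - ρ + a' = a + a' - ρ by ring, show k + (k' - ρ) = k + k' - ρ by ring]
    have h2' := h2.congr_weight (w' := fun _ z => Λ z.1 ^ (a + a' - ρ) * Λ z.2.1 ^ (k + k' - ρ)
      * jb (diffCLM z) ^ (K : ℝ)) fun _ z => by
        rw [show a + (a' - ρ) = a + a' - ρ by ring, show k + (k' - ρ) = k + k' - ρ by ring]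
    refine ((SymbolBound.cos.mul (h1'.add h2')).congr_weight fun _ _ => one_mul _).congr_fun
      fun t z => ?_
    have s1 : ContDiff ℝ (⊤ : ℕ∞) fun z : Ph3 n => f (shift 0 z) :=
      hf.smooth.comp (shift 0).contDiff
    have s2 : ContDiff ℝ (⊤ : ℕ∞) fun z : Ph3 n => dirDeriv (dirXi j) g (shift (Real.sin t) z) :=
      (contDiff_dirDeriv hg.smooth _).comp (shift _).contDiff
    simp only [hedef]
    rw [dirDeriv_mul contDiff_const (s1.mul s2), dirDeriv_mul s1 s2, dirDeriv_comp_shift hf.smooth,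
      dirDeriv_comp_shift (contDiff_dirDeriv hg.smooth _)]
    simp [dirDeriv]
  choose B hB0 hB using fun j => exists_norm_form_le_of_sgBound hΛ (heB j)
  refine ⟨(∑ j, B j) * 2, mul_nonneg (Finset.sum_nonneg fun j _ => hB0 j) zero_le_two,
    fun u => ?_⟩
  set N := wNorm Λ (a + a' - ρ) (wMul Λ ((k + k' - ρ) / 2) u) with hN
  have hN0 : 0 ≤ N := wNorm_nonneg hΛ _ _
  have hderiv := fun t => hasDerivAt_form hcT
    (Temperate.sum Finset.univ fun j _ => heT' j) hd u t
  have hbound : ∀ t, ‖form (fun z => ∑ j, diffCoord j z * e j t z) u‖ ≤ (∑ j, B j) * N := by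
    intro t
    rw [form_sum Finset.univ (fun j _ => heT' j) t u, Finset.sum_mul]
    refine (norm_sum_le _ _).trans (Finset.sum_le_sum fun j _ => ?_)
    rw [form_diffCoord_mul (heT j), norm_mul, Complex.norm_I, one_mul]
    exact hB j t u
  have hmv := convex_univ.norm_image_sub_le_of_norm_hasDerivWithin_le
    (fun t _ => (hderiv t).hasDerivWithinAt) (fun t _ => hbound t)
    (Set.mem_univ (0 : ℝ)) (Set.mem_univ (π / 2))
  have e0 : c 0 = fun z => f (z.1, z.2.1) * g (z.1, z.2.1) := by
    ext z
    simp [hcdef, shift_apply]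
  have e1 : c (π / 2) = fun z => f (z.1, z.2.1) * g (z.1, z.2.2) := by
    ext z
    simp [hcdef, shift_apply]
  rw [e0, e1, sub_zero, Real.norm_of_nonneg (by positivity)] at hmv
  refine hmv.trans ?_
  have h0 : 0 ≤ (∑ j, B j) * N := mul_nonneg (Finset.sum_nonneg fun j _ => hB0 j) hN0
  nlinarith [Real.pi_le_four]

end SGForm

/-! ### Gårding's inequality on the Fourier side -/

section Garding

variable {n : ℕ} {Λ : En n → ℝ} {ρ : ℝ}

/-- The form with amplitude `τ(x, ξ)`. -/
def leftForm (τ : En n × En n → ℝ) (u : SchwartzMap (En n) ℂ) : ℂ :=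
  form (fun z => ((τ (z.1, z.2.1) : ℝ) : ℂ)) u

/-- The form with amplitude `f(x, ξ) g(x, η)`. -/
def tensorForm (f g : En n × En n → ℝ) (u : SchwartzMap (En n) ℂ) : ℂ :=
  form (fun z => ((f (z.1, z.2.1) : ℝ) : ℂ) * ((g (z.1, z.2.2) : ℝ) : ℂ)) u

lemma SGSymbol.ofReal {k a : ℝ} {f : En n × En n → ℝ} (hf : SGSymbol Λ ρ k a f) :
    SGSymbol Λ ρ k a (fun q => ((f q : ℝ) : ℂ)) := hf.clm_comp Complex.ofRealCLM

lemma SGSymbol.symbolBound_left {k a : ℝ} {f : En n × En n → ℂ} (hf : SGSymbol Λ ρ k a f) :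
    SymbolBound (fun (_ : Unit) (z : Ph3 n) => f (z.1, z.2.1))
      (fun _ z => Λ z.1 ^ a * Λ z.2.1 ^ k * jb (diffCLM z) ^ (0 : ℝ)) :=
  (hf.base.comp_clm (fun _ => (ContinuousLinearMap.fst ℝ (En n) (En n × En n)).prod projXi) _
    fun _ => le_rfl).congr_weight fun _ z => by rw [Real.rpow_zero, mul_one]; rfl

lemma SGSymbol.temperate_left (hΛ : SGWeight n Λ ρ) {k a : ℝ} {f : En n × En n → ℂ}
    (hf : SGSymbol Λ ρ k a f) : Temperate (fun (_ : Unit) (z : Ph3 n) => f (z.1, z.2.1)) :=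
  temperate_of_sgBound hΛ hf.symbolBound_left

lemma tensorForm_eq (f g : En n × En n → ℝ) (u : SchwartzMap (En n) ℂ) :
    tensorForm f g u = ∫ x, invF (fun ξ => ((f (x, ξ) : ℝ) : ℂ) * u ξ) x
      * (starRingEnd ℂ) (invF (fun ξ => ((g (x, ξ) : ℝ) : ℂ) * u ξ) x) := by
  unfold tensorForm form
  congr 1
  ext x
  have h := amp_tensor (fun x ξ => ((f (x, ξ) : ℝ) : ℂ)) (fun x ξ => ((g (x, ξ) : ℝ) : ℂ)) u x
  simpa only [Complex.conj_ofReal] using h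

lemma conj_tensorForm (f g : En n × En n → ℝ) (u : SchwartzMap (En n) ℂ) :
    (starRingEnd ℂ) (tensorForm f g u) = tensorForm g f u := by
  rw [tensorForm_eq, tensorForm_eq, ← integral_conj]
  congr 1
  ext x
  rw [map_mul, Complex.conj_conj, mul_comm]

lemma tensorForm_self (f : En n × En n → ℝ) (u : SchwartzMap (En n) ℂ) :
    tensorForm f f u = ((∫ x, ‖invF (fun ξ => ((f (x, ξ) : ℝ) : ℂ) * u ξ) x‖ ^ 2 : ℝ) : ℂ) := by
  rw [tensorForm_eq, ← integral_complex_ofReal]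
  congr 1
  ext x
  rw [Complex.mul_conj, Complex.normSq_eq_norm_sq]

lemma invF_const_mul (z : ℂ) (f : En n → ℂ) (x : En n) :
    invF (fun ξ => z * f ξ) x = z * invF f x := by
  unfold invF
  rw [← integral_const_mul]
  congr 1
  ext ξ
  ring

lemma tensorForm_sgWt (hΛ : SGWeight n Λ ρ) (k a : ℝ) (u : SchwartzMap (En n) ℂ) :
    tensorForm (sgWt Λ k a) (sgWt Λ k a) u = ((wNorm Λ (2 * a) (wMul Λ k u) : ℝ) : ℂ) := by
  rw [tensorForm_self, wNorm]
  congr 2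
  ext x
  have h : (fun ξ => ((sgWt Λ k a (x, ξ) : ℝ) : ℂ) * u ξ)
      = fun ξ => ((Λ x ^ a : ℝ) : ℂ) * wMul Λ k u ξ := by
    ext ξ
    rw [hΛ.wMul_apply, sgWt, Complex.ofReal_mul, mul_assoc]
  rw [h, invF_const_mul, norm_mul, mul_pow, Complex.norm_real, Real.norm_eq_abs, sq_abs,
    ← Real.rpow_natCast, ← Real.rpow_mul (hΛ.pos x).le]
  congr 2
  push_cast
  ring

lemma exists_norm_leftForm_le (hΛ : SGWeight n Λ ρ) {k a : ℝ} {f : En n × En n → ℝ}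
    (hf : SGSymbol Λ ρ k a f) :
    ∃ C : ℝ, 0 ≤ C ∧ ∀ u, ‖leftForm f u‖ ≤ C * wNorm Λ a (wMul Λ (k / 2) u) := by
  obtain ⟨C, hC, h⟩ := exists_norm_form_le_of_sgBound hΛ hf.ofReal.symbolBound_left
  exact ⟨C, hC, h ()⟩

lemma exists_norm_tensorForm_sub_le (hΛ : SGWeight n Λ ρ) {k a k' a' : ℝ} {f g : En n × En n → ℝ}
    (hf : SGSymbol Λ ρ k a f) (hg : SGSymbol Λ ρ k' a' g) :
    ∃ C : ℝ, 0 ≤ C ∧ ∀ u, ‖tensorForm f g u - leftForm (fun q => f q * g q) u‖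
      ≤ C * wNorm Λ (a + a' - ρ) (wMul Λ ((k + k' - ρ) / 2) u) := by
  obtain ⟨C, hC, h⟩ := exists_norm_form_sub_le hΛ hf.ofReal hg.ofReal
  refine ⟨C, hC, fun u => ?_⟩
  simpa only [tensorForm, leftForm, Complex.ofReal_mul] using h u

/-- The weighted norm is monotone in the frequency order. -/
lemma exists_wNorm_le (hΛ : SGWeight n Λ ρ) (a : ℝ) {t' t : ℝ} (h : t' ≤ t) :
    ∃ C : ℝ, 0 ≤ C ∧ ∀ u, wNorm Λ a (wMul Λ t' u) ≤ C * wNorm Λ a (wMul Λ t u) := by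
  have hp := hΛ.pos
  obtain ⟨D, hD, hD'⟩ := exists_rpow_le_rpow hΛ.lower (show 2 * t' ≤ 2 * t by linarith)
  obtain ⟨M, K, hM, hmod⟩ := hΛ.moderate t'
  have hb : SymbolBound (fun (_ : Unit) (z : Ph3 n) =>
      ((sgWt Λ t' (a / 2) (z.1, z.2.1) : ℝ) : ℂ) * ((sgWt Λ t' (a / 2) (z.1, z.2.2) : ℝ) : ℂ))
      (fun _ z => Λ z.1 ^ a * Λ z.2.1 ^ (2 * t) * jb (diffCLM z) ^ (K : ℝ)) := by
    have h0 := (SGSymbol.weight hΛ t' (a / 2)).ofReal.base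
    refine ((h0.comp_clm (fun _ =>
      (ContinuousLinearMap.fst ℝ (En n) (En n × En n)).prod projXi) _ fun _ => le_rfl).mul
      (h0.comp_clm (fun _ =>
      (ContinuousLinearMap.fst ℝ (En n) (En n × En n)).prod projEta) _ fun _ => le_rfl)).mono
      (M * D) (by positivity) fun _ z => ?_
    change Λ z.1 ^ (a / 2) * Λ z.2.1 ^ t' * (Λ z.1 ^ (a / 2) * Λ z.2.2 ^ t') ≤ _
    have h1 := (Real.rpow_pos_of_pos (hp z.1) (a / 2)).le
    have h2 := (Real.rpow_pos_of_pos (hp z.2.1) t').le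
    have h5 := (Real.rpow_pos_of_pos (hp z.1) a).le
    have hm := hmod z.2.2 z.2.1
    rw [← neg_sub, jb_neg] at hm
    have h3 : Λ z.1 ^ (a / 2) * Λ z.1 ^ (a / 2) = Λ z.1 ^ a := by
      rw [← Real.rpow_add (hp _), add_halves]
    have h4 : Λ z.2.1 ^ t' * Λ z.2.1 ^ t' = Λ z.2.1 ^ (2 * t') := by
      rw [← Real.rpow_add (hp _), two_mul]
    have hj := (jb_pos (diffCLM z)).le
    calc Λ z.1 ^ (a / 2) * Λ z.2.1 ^ t' * (Λ z.1 ^ (a / 2) * Λ z.2.2 ^ t')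
        ≤ Λ z.1 ^ (a / 2) * Λ z.2.1 ^ t'
          * (Λ z.1 ^ (a / 2) * (M * Λ z.2.1 ^ t' * jb (z.2.1 - z.2.2) ^ K)) := by gcongr
      _ = M * ((Λ z.1 ^ (a / 2) * Λ z.1 ^ (a / 2)) * (Λ z.2.1 ^ t' * Λ z.2.1 ^ t')
          * jb (diffCLM z) ^ K) := by
          rw [diffCLM_apply]
          ring
      _ = M * (Λ z.1 ^ a * Λ z.2.1 ^ (2 * t') * jb (diffCLM z) ^ K) := by rw [h3, h4]
      _ ≤ M * (Λ z.1 ^ a * (D * Λ z.2.1 ^ (2 * t)) * jb (diffCLM z) ^ K) := by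
          gcongr
          exact hD' _
      _ = _ := by
          rw [Real.rpow_natCast]
          ring
  obtain ⟨C, hC, hC'⟩ := exists_norm_form_le_of_sgBound hΛ hb
  refine ⟨C, hC, fun u => ?_⟩
  have e := tensorForm_sgWt hΛ t' (a / 2) u
  have hle : ‖tensorForm (sgWt Λ t' (a / 2)) (sgWt Λ t' (a / 2)) u‖ ≤ _ := hC' () u
  rw [e, mul_div_cancel₀ a two_ne_zero, mul_div_cancel_left₀ t two_ne_zero, Complex.norm_real,
    Real.norm_of_nonneg (wNorm_nonneg hΛ _ _)] at hle
  exact hle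

/-- The imaginary part of the form of a real symbol is of lower order. -/
lemma exists_abs_im_leftForm_le (hΛ : SGWeight n Λ ρ) {m₁ m₂ : ℝ} {f : En n × En n → ℝ}
    (hf : SGSymbol Λ ρ (2 * m₁) (2 * m₂) f) :
    ∃ C : ℝ, 0 ≤ C ∧ ∀ u,
      |(leftForm f u).im| ≤ C * wNorm Λ (2 * m₂ - ρ) (wMul Λ ((2 * m₁ - ρ) / 2) u) := by
  have hg := SGSymbol.mul hΛ hf (SGSymbol.weight hΛ (-m₁) (-m₂))
  have hb := SGSymbol.weight hΛ m₁ m₂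
  obtain ⟨C, hC, h⟩ := exists_norm_tensorForm_sub_le hΛ hg hb
  obtain ⟨D, hD, h'⟩ := exists_norm_tensorForm_sub_le hΛ hb hg
  have hw : ∀ q, sgWt Λ (-m₁) (-m₂) q * sgWt Λ m₁ m₂ q = 1 := fun q => by
    rw [hΛ.sgWt_mul, neg_add_cancel, neg_add_cancel, sgWt, Real.rpow_zero, Real.rpow_zero, one_mul]
  have e1 : (fun q => f q * sgWt Λ (-m₁) (-m₂) q * sgWt Λ m₁ m₂ q) = f := by
    ext q
    rw [mul_assoc, hw, mul_one]
  have e2 : (fun q => sgWt Λ m₁ m₂ q * (f q * sgWt Λ (-m₁) (-m₂) q)) = f := by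
    ext q
    linear_combination f q * hw q
  refine ⟨(C + D) / 2, by positivity, fun u => ?_⟩
  have h1 := h u
  have h2 := h' u
  rw [e1, show 2 * m₂ + -m₂ + m₂ - ρ = 2 * m₂ - ρ by ring,
    show 2 * m₁ + -m₁ + m₁ - ρ = 2 * m₁ - ρ by ring] at h1
  rw [e2, ← conj_tensorForm, show m₂ + (2 * m₂ + -m₂) - ρ = 2 * m₂ - ρ by ring,
    show m₁ + (2 * m₁ + -m₁) - ρ = 2 * m₁ - ρ by ring] at h2
  have h3 := abs_le.1 ((Complex.abs_im_le_norm _).trans h1)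
  have h4 := abs_le.1 ((Complex.abs_im_le_norm _).trans h2)
  simp only [Complex.sub_im, Complex.conj_im] at h3 h4
  rw [abs_le]
  constructor <;> linarith [h3.1, h3.2, h4.1, h4.2]

lemma exists_garding_form (hΛ : SGWeight n Λ ρ) {m₁ m₂ : ℝ} {σ : En n × En n → ℂ}
    (hσ : SGSymbol Λ ρ (2 * m₁) (2 * m₂) σ) {C R : ℝ} (hC : 0 < C)
    (hell : ∀ q : En n × En n, R ^ 2 ≤ ‖q.1‖ ^ 2 + ‖q.2‖ ^ 2 →
      C * sgWt Λ (2 * m₁) (2 * m₂) q ≤ (σ q).re) :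
    ∃ D : ℝ, 0 ≤ D ∧ ∀ u, C / 2 * wNorm Λ (2 * m₂) (wMul Λ m₁ u)
      - D * wNorm Λ (2 * m₂ - ρ) (wMul Λ ((2 * m₁ - ρ) / 2) u)
      ≤ (form (fun z => σ (z.1, z.2.1)) u).re := by
  have hρ := hΛ.rho_pos
  have hre : SGSymbol Λ ρ (2 * m₁) (2 * m₂) (fun q => (σ q).re) := hσ.clm_comp Complex.reCLM
  have him : SGSymbol Λ ρ (2 * m₁) (2 * m₂) (fun q => (σ q).im) := hσ.clm_comp Complex.imCLM
  have hκ := SGSymbol.weight hΛ (2 * m₁ - ρ) (2 * m₂ - ρ)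
  have hκ' := hκ.mono hΛ (show 2 * m₁ - ρ ≤ 2 * m₁ by linarith)
    (show 2 * m₂ - ρ ≤ 2 * m₂ by linarith)
  have hB := SGSymbol.weight hΛ (2 * m₁) (2 * m₂)
  have hb₀ := SGSymbol.weight hΛ m₁ m₂
  obtain ⟨K, hK⟩ : ∃ K : ℝ, ∀ q ∈ Metric.closedBall (0 : En n × En n) |R|,
      ‖(C * sgWt Λ (2 * m₁) (2 * m₂) q - (σ q).re) / sgWt Λ (2 * m₁ - ρ) (2 * m₂ - ρ) q‖ ≤ K :=
    (isCompact_closedBall 0 |R|).exists_bound_of_continuousOn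
      (((hB.smooth.continuous.const_mul C |>.sub hre.smooth.continuous).div
        hκ.smooth.continuous fun q => (hΛ.sgWt_pos _ _ q).ne').continuousOn)
  set f : En n × En n → ℝ := fun q => (σ q).re + (-(C / 2)) * sgWt Λ (2 * m₁) (2 * m₂) q
    + |K| * sgWt Λ (2 * m₁ - ρ) (2 * m₂ - ρ) q with hfdef
  have hf : SGSymbol Λ ρ (2 * m₁) (2 * m₂) f :=
    (hre.add (hB.const_mul _)).add (hκ'.const_mul _)
  have hlow : ∀ q, C / 2 * sgWt Λ (2 * m₁) (2 * m₂) q ≤ f q := fun q => by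
    have hκ0 := hΛ.sgWt_pos (2 * m₁ - ρ) (2 * m₂ - ρ) q
    by_cases hq : R ^ 2 ≤ ‖q.1‖ ^ 2 + ‖q.2‖ ^ 2
    · have h1 := hell q hq
      have h2 : 0 ≤ |K| * sgWt Λ (2 * m₁ - ρ) (2 * m₂ - ρ) q := by positivity
      simp only [hfdef]
      linarith
    · have hq' : q ∈ Metric.closedBall (0 : En n × En n) |R| := by
        rw [not_le] at hq
        rw [mem_closedBall_zero_iff, Prod.norm_def, max_le_iff]
        constructor <;> refine abs_le_of_sq_le_sq' ?_ (abs_nonneg R) |>.2 <;> rw [sq_abs] <;>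
          nlinarith [sq_nonneg ‖q.1‖, sq_nonneg ‖q.2‖]
      have h1 := (le_abs_self _).trans ((hK q hq').trans (le_abs_self K))
      rw [div_le_iff₀ hκ0] at h1
      simp only [hfdef]
      linarith
  have hb := SGSymbol.rpow hΛ hf (half_pos hC) hlow (1 / 2)
  have hfpos : ∀ q, 0 < f q := fun q =>
    (mul_pos (half_pos hC) (hΛ.sgWt_pos _ _ q)).trans_le (hlow q)
  have hbb : (fun q => f q ^ (1 / 2 : ℝ) * f q ^ (1 / 2 : ℝ)) = f := by
    ext q
    rw [← Real.rpow_add (hfpos q), add_halves, Real.rpow_one]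
  have hb₀b₀ : (fun q => sgWt Λ m₁ m₂ q * sgWt Λ m₁ m₂ q) = sgWt Λ (2 * m₁) (2 * m₂) := by
    ext q
    rw [hΛ.sgWt_mul, two_mul, two_mul]
  obtain ⟨D₁, hD₁, h₁⟩ := exists_norm_tensorForm_sub_le hΛ hb hb
  obtain ⟨D₂, hD₂, h₂⟩ := exists_norm_tensorForm_sub_le hΛ hb₀ hb₀
  obtain ⟨D₃, hD₃, h₃⟩ := exists_norm_leftForm_le hΛ hκ
  obtain ⟨D₄, hD₄, h₄⟩ := exists_abs_im_leftForm_le hΛ him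
  rw [hbb] at h₁
  rw [hb₀b₀] at h₂
  refine ⟨D₁ + C / 2 * D₂ + |K| * D₃ + D₄, by positivity, fun u => ?_⟩
  have i₁ := h₁ u
  have i₂ := h₂ u
  have i₃ := h₃ u
  have i₄ := abs_le.1 (h₄ u)
  rw [show 2 * m₂ * (1 / 2) + 2 * m₂ * (1 / 2) - ρ = 2 * m₂ - ρ by ring,
    show 2 * m₁ * (1 / 2) + 2 * m₁ * (1 / 2) - ρ = 2 * m₁ - ρ by ring] at i₁
  rw [show m₂ + m₂ - ρ = 2 * m₂ - ρ by ring, show m₁ + m₁ - ρ = 2 * m₁ - ρ by ring] at i₂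
  set N := wNorm Λ (2 * m₂ - ρ) (wMul Λ ((2 * m₁ - ρ) / 2) u) with hN
  have j₁ := (abs_le.1 ((Complex.abs_re_le_norm _).trans i₁)).2
  have j₂ := (abs_le.1 ((Complex.abs_re_le_norm _).trans i₂)).2
  have j₃ := (abs_le.1 ((Complex.abs_re_le_norm _).trans i₃)).2
  rw [Complex.sub_re, tensorForm_self, Complex.ofReal_re] at j₁
  rw [Complex.sub_re, tensorForm_sgWt hΛ, Complex.ofReal_re] at j₂
  have pos₁ : 0 ≤ ∫ x, ‖invF (fun ξ => ((f (x, ξ) ^ (1 / 2 : ℝ) : ℝ) : ℂ) * u ξ) x‖ ^ 2 :=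
    integral_nonneg fun x => by positivity
  have lin : form (fun z => σ (z.1, z.2.1)) u = leftForm f u
      + ((C / 2 : ℝ) : ℂ) * leftForm (sgWt Λ (2 * m₁) (2 * m₂)) u
      + ((-|K| : ℝ) : ℂ) * leftForm (sgWt Λ (2 * m₁ - ρ) (2 * m₂ - ρ)) u
      + Complex.I * leftForm (fun q => (σ q).im) u := by
    have t1 := hf.ofReal.temperate_left hΛ
    have t2 := (hB.ofReal.temperate_left hΛ).const_mul ((C / 2 : ℝ) : ℂ)
    have t3 := (hκ.ofReal.temperate_left hΛ).const_mul ((-|K| : ℝ) : ℂ)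
    have t4 := (him.ofReal.temperate_left hΛ).const_mul Complex.I
    unfold leftForm
    rw [← form_const_mul, ← form_const_mul, ← form_const_mul, ← form_add t1 t2 (),
      ← form_add (t1.add t2) t3 (), ← form_add ((t1.add t2).add t3) t4 ()]
    congr 1
    ext z
    have hz := Complex.re_add_im (σ (z.1, z.2.1))
    simp only [hfdef]
    push_cast
    linear_combination -hz
  rw [lin]
  simp only [Complex.add_re, Complex.re_ofReal_mul, Complex.I_mul_re]
  have k₂ := mul_le_mul_of_nonneg_left j₂ (half_pos hC).le
  have k₃ := mul_le_mul_of_nonneg_left j₃ (abs_nonneg K)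
  linarith [i₄.2]

/-- Interpolation between weighted norms. -/
lemma exists_interpolation (hΛ : SGWeight n Λ ρ) (m₁ m₂ : ℝ) {s₁ s₂ : ℝ} (h₁ : s₁ ≤ ρ / 2)
    (h₂ : ρ / 2 ≤ s₂) {ε : ℝ} (hε : 0 < ε) : ∃ D : ℝ, 0 < D ∧ ∀ u,
      wNorm Λ (2 * m₂ - ρ) (wMul Λ ((2 * m₁ - ρ) / 2) u)
        ≤ ε * wNorm Λ (2 * m₂) (wMul Λ m₁ u)
          + D * wNorm Λ (2 * (m₂ - s₂)) (wMul Λ (m₁ - s₁) u) := by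
  have hρ := hΛ.rho_pos
  have hp := hΛ.pos
  obtain ⟨A, hA, hA'⟩ := exists_wNorm_le hΛ (2 * m₂) (show (2 * m₁ - ρ) / 2 ≤ m₁ by linarith)
  obtain ⟨B, hB, hB'⟩ := exists_wNorm_le hΛ (2 * (m₂ - s₂))
    (show (2 * m₁ - ρ) / 2 ≤ m₁ - s₁ by linarith)
  set δ := ε / (A + 1) with hδ
  have hδ0 : 0 < δ := by positivity
  set E := (δ⁻¹) ^ ((2 * s₂ - ρ) / ρ) with hE
  have hE0 : 0 < E := Real.rpow_pos_of_pos (by positivity) _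
  have pt : ∀ x, Λ x ^ (2 * m₂ - ρ) ≤ δ * Λ x ^ (2 * m₂) + E * Λ x ^ (2 * (m₂ - s₂)) := by
    intro x
    have p1 := Real.rpow_pos_of_pos (hp x) (2 * m₂)
    have p2 := Real.rpow_pos_of_pos (hp x) (2 * (m₂ - s₂))
    rcases le_total (Λ x ^ (-ρ)) δ with h | h
    · have e : Λ x ^ (2 * m₂ - ρ) = Λ x ^ (-ρ) * Λ x ^ (2 * m₂) := by
        rw [← Real.rpow_add (hp x)]
        ring_nf
      rw [e]
      have := mul_le_mul_of_nonneg_right h p1.le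
      have : 0 ≤ E * Λ x ^ (2 * (m₂ - s₂)) := by positivity
      linarith
    · have e : Λ x ^ (2 * m₂ - ρ) = Λ x ^ (2 * s₂ - ρ) * Λ x ^ (2 * (m₂ - s₂)) := by
        rw [← Real.rpow_add (hp x)]
        ring_nf
      have h5 : Λ x ^ ρ ≤ δ⁻¹ := by
        rw [Real.rpow_neg (hp x).le] at h
        exact (le_inv_comm₀ hδ0 (Real.rpow_pos_of_pos (hp x) ρ)).1 h
      have h6 : Λ x ^ (2 * s₂ - ρ) ≤ E := by
        have h7 : Λ x ^ (2 * s₂ - ρ) = (Λ x ^ ρ) ^ ((2 * s₂ - ρ) / ρ) := by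
          rw [← Real.rpow_mul (hp x).le, mul_div_cancel₀ _ hρ.ne']
        rw [h7]
        exact Real.rpow_le_rpow (Real.rpow_pos_of_pos (hp x) ρ).le h5
          (div_nonneg (by linarith) hρ.le)
      rw [e]
      have := mul_le_mul_of_nonneg_right h6 p2.le
      have : 0 ≤ δ * Λ x ^ (2 * m₂) := by positivity
      linarith
  refine ⟨E * (B + 1), by positivity, fun u => ?_⟩
  set v := wMul Λ ((2 * m₁ - ρ) / 2) u with hv
  have step : wNorm Λ (2 * m₂ - ρ) v
      ≤ δ * wNorm Λ (2 * m₂) v + E * wNorm Λ (2 * (m₂ - s₂)) v := by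
    unfold wNorm
    rw [← integral_const_mul, ← integral_const_mul, ← integral_add
      ((integrable_wNorm hΛ _ v).const_mul _) ((integrable_wNorm hΛ _ v).const_mul _)]
    refine integral_mono (integrable_wNorm hΛ _ v) (((integrable_wNorm hΛ _ v).const_mul _).add
      ((integrable_wNorm hΛ _ v).const_mul _)) fun x => ?_
    have := mul_le_mul_of_nonneg_right (pt x) (sq_nonneg ‖invF v x‖)
    linarith
  have a1 := mul_le_mul_of_nonneg_left (hA' u) hδ0.le
  have a2 := mul_le_mul_of_nonneg_left (hB' u) hE0.le
  have n1 := wNorm_nonneg hΛ (2 * m₂) (wMul Λ m₁ u)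
  have n2 := wNorm_nonneg hΛ (2 * (m₂ - s₂)) (wMul Λ (m₁ - s₁) u)
  have hδA : δ * A ≤ ε := by
    have : δ * (A + 1) = ε := div_mul_cancel₀ ε (by positivity)
    linarith
  have a3 := mul_le_mul_of_nonneg_right hδA n1
  have a4 := mul_nonneg hE0.le n2
  linarith

end Garding

/-! ### Passing to the Fourier side -/

section FourierSide

variable {n : ℕ} {Λ : En n → ℝ} {ρ : ℝ}

open scoped FourierTransform

variable (n) in
/-- The normalising constant `(2π)^{-n/2}` of the Fourier transform. -/
def ftConst : ℝ := (2 * π) ^ (-(n : ℝ) / 2)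

lemma ftConst_sq_mul : ftConst n ^ 2 * (2 * π) ^ n = 1 := by
  have h : (0 : ℝ) < 2 * π := by positivity
  rw [ftConst, ← Real.rpow_natCast, ← Real.rpow_natCast, ← Real.rpow_mul h.le,
    ← Real.rpow_add h]
  convert Real.rpow_zero _ using 2
  push_cast
  ring

variable (n) in
/-- The dilation `ξ ↦ (2π)⁻¹ ξ`. -/
def dilation : En n ≃L[ℝ] En n :=
  ContinuousLinearEquiv.smulLeft (Units.mk0 ((2 * π)⁻¹ : ℝ) (by positivity))

/-- The transform `ft φ` of a Schwartz function, as a Schwartz function. -/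
def ftS (φ : SchwartzMap (En n) ℂ) : SchwartzMap (En n) ℂ :=
  (ftConst n : ℂ) • SchwartzMap.compCLMOfContinuousLinearEquiv ℂ (dilation n) (𝓕 φ)

lemma ftS_apply (φ : SchwartzMap (En n) ℂ) (ξ : En n) :
    ftS φ ξ = (ftConst n : ℂ) * 𝓕 φ ((2 * π)⁻¹ • ξ) := rfl

lemma ft_eq (φ : SchwartzMap (En n) ℂ) (ξ : En n) : ft φ ξ = ftS φ ξ := by
  rw [ftS_apply, SchwartzMap.fourier_coe, Real.fourier_eq', ft, ftConst]
  congr 2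
  ext x
  rw [smul_eq_mul, real_inner_smul_right]
  congr 2
  have : (2 * (π : ℂ)) ≠ 0 := by exact_mod_cast (by positivity : (2 * π : ℝ) ≠ 0)
  push_cast
  field_simp

lemma ftConst_mul_invF (φ : SchwartzMap (En n) ℂ) (x : En n) :
    (ftConst n : ℂ) * invF (ftS φ) x = φ x := by
  have h2 : (0 : ℝ) ≤ 2 * π := by positivity
  have h3 : (2 * (π : ℂ)) ≠ 0 := by exact_mod_cast (by positivity : (2 * π : ℝ) ≠ 0)
  set g : En n → ℂ := fun t => (ftConst n : ℂ) *
    (Complex.exp (((2 * π * ⟪t, x⟫ : ℝ) : ℂ) * Complex.I) * 𝓕 φ t) with hg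
  have h : invF (ftS φ) x = ∫ ξ, g ((2 * π)⁻¹ • ξ) := by
    unfold invF
    congr 1
    ext ξ
    have h4 : Complex.I * ((⟪ξ, x⟫ : ℝ) : ℂ)
        = ((2 * π * ((2 * π)⁻¹ * ⟪ξ, x⟫) : ℝ) : ℂ) * Complex.I := by
      push_cast
      field_simp
    rw [ftS_apply, ph, real_inner_comm, h4, hg]
    beta_reduce
    rw [real_inner_smul_left]
    ring
  have hinv : ∫ t, Complex.exp (((2 * π * ⟪t, x⟫ : ℝ) : ℂ) * Complex.I) * 𝓕 φ t = φ x := by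
    have h4 : 𝓕⁻ (𝓕 φ) x = φ x := by rw [FourierTransform.fourierInv_fourier_eq]
    rw [SchwartzMap.fourierInv_coe, Real.fourierInv_eq'] at h4
    exact h4
  rw [h, Measure.integral_comp_inv_smul_of_nonneg volume g h2, hg, integral_const_mul, hinv,
    finrank_euclideanSpace_fin, Complex.real_smul]
  have h5 : ((ftConst n : ℂ)) ^ 2 * (((2 * π) ^ n : ℝ) : ℂ) = 1 := by
    exact_mod_cast ftConst_sq_mul (n := n)
  linear_combination (φ x) * h5

lemma integral_pdo_mul_conj (σ : En n → En n → ℂ) (φ : SchwartzMap (En n) ℂ) :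
    ∫ x, pdo σ φ x * (starRingEnd ℂ) (φ x)
      = ((ftConst n ^ 2 : ℝ) : ℂ) * form (fun z => σ z.1 z.2.1) (ftS φ) := by
  rw [form, ← integral_const_mul]
  congr 1
  ext x
  have h := amp_tensor σ (fun _ _ => 1) (ftS φ) x
  simp only [map_one, mul_one, one_mul] at h
  have hp : pdo σ φ x = (ftConst n : ℂ) * invF (fun ξ => σ x ξ * ftS φ ξ) x := by
    unfold pdo invF
    simp only [ft_eq, ph, mul_assoc]
    rfl
  rw [h, hp, ← ftConst_mul_invF φ x, map_mul, Complex.conj_ofReal]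
  push_cast
  ring

lemma sgNormSq_eq (hΛ : SGWeight n Λ ρ) (s₁ s₂ : ℝ) (φ : SchwartzMap (En n) ℂ) :
    sgNormSq Λ s₁ s₂ φ = ftConst n ^ 2 * wNorm Λ (2 * s₂) (wMul Λ s₁ (ftS φ)) := by
  rw [sgNormSq, wNorm, ← integral_const_mul]
  congr 1
  ext x
  have h : ∫ ξ, Complex.exp (Complex.I * ((⟪x, ξ⟫ : ℝ) : ℂ)) * ((Λ ξ ^ s₁ : ℝ) : ℂ) * ft φ ξ
      = invF (wMul Λ s₁ (ftS φ)) x := by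
    unfold invF
    simp only [ft_eq, ph, hΛ.wMul_apply, mul_assoc]
  rw [h, norm_mul, norm_mul, Complex.norm_real, Complex.norm_real, mul_pow, mul_pow,
    Real.norm_eq_abs, Real.norm_eq_abs, sq_abs, sq_abs, ← Real.rpow_natCast (Λ x ^ s₂),
    ← Real.rpow_mul (hΛ.pos x).le, ftConst, mul_comm s₂]
  push_cast
  ring

end FourierSide

end SGGarding

/-- Gårding's inequality for SG M-elliptic operators. -/
theorem garding_SG_M_elliptic (n : ℕ) (hn : 1 ≤ n)
    (Λ : En n → ℝ) (μ₀ μ₁ μ ρ : ℝ)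
    (hw : IsWeight n Λ μ₀ μ₁ μ) (hρ : 0 < ρ) (hρμ : ρ ≤ 1 / μ)
    (m₁ m₂ : ℝ) (σ : En n → En n → ℂ) (hσ : SGMClass Λ ρ (2 * m₁) (2 * m₂) σ)
    (C R : ℝ) (hC : 0 < C) (hR : 0 < R)
    (hell : ∀ x ξ : En n, R ^ 2 ≤ ‖x‖ ^ 2 + ‖ξ‖ ^ 2 →
      C * Λ x ^ (2 * m₂) * Λ ξ ^ (2 * m₁) ≤ (σ x ξ).re) :
    ∃ C' > 0, ∀ s₁ s₂ : ℝ, s₁ ≤ ρ / 2 → ρ / 2 ≤ s₂ →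
      ∃ Cs > 0, ∀ φ : SchwartzMap (En n) ℂ,
        C' * sgNormSq Λ m₁ m₂ (⇑φ) - Cs * sgNormSq Λ (m₁ - s₁) (m₂ - s₂) (⇑φ) ≤
          (∫ (x : En n), pdo σ (⇑φ) x * (starRingEnd ℂ) (φ x)).re := by
  have hΛ := SGGarding.SGWeight.of_isWeight hw hρ hρμ
  obtain ⟨D, hD, hform⟩ := SGGarding.exists_garding_form hΛ
    (SGGarding.SGSymbol.of_sgmClass hΛ hσ) hC (R := R)
    (fun q hq => by simpa only [SGGarding.sgWt, mul_assoc] using hell q.1 q.2 hq)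
  refine ⟨C / 4, by positivity, fun s₁ s₂ h₁ h₂ => ?_⟩
  have hε : 0 < C / (4 * (D + 1)) := by positivity
  obtain ⟨K, hK, hinterp⟩ := SGGarding.exists_interpolation hΛ m₁ m₂ h₁ h₂ hε
  refine ⟨(D + 1) * K, by positivity, fun φ => ?_⟩
  rw [SGGarding.integral_pdo_mul_conj, SGGarding.sgNormSq_eq hΛ, SGGarding.sgNormSq_eq hΛ,
    Complex.re_ofReal_mul]
  set A := SGGarding.wNorm Λ (2 * m₂) (SGGarding.wMul Λ m₁ (SGGarding.ftS φ))
  set B := SGGarding.wNorm Λ (2 * (m₂ - s₂)) (SGGarding.wMul Λ (m₁ - s₁) (SGGarding.ftS φ))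
  have h := hform (SGGarding.ftS φ)
  have h' := mul_le_mul_of_nonneg_left (hinterp (SGGarding.ftS φ))
    (by positivity : (0 : ℝ) ≤ D + 1)
  have hnn := SGGarding.wNorm_nonneg hΛ (2 * m₂ - ρ)
    (SGGarding.wMul Λ ((2 * m₁ - ρ) / 2) (SGGarding.ftS φ))
  have hc : (D + 1) * (C / (4 * (D + 1)) * A) = C / 4 * A := by
    field_simp
  calc C / 4 * (SGGarding.ftConst n ^ 2 * A) - (D + 1) * K * (SGGarding.ftConst n ^ 2 * B)
      = SGGarding.ftConst n ^ 2 * (C / 4 * A - (D + 1) * K * B) := by ring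
    _ ≤ _ := by
      gcongr
      linarith

end
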